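/- There exist constants ε₀ ∈ (0,1/2) and c₀ > 0, depending only on n ≥ 2, with the following property. Let E ⊆ ℝⁿ be an open bounded set with |E| = |B| and bar(E) = 0 whose boundary is ∂E = {(1+u(x))x : x ∈ ∂B} for a Lipschitz function u : ∂B → ℝ with ‖u‖_{W^{1,∞}(∂B)} < ε₀. Then for every s ∈ (0,1): P_s(E) − P_s(B) ≥ c₀·( [u]²_{(1+s)/2} + s·P_s(B)·‖u‖²_{L²(∂B)} ), where [u]²_{(1+s)/2} = ∬_{∂B×∂B} |u(x) − u(y)|²/|x−y|^{n+s} dH^{n−1}_x dH^{n−1}_y. -/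

import Mathlib

open MeasureTheory Metric Bornology
open scoped ENNReal symmDiff

/-- The fractional `s`-perimeter of a set `E ⊆ ℝⁿ`:
`P_s(E) = ∫_E ∫_{Eᶜ} |x - y|^{-(n+s)} dx dy`. -/
noncomputable def fracPer (n : ℕ) (s : ℝ) (E : Set (EuclideanSpace ℝ (Fin n))) : ℝ≥0∞ :=
  ∫⁻ x in E, ∫⁻ y in Eᶜ, ENNReal.ofReal (‖x - y‖ ^ (-((n : ℝ) + s)))

/-- The radius of the ball centered at the origin with the same volume as `E`. -/
noncomputable def matchRad (n : ℕ) (E : Set (EuclideanSpace ℝ (Fin n))) : ℝ :=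
  ((volume E).toReal / (volume (ball (0 : EuclideanSpace ℝ (Fin n)) 1)).toReal) ^ ((1 : ℝ) / n)

/-- The `s`-isoperimetric deficit `δ_s(E) = (P_s(E) - P_s(B(m)))/P_s(B(m))`, where `B(m)` is the
ball centered at the origin with `|B(m)| = |E|`. -/
noncomputable def sDeficit (n : ℕ) (s : ℝ) (E : Set (EuclideanSpace ℝ (Fin n))) : ℝ :=
  ((fracPer n s E).toReal
      - (fracPer n s (ball (0 : EuclideanSpace ℝ (Fin n)) (matchRad n E))).toReal)
    / (fracPer n s (ball (0 : EuclideanSpace ℝ (Fin n)) (matchRad n E))).toReal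

/-- The barycenter `bar(E) = (1/|E|) ∫_E x dx`. -/
noncomputable def barycenter (n : ℕ) (E : Set (EuclideanSpace ℝ (Fin n))) :
    EuclideanSpace ℝ (Fin n) :=
  ((volume E).toReal)⁻¹ • ∫ x in E, x

/-- The barycentric asymmetry `λ₀(E) = |E ∆ (bar(E) + B(m))| / |E|`. -/
noncomputable def barAsym (n : ℕ) (E : Set (EuclideanSpace ℝ (Fin n))) : ℝ :=
  (volume (E ∆ ball (barycenter n E) (matchRad n E))).toReal / (volume E).toReal

namespace FracFuglede

open Set Filter Topology
open scoped RealInnerProductSpace Pointwise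

/-- Euclidean space of dimension `n`. -/
abbrev V (n : ℕ) := EuclideanSpace ℝ (Fin n)

/-- The surface measure of the unit sphere, as a measure on the ambient space. -/
noncomputable def sph (n : ℕ) : Measure (V n) :=
  ((volume : Measure (V n)).toSphere).map Subtype.val

instance (n : ℕ) : IsFiniteMeasure (sph n) := by
  unfold sph; infer_instance

lemma sph_apply {n : ℕ} {A : Set (V n)} (hA : MeasurableSet A) :
    sph n A = n * volume (Ioo (0 : ℝ) 1 • (A ∩ sphere (0 : V n) 1)) := by
  rw [sph, Measure.map_apply measurable_subtype_coe hA,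
    Measure.toSphere_apply' _ (measurable_subtype_coe hA)]
  simp [Subtype.image_preimage_coe, inter_comm]

lemma sph_ae_sphere (n : ℕ) : ∀ᵐ x ∂sph n, x ∈ sphere (0 : V n) 1 := by
  have h : MeasurableSet (sphere (0 : V n) 1)ᶜ := isClosed_sphere.measurableSet.compl
  show sph n (sphere (0 : V n) 1)ᶜ = 0
  rw [sph_apply h]
  simp

lemma sph_ae_norm (n : ℕ) : ∀ᵐ x ∂sph n, ‖x‖ = 1 := by
  filter_upwards [sph_ae_sphere n] with x hx
  simpa using hx

lemma sph_univ_ne_zero {n : ℕ} (hn : 1 ≤ n) : sph n univ ≠ 0 := by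
  have : Nonempty (Fin n) := ⟨⟨0, hn⟩⟩
  rw [sph, Measure.map_apply measurable_subtype_coe MeasurableSet.univ]
  simp only [preimage_univ]
  rw [ne_eq, Measure.measure_univ_eq_zero]
  exact (Measure.toSphere_ne_zero (volume : Measure (V n)))

lemma sph_map_isometry {n : ℕ} (R : V n ≃ₗᵢ[ℝ] V n) :
    MeasurePreserving R (sph n) (sph n) := by
  refine ⟨R.continuous.measurable, ?_⟩
  ext A hA
  rw [Measure.map_apply R.continuous.measurable hA, sph_apply hA,
    sph_apply (R.continuous.measurable hA)]
  congr 1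
  have : Ioo (0 : ℝ) 1 • (R ⁻¹' A ∩ sphere (0 : V n) 1)
      = R ⁻¹' (Ioo (0 : ℝ) 1 • (A ∩ sphere (0 : V n) 1)) := by
    ext z
    simp only [Set.mem_smul, mem_inter_iff, mem_preimage, mem_sphere_iff_norm, sub_zero]
    constructor
    · rintro ⟨r, hr, y, ⟨hy, hy1⟩, rfl⟩
      exact ⟨r, hr, R y, ⟨hy, by simpa using hy1⟩, by simp⟩
    · rintro ⟨r, hr, y, ⟨hy, hy1⟩, h⟩
      refine ⟨r, hr, R.symm y, ⟨by simpa using hy, by simpa using hy1⟩, ?_⟩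
      apply R.injective
      simp [h]
  rw [this]
  exact R.measurePreserving.measure_preimage_equiv (f := R.toMeasurableEquiv) _

lemma lintegral_polar {n : ℕ} (hn : 1 ≤ n) {f : V n → ℝ≥0∞} (hf : Measurable f) :
    ∫⁻ z, f z = ∫⁻ x, (∫⁻ r in Ioi (0 : ℝ), ENNReal.ofReal (r ^ (n - 1)) * f (r • x)) ∂sph n := by
  have : Nonempty (Fin n) := ⟨⟨0, hn⟩⟩
  have h1 := (Measure.measurePreserving_homeomorphUnitSphereProd (volume : Measure (V n))).symm
    (e := (homeomorphUnitSphereProd (V n)).toMeasurableEquiv)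
  have hfm : Measurable fun p : sphere (0 : V n) 1 × Ioi (0 : ℝ) => f (p.2.1 • p.1.1) := by
    fun_prop
  have hm : Measurable fun p : V n × ℝ => ENNReal.ofReal (p.2 ^ (n - 1)) * f (p.2 • p.1) := by
    fun_prop
  calc ∫⁻ z, f z = ∫⁻ z in ({0}ᶜ : Set (V n)), f z := by
        rw [MeasureTheory.restrict_compl_singleton]
    _ = ∫⁻ z : ({0}ᶜ : Set (V n)), f z ∂((volume : Measure (V n)).comap Subtype.val) := by
        rw [lintegral_subtype_comap (measurableSet_singleton _).compl]
    _ = ∫⁻ p, f (p.2.1 • p.1.1) ∂((volume : Measure (V n)).toSphere.prod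
          (Measure.volumeIoiPow (n - 1))) := by
        have h2 := h1.lintegral_comp_emb (MeasurableEquiv.measurableEmbedding _)
          (fun z : ({0}ᶜ : Set (V n)) => f z)
        rw [finrank_euclideanSpace_fin] at h2
        rw [← h2]
        rfl
    _ = ∫⁻ x, (∫⁻ r in Ioi (0 : ℝ), ENNReal.ofReal (r ^ (n - 1)) * f (r • x)) ∂sph n := by
        rw [lintegral_prod _ hfm.aemeasurable, sph, lintegral_map _ measurable_subtype_coe]
        · refine lintegral_congr fun x => ?_
          rw [Measure.volumeIoiPow, lintegral_withDensity_eq_lintegral_mul _ (by fun_prop)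
            (by fun_prop)]
          rw [← lintegral_subtype_comap measurableSet_Ioi]
          rfl
        · exact Measurable.lintegral_prod_right (f := fun x r =>
            ENNReal.ofReal (r ^ (n - 1)) * f (r • x)) hm

/-- Zonal functions have integrals independent of the pole. -/
lemma exists_isometry {n : ℕ} {x x' : V n} (hx : ‖x‖ = 1) (hx' : ‖x'‖ = 1) :
    ∃ R : V n ≃ₗᵢ[ℝ] V n, R x = x' := by
  refine ⟨(ℝ ∙ (x - x'))ᗮ.reflection, ?_⟩
  exact Submodule.reflection_sub (by rw [hx, hx'])

lemma lintegral_zonal {n : ℕ} {x x' : V n} (hx : ‖x‖ = 1) (hx' : ‖x'‖ = 1) (φ : ℝ → ℝ≥0∞) :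
    ∫⁻ y, φ ⟪x, y⟫ ∂sph n = ∫⁻ y, φ ⟪x', y⟫ ∂sph n := by
  obtain ⟨R, rfl⟩ := exists_isometry hx' hx
  rw [← (sph_map_isometry R).lintegral_comp_emb R.toMeasurableEquiv.measurableEmbedding]
  simp [LinearIsometryEquiv.inner_map_map]

lemma integral_zonal {n : ℕ} {x x' : V n} (hx : ‖x‖ = 1) (hx' : ‖x'‖ = 1) (φ : ℝ → ℝ) :
    ∫ y, φ ⟪x, y⟫ ∂sph n = ∫ y, φ ⟪x', y⟫ ∂sph n := by
  obtain ⟨R, rfl⟩ := exists_isometry hx' hx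
  rw [← (sph_map_isometry R).integral_comp R.toMeasurableEquiv.measurableEmbedding]
  simp [LinearIsometryEquiv.inner_map_map]

lemma sph_closedBall_aux {n : ℕ} (hn : 1 ≤ n) {x : V n} (hx : ‖x‖ = 1) {r : ℝ} (hr : 0 < r)
    (hr1 : r ≤ 1) :
    ENNReal.ofReal ((r / 4) ^ n) * volume (ball (0 : V n) 1)
      ≤ sph n (closedBall x r) * ENNReal.ofReal (r / 2) := by
  have : Nonempty (Fin n) := ⟨⟨0, hn⟩⟩
  set z : V n := (1 - r / 4) • x with hz
  have h1 : volume (ball z (r / 4))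
      = ENNReal.ofReal ((r / 4) ^ n) * volume (ball (0 : V n) 1) := by
    rw [Measure.addHaar_ball _ _ (by positivity), finrank_euclideanSpace_fin]
  rw [← h1, ← lintegral_indicator_one measurableSet_ball,
    lintegral_polar hn (measurable_one.indicator measurableSet_ball)]
  have key : ∀ y : V n, ‖y‖ = 1 → ∀ ρ : ℝ, 0 < ρ → ρ • y ∈ ball z (r / 4) →
      y ∈ closedBall x r ∧ ρ ∈ Ioo (1 - r / 2) 1 := by
    intro y hy ρ hρ h
    rw [mem_ball_iff_norm] at h
    have hzn : ‖z‖ = 1 - r / 4 := by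
      rw [hz, norm_smul, hx, Real.norm_of_nonneg (by linarith), mul_one]
    have hρn : ‖ρ • y‖ = ρ := by rw [norm_smul, hy, Real.norm_of_nonneg hρ.le, mul_one]
    have h2 := abs_norm_sub_norm_le (ρ • y) z
    rw [hzn, hρn] at h2
    have h3 := abs_lt.1 (h2.trans_lt h)
    refine ⟨?_, by constructor <;> linarith [h3.1, h3.2]⟩
    rw [mem_closedBall_iff_norm]
    have e : y - x = (1 - ρ) • y + (ρ • y - z) - (r / 4) • x := by
      rw [hz]; module
    rw [e]
    refine (norm_sub_le _ _).trans ?_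
    have h4 := norm_add_le ((1 - ρ) • y) (ρ • y - z)
    have h5 : ‖(1 - ρ) • y‖ = 1 - ρ := by
      rw [norm_smul, hy, Real.norm_of_nonneg (by linarith [h3.1, h3.2]), mul_one]
    have h6 : ‖(r / 4) • x‖ = r / 4 := by
      rw [norm_smul, hx, Real.norm_of_nonneg (by linarith), mul_one]
    linarith [h3.1]
  calc _ ≤ ∫⁻ y, (closedBall x r).indicator (fun _ => ENNReal.ofReal (r / 2)) y ∂sph n := by
        refine lintegral_mono_ae ?_
        filter_upwards [sph_ae_norm n] with y hy
        by_cases hy' : y ∈ closedBall x r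
        · rw [indicator_of_mem hy']
          calc _ ≤ ∫⁻ ρ in Ioi (0 : ℝ), (Ioo (1 - r / 2) 1).indicator 1 ρ := by
                refine setLIntegral_mono (measurable_one.indicator measurableSet_Ioo) ?_
                intro ρ hρ
                by_cases hb : ρ • y ∈ ball z (r / 4)
                · rw [indicator_of_mem hb, indicator_of_mem (key y hy ρ hρ hb).2]
                  simp only [Pi.one_apply, mul_one]
                  rw [ENNReal.ofReal_le_one]
                  exact pow_le_one₀ (le_of_lt hρ) (key y hy ρ hρ hb).2.2.le
                · rw [indicator_of_notMem hb]; simp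
            _ ≤ ∫⁻ ρ, (Ioo (1 - r / 2) 1).indicator 1 ρ := setLIntegral_le_lintegral _ _
            _ = ENNReal.ofReal (r / 2) := by
                rw [lintegral_indicator_one measurableSet_Ioo, Real.volume_Ioo]
                congr 1; ring
        · rw [indicator_of_notMem hy', nonpos_iff_eq_zero]
          refine setLIntegral_eq_zero measurableSet_Ioi ?_
          intro ρ hρ
          simp only [Pi.zero_apply]
          rw [indicator_of_notMem fun hb => hy' (key y hy ρ hρ hb).1]
          simp
    _ = _ := by
        rw [lintegral_indicator_const measurableSet_closedBall, mul_comm]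

lemma sph_closedBall_lower {n : ℕ} (hn : 1 ≤ n) :
    ∃ K : ℝ≥0∞, K ≠ ∞ ∧ ∀ x : V n, ‖x‖ = 1 → ∀ r : ℝ, 0 < r → r ≤ 1 →
      ENNReal.ofReal r ^ ((n : ℝ) - 1) ≤ K * sph n (closedBall x r) := by
  have : Nonempty (Fin n) := ⟨⟨0, hn⟩⟩
  have hb0 : volume (ball (0 : V n) 1) ≠ 0 := (measure_ball_pos _ _ one_pos).ne'
  have hbt : volume (ball (0 : V n) 1) ≠ ∞ := measure_ball_lt_top.ne
  refine ⟨ENNReal.ofReal (4 ^ n / 2) * (volume (ball (0 : V n) 1))⁻¹,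
    ENNReal.mul_ne_top ENNReal.ofReal_ne_top (ENNReal.inv_ne_top.2 hb0), ?_⟩
  intro x hx r hr hr1
  have h := sph_closedBall_aux hn hx hr hr1
  have e : ENNReal.ofReal r ^ ((n : ℝ) - 1) = ENNReal.ofReal (r ^ (n - 1)) := by
    rw [ENNReal.ofReal_rpow_of_pos hr]
    congr 1
    rw [← Real.rpow_natCast, Nat.cast_sub hn, Nat.cast_one]
  rw [e]
  have h2 : r ^ (n - 1) = (4 ^ n / 2) * ((r / 4) ^ n) * (r / 2)⁻¹ := by
    obtain ⟨m, rfl⟩ : ∃ m, n = m + 1 := ⟨n - 1, by omega⟩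
    simp only [Nat.add_sub_cancel, div_pow, pow_succ]
    field_simp
  rw [h2, ENNReal.ofReal_mul (by positivity), ENNReal.ofReal_mul (by positivity),
    ENNReal.ofReal_inv_of_pos (by positivity), mul_assoc, mul_assoc]
  refine mul_le_mul_right ?_ _
  have h3 : ENNReal.ofReal (r / 2) ≠ 0 := by simp [hr]
  calc ENNReal.ofReal ((r / 4) ^ n) * (ENNReal.ofReal (r / 2))⁻¹
      = (volume (ball (0 : V n) 1))⁻¹ * (ENNReal.ofReal ((r / 4) ^ n) * volume (ball (0 : V n) 1))
          * (ENNReal.ofReal (r / 2))⁻¹ := by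
        rw [mul_comm (ENNReal.ofReal ((r / 4) ^ n)) (volume _), ← mul_assoc _ (volume _),
          ENNReal.inv_mul_cancel hb0 hbt, one_mul]
    _ ≤ (volume (ball (0 : V n) 1))⁻¹ * (sph n (closedBall x r) * ENNReal.ofReal (r / 2))
          * (ENNReal.ofReal (r / 2))⁻¹ := by gcongr
    _ = _ := by
        rw [mul_assoc, mul_assoc, ENNReal.mul_inv_cancel h3 ENNReal.ofReal_ne_top, mul_one]

lemma hausdorff_le_sph {n : ℕ} (hn : 1 ≤ n) :
    ∃ K : ℝ≥0∞, K ≠ ∞ ∧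
      (μH[(n : ℝ) - 1] : Measure (V n)).restrict (sphere (0 : V n) 1) ≤ K • sph n := by
  obtain ⟨K, hK, h⟩ := sph_closedBall_lower hn
  have hd : (0 : ℝ) ≤ (n : ℝ) - 1 := by
    have : (1 : ℝ) ≤ n := by exact_mod_cast hn
    linarith
  refine ⟨ENNReal.ofReal 10 ^ ((n : ℝ) - 1) * K,
    ENNReal.mul_ne_top (ENNReal.rpow_ne_top_of_nonneg hd ENNReal.ofReal_ne_top) hK, ?_⟩
  rw [Measure.le_iff]
  intro A₀ hA₀
  rw [Measure.restrict_apply hA₀]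
  set A := A₀ ∩ sphere (0 : V n) 1 with hA
  have hAS : ∀ x ∈ A, ‖x‖ = 1 := fun x hx => by simpa using hx.2
  suffices μH[(n : ℝ) - 1] A ≤ ENNReal.ofReal 10 ^ ((n : ℝ) - 1) * K * sph n A by
    refine this.trans ?_
    rw [Measure.smul_apply, smul_eq_mul]
    gcongr
    exact inter_subset_left
  have main : ∀ ε : ℝ≥0∞, ε ≠ 0 → μH[(n : ℝ) - 1] A
      ≤ ENNReal.ofReal 10 ^ ((n : ℝ) - 1) * K * (sph n A + ε) := by
    intro ε hε
    obtain ⟨U, hAU, hU, hUA⟩ := A.exists_isOpen_le_add (sph n) hε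
    have cover : ∀ k : ℕ, ∃ v : Set (V n), ∃ ρ : V n → ℝ, v.Countable ∧
        (∀ b ∈ v, ediam (closedBall b (5 * ρ b)) ≤ ENNReal.ofReal (10 / ((k : ℝ) + 1))) ∧
        (A ⊆ ⋃ b : v, closedBall (b : V n) (5 * ρ b)) ∧
        ∑' b : v, ediam (closedBall (b : V n) (5 * ρ b)) ^ ((n : ℝ) - 1)
          ≤ ENNReal.ofReal 10 ^ ((n : ℝ) - 1) * K * sph n U := by
      intro k
      have hk : (0 : ℝ) < 1 / ((k : ℝ) + 1) := by positivity
      have hk1 : 1 / ((k : ℝ) + 1) ≤ 1 := by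
        rw [div_le_one (by positivity)]; linarith [k.cast_nonneg (α := ℝ)]
      have hρ : ∀ x : V n, ∃ ρ : ℝ, 0 < ρ ∧ ρ ≤ 1 / ((k : ℝ) + 1) ∧
          (x ∈ A → closedBall x ρ ⊆ U) := by
        intro x
        by_cases hx : x ∈ A
        · obtain ⟨δ, hδ, hδU⟩ := Metric.nhds_basis_closedBall.mem_iff.1 (hU.mem_nhds (hAU hx))
          refine ⟨min δ (1 / ((k : ℝ) + 1)), lt_min hδ hk, min_le_right _ _, fun _ => ?_⟩
          exact (closedBall_subset_closedBall (min_le_left _ _)).trans hδU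
        · exact ⟨_, hk, le_rfl, fun h => absurd h hx⟩
      choose ρ hρ0 hρk hρU using hρ
      obtain ⟨v, hvA, hvd, hv⟩ := Vitali.exists_disjoint_subfamily_covering_enlargement_closedBall
        A (fun x => x) ρ (1 / ((k : ℝ) + 1)) (fun a _ => hρk a) 5 (by norm_num)
      have hpos : ∀ b ∈ v, 0 < sph n (closedBall b (ρ b)) := by
        intro b hb
        have h' := h b (hAS b (hvA hb)) (ρ b) (hρ0 b) ((hρk b).trans hk1)
        rw [pos_iff_ne_zero]
        intro h0
        rw [h0, mul_zero, nonpos_iff_eq_zero, ENNReal.rpow_eq_zero_iff] at h'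
        rcases h' with h' | h'
        · simp [not_le.2 (hρ0 b)] at h'
        · exact ENNReal.ofReal_ne_top h'.1
      have hdisj : Pairwise (Function.onFun Disjoint fun b : v => closedBall (b : V n) (ρ b)) :=
        fun a b hab => hvd a.2 b.2 (fun hh => hab (Subtype.ext hh))
      have hcount : v.Countable := by
        have := Measure.countable_meas_pos_of_disjoint_iUnion (μ := sph n)
          (As := fun b : v => closedBall (b : V n) (ρ b))
          (fun b => measurableSet_closedBall) hdisj
        have h2 : {b : v | 0 < sph n (closedBall (b : V n) (ρ b))} = univ :=
          eq_univ_of_forall fun b => hpos b b.2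
        rw [h2, countable_univ_iff] at this
        exact this
      have hdiam : ∀ b : V n, ediam (closedBall b (5 * ρ b)) ≤ ENNReal.ofReal (10 * ρ b) := by
        intro b
        rw [Metric.closedEBall_ofReal (by linarith [hρ0 b]) |>.symm]
        refine Metric.ediam_closedEBall_le.trans (le_of_eq ?_)
        rw [← ENNReal.ofReal_ofNat 2, ← ENNReal.ofReal_mul (by norm_num)]
        ring_nf
      refine ⟨v, ρ, hcount, ?_, ?_, ?_⟩
      · intro b _
        refine (hdiam b).trans (ENNReal.ofReal_le_ofReal ?_)
        have := hρk b
        calc 10 * ρ b ≤ 10 * (1 / ((k : ℝ) + 1)) := by gcongr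
          _ = _ := by ring
      · intro a ha
        obtain ⟨b, hb, hab⟩ := hv a ha
        exact mem_iUnion.2 ⟨⟨b, hb⟩, hab (mem_closedBall_self (hρ0 a).le)⟩
      · calc _ ≤ ∑' b : v, ENNReal.ofReal 10 ^ ((n : ℝ) - 1) * K
                * sph n (closedBall (b : V n) (ρ b)) := by
              refine ENNReal.tsum_le_tsum fun b => ?_
              calc _ ≤ ENNReal.ofReal (10 * ρ b) ^ ((n : ℝ) - 1) := by
                    gcongr; exact hdiam b
                _ = ENNReal.ofReal 10 ^ ((n : ℝ) - 1) * ENNReal.ofReal (ρ b) ^ ((n : ℝ) - 1) := by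
                    rw [ENNReal.ofReal_mul (by norm_num), ENNReal.mul_rpow_of_nonneg _ _ hd]
                _ ≤ _ := by
                    rw [mul_assoc]
                    gcongr
                    exact h b (hAS b (hvA b.2)) (ρ b) (hρ0 b) ((hρk b).trans hk1)
          _ = ENNReal.ofReal 10 ^ ((n : ℝ) - 1) * K
                * ∑' b : v, sph n (closedBall (b : V n) (ρ b)) := ENNReal.tsum_mul_left
          _ ≤ _ := by
              gcongr
              refine (tsum_meas_le_meas_iUnion_of_disjoint (sph n)
                (fun b => measurableSet_closedBall) hdisj).trans (measure_mono ?_)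
              exact iUnion_subset fun b => hρU b (hvA b.2)
    choose v ρ hvc hvd hvA hvs using cover
    have : ∀ k, Countable (v k) := fun k => (hvc k).to_subtype
    have hlim : Tendsto (fun k : ℕ => ENNReal.ofReal (10 / ((k : ℝ) + 1))) atTop (𝓝 0) := by
      have hlim0 : Tendsto (fun k : ℕ => (10 : ℝ) / ((k : ℝ) + 1)) atTop (𝓝 0) := by
        have := tendsto_one_div_add_atTop_nhds_zero_nat (𝕜 := ℝ) |>.const_mul 10
        simpa [div_eq_mul_inv] using this
      rw [← ENNReal.ofReal_zero]
      exact (ENNReal.continuous_ofReal.tendsto 0).comp hlim0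
    refine (Measure.hausdorffMeasure_le_liminf_tsum (ι := fun k => v k) ((n : ℝ) - 1) A _ hlim
      (fun k b => closedBall (b : V n) (5 * ρ k b))
      (Eventually.of_forall fun k b => hvd k b b.2) (Eventually.of_forall hvA)).trans ?_
    calc _ ≤ liminf (fun _ : ℕ => ENNReal.ofReal 10 ^ ((n : ℝ) - 1) * K * sph n U) atTop :=
          liminf_le_liminf (Eventually.of_forall hvs)
      _ = ENNReal.ofReal 10 ^ ((n : ℝ) - 1) * K * sph n U := liminf_const _
      _ ≤ _ := by gcongr
  have hC : ENNReal.ofReal 10 ^ ((n : ℝ) - 1) * K ≠ ∞ :=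
    ENNReal.mul_ne_top (ENNReal.rpow_ne_top_of_nonneg hd ENNReal.ofReal_ne_top) hK
  have hlim : Tendsto (fun k : ℕ => ENNReal.ofReal 10 ^ ((n : ℝ) - 1) * K
      * (sph n A + (k : ℝ≥0∞)⁻¹)) atTop
      (𝓝 (ENNReal.ofReal 10 ^ ((n : ℝ) - 1) * K * (sph n A + 0))) :=
    ENNReal.Tendsto.const_mul (tendsto_const_nhds.add ENNReal.tendsto_inv_nat_nhds_zero)
      (Or.inr hC)
  rw [add_zero] at hlim
  exact ge_of_tendsto' hlim fun k => main _ (by simp)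

lemma inter_frontier_nonempty {X : Type*} [TopologicalSpace X] {t E : Set X}
    (ht : IsPreconnected t) (hE : IsOpen E) (h1 : (t ∩ E).Nonempty) (h2 : (t ∩ Eᶜ).Nonempty) :
    (t ∩ frontier E).Nonempty := by
  by_contra hcon
  rw [not_nonempty_iff_eq_empty] at hcon
  have hd : ∀ z ∈ t, z ∉ E → z ∉ closure E := fun z hz hzE hzc => by
    have : z ∈ t ∩ frontier E := ⟨hz, by rw [hE.frontier_eq]; exact ⟨hzc, hzE⟩⟩
    rw [hcon] at this
    exact this
  obtain ⟨z, hz, hzE⟩ := h2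
  obtain ⟨w, -, hw1, hw2⟩ := ht E (closure E)ᶜ hE isClosed_closure.isOpen_compl
    (fun w hw => by
      by_cases h : w ∈ E
      · exact Or.inl h
      · exact Or.inr (hd w hw h)) h1 ⟨z, hz, hd z hz hzE⟩
  exact hw2 (subset_closure hw1)

lemma mem_iff_of_frontier {n : ℕ} {E : Set (V n)} {u : V n → ℝ} (hE : IsOpen E)
    (hb : IsBounded E) (hne : E.Nonempty)
    (hfr : frontier E = (fun x => (1 + u x) • x) '' sphere (0 : V n) 1)
    (hu : ∀ x ∈ sphere (0 : V n) 1, -1 < u x) {x : V n} (hx : ‖x‖ = 1) {r : ℝ} (hr : 0 < r) :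
    r • x ∈ E ↔ r < 1 + u x := by
  have hfr' : ∀ x : V n, ‖x‖ = 1 → ∀ r : ℝ, 0 ≤ r → r • x ∈ frontier E → r = 1 + u x := by
    intro x hx r hr h
    rw [hfr] at h
    obtain ⟨y, hy, hxy⟩ := h
    have hy1 : ‖y‖ = 1 := by simpa using hy
    have huy : 0 < 1 + u y := by linarith [hu y hy]
    have hn := congrArg norm hxy
    simp only [norm_smul, hx, hy1, mul_one, Real.norm_of_nonneg hr,
      Real.norm_of_nonneg huy.le] at hn
    have : y = x := by
      simp only [hn] at hxy
      exact smul_right_injective _ (by rw [← hn]; exact huy.ne') hxy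
    rw [← hn, this]
  have hmem : ∀ x : V n, ‖x‖ = 1 → (1 + u x) • x ∈ frontier E := by
    intro x hx
    rw [hfr]
    exact ⟨x, by simpa using hx, rfl⟩
  have seg : ∀ x : V n, ∀ I : Set ℝ, IsPreconnected I → IsPreconnected ((fun r : ℝ => r • x) '' I) :=
    fun x I hI => hI.image _ (by fun_prop)
  have outer : ∀ x : V n, ‖x‖ = 1 → ∀ r : ℝ, 1 + u x ≤ r → r • x ∉ E := by
    intro x hx r hr hrE
    have hux : 0 < 1 + u x := by linarith [hu x (by simpa using hx)]
    rcases hr.eq_or_lt with rfl | hr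
    · exact (hE.inter_frontier_eq.le ⟨hrE, hmem x hx⟩)
    obtain ⟨R, hR⟩ := hb.exists_norm_le
    have h := inter_frontier_nonempty (seg x (Ici r) isPreconnected_Ici) hE
      ⟨r • x, ⟨r, self_mem_Ici, rfl⟩, hrE⟩
      ⟨(max r (R + 1)) • x, ⟨_, mem_Ici.2 (le_max_left _ _), rfl⟩, fun h => by
        have := hR _ h
        rw [norm_smul, hx, mul_one] at this
        have h2 := le_abs_self (max r (R + 1))
        have h3 := le_max_right r (R + 1)
        rw [Real.norm_eq_abs] at this
        linarith⟩
    obtain ⟨_, ⟨ρ, hρ, rfl⟩, hρf⟩ := h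
    have := hfr' x hx ρ (by linarith [mem_Ici.1 hρ]) hρf
    linarith [mem_Ici.1 hρ]
  have inner : ∀ x : V n, ‖x‖ = 1 → ∀ r : ℝ, 0 ≤ r → r < 1 + u x → (r • x ∈ E ↔ (0 : V n) ∈ E) := by
    intro x hx r hr hr1
    have no : ∀ ρ ∈ Icc 0 r, ρ • x ∉ frontier E := fun ρ hρ hf => by
      have := hfr' x hx ρ hρ.1 hf
      linarith [hρ.2]
    have hp := seg x (Icc 0 r) isPreconnected_Icc
    have h0 : (0 : V n) ∈ (fun r : ℝ => r • x) '' Icc 0 r := ⟨0, ⟨le_rfl, hr⟩, by simp⟩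
    have h1 : r • x ∈ (fun r : ℝ => r • x) '' Icc 0 r := ⟨r, ⟨hr, le_rfl⟩, rfl⟩
    by_contra hcon
    have : (((fun r : ℝ => r • x) '' Icc 0 r) ∩ frontier E).Nonempty := by
      by_cases h : r • x ∈ E
      · exact inter_frontier_nonempty hp hE ⟨_, h1, h⟩ ⟨0, h0, fun h' => hcon (by tauto)⟩
      · exact inter_frontier_nonempty hp hE ⟨0, h0, by tauto⟩ ⟨_, h1, h⟩
    obtain ⟨_, ⟨ρ, hρ, rfl⟩, hρf⟩ := this
    exact no ρ hρ hρf
  have zero_mem : (0 : V n) ∈ E := by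
    obtain ⟨z, hz⟩ := hne
    by_cases hz0 : z = 0
    · rwa [hz0] at hz
    have hzn : 0 < ‖z‖ := norm_pos_iff.2 hz0
    have hx : ‖(‖z‖⁻¹ • z)‖ = 1 := by
      rw [norm_smul, norm_inv, norm_norm, inv_mul_cancel₀ hzn.ne']
    have e : ‖z‖ • (‖z‖⁻¹ • z) = z := by rw [smul_smul, mul_inv_cancel₀ hzn.ne', one_smul]
    refine (inner _ hx ‖z‖ hzn.le ?_).1 (by rwa [e])
    by_contra hcon
    exact outer _ hx ‖z‖ (not_lt.1 hcon) (by rwa [e])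
  refine ⟨fun h => ?_, fun h => (inner x hx r hr.le h).2 zero_mem⟩
  by_contra hcon
  exact outer x hx r (not_lt.1 hcon) h

/-- `E` is star-shaped with radial function `U`. -/
def IsStar {n : ℕ} (E : Set (V n)) (U : V n → ℝ) : Prop :=
  ∀ x : V n, ‖x‖ = 1 → ∀ r : ℝ, 0 < r → (r • x ∈ E ↔ r < U x)

lemma isStar_ball {n : ℕ} : IsStar (ball (0 : V n) 1) fun _ => 1 := by
  intro x hx r hr
  simp [norm_smul, hx, abs_of_pos hr]

lemma setLIntegral_star {n : ℕ} (hn : 1 ≤ n) {E : Set (V n)} {U : V n → ℝ} (hE : MeasurableSet E)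
    (hEU : IsStar E U) {f : V n → ℝ≥0∞} (hf : Measurable f) :
    ∫⁻ z in E, f z
      = ∫⁻ x, (∫⁻ r in Ioo 0 (U x), ENNReal.ofReal (r ^ (n - 1)) * f (r • x)) ∂sph n := by
  rw [← lintegral_indicator hE, lintegral_polar hn (hf.indicator hE)]
  refine lintegral_congr_ae ?_
  filter_upwards [sph_ae_norm n] with x hx
  rw [← lintegral_indicator measurableSet_Ioi, ← lintegral_indicator measurableSet_Ioo]
  congr 1
  ext r
  by_cases hr : 0 < r
  · rw [indicator_of_mem (mem_Ioi.2 hr)]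
    by_cases h : r < U x
    · rw [indicator_of_mem ((hEU x hx r hr).2 h), indicator_of_mem (mem_Ioo.2 ⟨hr, h⟩)]
    · rw [indicator_of_notMem (fun h' => h ((hEU x hx r hr).1 h')),
        indicator_of_notMem (fun h' => h (mem_Ioo.1 h').2), mul_zero]
  · rw [indicator_of_notMem (show r ∉ Ioi 0 from hr),
      indicator_of_notMem (show r ∉ Ioo 0 (U x) from fun h => hr h.1)]

lemma setLIntegral_star_compl {n : ℕ} (hn : 1 ≤ n) {E : Set (V n)} {U : V n → ℝ}
    (hE : MeasurableSet E) (hEU : IsStar E U) (hU : ∀ x, ‖x‖ = 1 → 0 < U x)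
    {f : V n → ℝ≥0∞} (hf : Measurable f) :
    ∫⁻ z in Eᶜ, f z
      = ∫⁻ x, (∫⁻ r in Ici (U x), ENNReal.ofReal (r ^ (n - 1)) * f (r • x)) ∂sph n := by
  rw [← lintegral_indicator hE.compl, lintegral_polar hn (hf.indicator hE.compl)]
  refine lintegral_congr_ae ?_
  filter_upwards [sph_ae_norm n] with x hx
  rw [← lintegral_indicator measurableSet_Ioi, ← lintegral_indicator measurableSet_Ici]
  congr 1
  ext r
  by_cases hr : 0 < r
  · rw [indicator_of_mem (mem_Ioi.2 hr)]
    by_cases h : r < U x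
    · rw [indicator_of_notMem (show r • x ∉ Eᶜ from fun h' => h' ((hEU x hx r hr).2 h)),
        indicator_of_notMem (show r ∉ Ici (U x) from not_le.2 h), mul_zero]
    · rw [indicator_of_mem (show r • x ∈ Eᶜ from fun h' => h ((hEU x hx r hr).1 h')),
        indicator_of_mem (mem_Ici.2 (not_lt.1 h))]
  · rw [indicator_of_notMem (show r ∉ Ioi 0 from hr),
      indicator_of_notMem (show r ∉ Ici (U x) from fun h => hr ((hU x hx).trans_le h))]

lemma lintegral_Ioo_pow (k : ℕ) {p : ℝ} (hp : 0 ≤ p) :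
    ∫⁻ r in Ioo 0 p, ENNReal.ofReal (r ^ k) = ENNReal.ofReal (p ^ (k + 1) / (k + 1)) := by
  rw [← ofReal_integral_eq_lintegral_ofReal]
  · rw [← integral_Ioc_eq_integral_Ioo, ← intervalIntegral.integral_of_le hp, integral_pow]
    simp
  · exact ((continuous_pow k).integrableOn_Icc (a := 0) (b := p)).mono_set Ioo_subset_Icc_self
  · filter_upwards [ae_restrict_mem measurableSet_Ioo] with r hr
    exact pow_nonneg hr.1.le _

lemma integrable_sph {n : ℕ} {f : V n → ℝ} (hf : Measurable f) (C : ℝ)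
    (hC : ∀ x, ‖x‖ = 1 → |f x| ≤ C) : Integrable f (sph n) := by
  refine Integrable.of_bound hf.aestronglyMeasurable C ?_
  filter_upwards [sph_ae_norm n] with x hx
  exact hC x hx

lemma integrable_sph_of_continuous {n : ℕ} {f : V n → ℝ} (hf : Continuous f) :
    Integrable f (sph n) := by
  obtain ⟨C, hC⟩ := (isCompact_sphere (0 : V n) 1).exists_bound_of_continuousOn hf.continuousOn
  exact integrable_sph hf.measurable C fun x hx => hC x (by simpa using hx)

lemma lintegral_radius_pow {n : ℕ} (hn : 1 ≤ n) {E : Set (V n)} {U : V n → ℝ}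
    (hE : MeasurableSet E) (hEU : IsStar E U) (hU : ∀ x, ‖x‖ = 1 → 0 < U x) :
    volume E = ∫⁻ x, ENNReal.ofReal (U x ^ n / n) ∂sph n := by
  have h := setLIntegral_star hn hE hEU (f := fun _ => 1) measurable_const
  rw [setLIntegral_one] at h
  rw [h]
  refine lintegral_congr_ae ?_
  filter_upwards [sph_ae_norm n] with x hx
  simp only [mul_one]
  rw [lintegral_Ioo_pow _ (hU x hx).le]
  obtain ⟨m, rfl⟩ : ∃ m, n = m + 1 := ⟨n - 1, by omega⟩
  simp

lemma integral_radius_pow {n : ℕ} (hn : 1 ≤ n) {E : Set (V n)} {U : V n → ℝ}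
    (hE : MeasurableSet E) (hEU : IsStar E U) (hUc : Continuous U)
    (hU : ∀ x, ‖x‖ = 1 → 0 < U x) (hvol : volume E = volume (ball (0 : V n) 1)) :
    ∫ x, (U x ^ n - 1) ∂sph n = 0 := by
  have h1 := lintegral_radius_pow hn hE hEU hU
  have h2 := lintegral_radius_pow hn (measurableSet_ball) (isStar_ball (n := n)) (by simp)
  rw [h1, h2] at hvol
  have hn0 : (0 : ℝ) < n := by exact_mod_cast hn
  have i1 : Integrable (fun x => U x ^ n / n) (sph n) :=
    integrable_sph_of_continuous (by fun_prop)
  rw [← ofReal_integral_eq_lintegral_ofReal i1, ← ofReal_integral_eq_lintegral_ofReal,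
    ENNReal.ofReal_eq_ofReal_iff] at hvol
  · rw [integral_div] at hvol
    rw [integral_sub (integrable_sph_of_continuous (by fun_prop)) (integrable_const _)]
    simp only [one_pow] at hvol
    rw [integral_const] at *
    field_simp at hvol
    simp only [smul_eq_mul] at *
    have e : (n : ℝ) * ((sph n).real univ * (1 / n)) = (sph n).real univ := by field_simp
    linarith
  · refine integral_nonneg_of_ae ?_
    filter_upwards [sph_ae_norm n] with x hx
    have := hU x hx
    positivity
  · exact integral_nonneg fun x => by positivity
  · exact integrable_const _
  · exact ae_of_all _ fun x => by positivity
  · filter_upwards [sph_ae_norm n] with x hx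
    have := hU x hx
    positivity

lemma integral_radius_moment {n : ℕ} (hn : 1 ≤ n) {E : Set (V n)} {U : V n → ℝ}
    (hE : MeasurableSet E) (hb : IsBounded E) (hEU : IsStar E U) (hUc : Continuous U)
    (hU : ∀ x, ‖x‖ = 1 → 0 < U x) (hvol : volume E = volume (ball (0 : V n) 1))
    (hzero : ∫ z in E, z = 0) (w : V n) :
    ∫ x, ⟪w, x⟫ * U x ^ (n + 1) ∂sph n = 0 := by
  have : Nonempty (Fin n) := ⟨⟨0, hn⟩⟩
  have hvt : volume E ≠ ∞ := by rw [hvol]; exact measure_ball_lt_top.ne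
  obtain ⟨R, hR⟩ := hb.exists_norm_le
  have hid : IntegrableOn (fun z : V n => z) E := by
    refine Measure.integrableOn_of_bounded hvt (by fun_prop) (M := R) ?_
    filter_upwards [ae_restrict_mem hE] with z hz using hR z hz
  have hw : ∫ z in E, ⟪w, z⟫ = 0 := by rw [integral_inner hid, hzero, inner_zero_right]
  have hwi : IntegrableOn (fun z : V n => ⟪w, z⟫) E := hid.const_inner w
  have key : ∀ w : V n, ∫⁻ z in E, ENNReal.ofReal ⟪w, z⟫
      = ∫⁻ x, ENNReal.ofReal (⟪w, x⟫ * U x ^ (n + 1) / (n + 1)) ∂sph n := by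
    intro w
    rw [setLIntegral_star hn hE hEU (by fun_prop)]
    refine lintegral_congr_ae ?_
    filter_upwards [sph_ae_norm n] with x hx
    have : ∀ r ∈ Ioo 0 (U x), ENNReal.ofReal (r ^ (n - 1)) * ENNReal.ofReal ⟪w, r • x⟫
        = ENNReal.ofReal (r ^ n) * ENNReal.ofReal ⟪w, x⟫ := by
      intro r hr
      have hr0 := hr.1
      rw [inner_smul_right, ENNReal.ofReal_mul hr0.le, ← mul_assoc,
        ← ENNReal.ofReal_mul (by positivity), ← pow_succ, Nat.sub_add_cancel hn]
    rw [setLIntegral_congr_fun measurableSet_Ioo this, lintegral_mul_const _ (by fun_prop),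
      lintegral_Ioo_pow _ (hU x hx).le, ← ENNReal.ofReal_mul]
    · congr 1; ring
    · have := hU x hx
      positivity
  have i1 : Integrable (fun x => ⟪w, x⟫ * U x ^ (n + 1) / (n + 1)) (sph n) :=
    integrable_sph_of_continuous (by fun_prop)
  rw [integral_eq_lintegral_pos_part_sub_lintegral_neg_part hwi] at hw
  have k2 := key (-w)
  simp only [inner_neg_left, neg_mul, neg_div] at k2
  rw [key w, k2, ← integral_eq_lintegral_pos_part_sub_lintegral_neg_part i1, integral_div,
    div_eq_zero_iff] at hw
  rcases hw with h | h
  · exact h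
  · have : (0 : ℝ) < n := by exact_mod_cast hn
    linarith

lemma measurable_setLIntegral_param {X : Type*} [MeasurableSpace X] {G : X → ℝ → ℝ≥0∞}
    (hG : Measurable (Function.uncurry G)) {A : X → Set ℝ}
    (hA : MeasurableSet {z : X × ℝ | z.2 ∈ A z.1}) :
    Measurable fun x => ∫⁻ r in A x, G x r := by
  have h : ∀ x, MeasurableSet (A x) := fun x => measurable_prodMk_left (x := x) hA
  simp_rw [← lintegral_indicator (h _)]
  have := hG.indicator hA
  refine Measurable.lintegral_prod_right' (f := fun z : X × ℝ => (A z.1).indicator (G z.1) z.2) ?_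
  convert this using 1
  ext z
  rfl

lemma measurableSet_Ioo_param {X : Type*} [MeasurableSpace X] {p q : X → ℝ} (hp : Measurable p)
    (hq : Measurable q) : MeasurableSet {z : X × ℝ | z.2 ∈ Ioo (p z.1) (q z.1)} :=
  (measurableSet_lt (hp.comp measurable_fst) measurable_snd).inter
    (measurableSet_lt measurable_snd (hq.comp measurable_fst))

lemma measurableSet_Ico_param {X : Type*} [MeasurableSpace X] {p q : X → ℝ} (hp : Measurable p)
    (hq : Measurable q) : MeasurableSet {z : X × ℝ | z.2 ∈ Ico (p z.1) (q z.1)} :=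
  (measurableSet_le (hp.comp measurable_fst) measurable_snd).inter
    (measurableSet_lt measurable_snd (hq.comp measurable_fst))

lemma measurableSet_Ici_param {X : Type*} [MeasurableSpace X] {p : X → ℝ} (hp : Measurable p) :
    MeasurableSet {z : X × ℝ | z.2 ∈ Ici (p z.1)} :=
  measurableSet_le (hp.comp measurable_fst) measurable_snd

/-- The Gagliardo kernel in polar coordinates. -/
noncomputable def gk (n : ℕ) (s t r ρ : ℝ) : ℝ :=
  r ^ (n - 1) * ρ ^ (n - 1) * (r ^ 2 + ρ ^ 2 - 2 * r * ρ * t) ^ (-(((n : ℝ) + s) / 2))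

/-- Radial interaction of `(0,p)` with `[q,∞)`. -/
noncomputable def radW (n : ℕ) (s t p q : ℝ) : ℝ≥0∞ :=
  ∫⁻ r in Ioo 0 p, ∫⁻ ρ in Ici q, ENNReal.ofReal (gk n s t r ρ)

/-- Radial self-interaction of the interval between `p` and `q`. -/
noncomputable def radSq (n : ℕ) (s t p q : ℝ) : ℝ≥0∞ :=
  ∫⁻ r in Ico (min p q) (max p q), ∫⁻ ρ in Ico (min p q) (max p q),
    ENNReal.ofReal (gk n s t r ρ)

lemma gk_comm (n : ℕ) (s t r ρ : ℝ) : gk n s t r ρ = gk n s t ρ r := by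
  unfold gk; congr 1; · ring
  congr 1; ring

lemma norm_smul_sub_rpow {n : ℕ} (s : ℝ) {x y : V n} (hx : ‖x‖ = 1) (hy : ‖y‖ = 1) (r ρ : ℝ) :
    ‖r • x - ρ • y‖ ^ (-((n : ℝ) + s))
      = (r ^ 2 + ρ ^ 2 - 2 * r * ρ * ⟪x, y⟫) ^ (-(((n : ℝ) + s) / 2)) := by
  have h : r ^ 2 + ρ ^ 2 - 2 * r * ρ * ⟪x, y⟫ = ‖r • x - ρ • y‖ ^ 2 := by
    rw [norm_sub_sq_real, norm_smul, norm_smul, hx, hy, real_inner_smul_left,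
      real_inner_smul_right, mul_one, mul_one, Real.norm_eq_abs, Real.norm_eq_abs, sq_abs, sq_abs]
    ring
  rw [h, ← Real.rpow_natCast, ← Real.rpow_mul (norm_nonneg _)]
  congr 1
  push_cast
  ring

lemma measurable_radW (n : ℕ) (s : ℝ) :
    Measurable fun z : ℝ × ℝ × ℝ => radW n s z.1 z.2.1 z.2.2 := by
  unfold radW
  refine measurable_setLIntegral_param (X := ℝ × ℝ × ℝ) (G := fun z r => ∫⁻ ρ in Ici z.2.2,
    ENNReal.ofReal (gk n s z.1 r ρ)) (A := fun z => Ioo 0 z.2.1) ?_ ?_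
  · refine measurable_setLIntegral_param (X := (ℝ × ℝ × ℝ) × ℝ)
      (G := fun z ρ => ENNReal.ofReal (gk n s z.1.1 z.2 ρ)) (A := fun z => Ici z.1.2.2) ?_ ?_
    · unfold gk; fun_prop
    · exact measurableSet_Ici_param (p := fun z : (ℝ × ℝ × ℝ) × ℝ => z.1.2.2) (by fun_prop)
  · exact measurableSet_Ioo_param (p := fun z : ℝ × ℝ × ℝ => 0) (q := fun z => z.2.1)
      (by fun_prop) (by fun_prop)

lemma measurable_radSq (n : ℕ) (s : ℝ) :
    Measurable fun z : ℝ × ℝ × ℝ => radSq n s z.1 z.2.1 z.2.2 := by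
  unfold radSq
  refine measurable_setLIntegral_param (X := ℝ × ℝ × ℝ) (G := fun z r => ∫⁻ ρ in Ico (min z.2.1 z.2.2)
    (max z.2.1 z.2.2), ENNReal.ofReal (gk n s z.1 r ρ))
    (A := fun z => Ico (min z.2.1 z.2.2) (max z.2.1 z.2.2)) ?_ ?_
  · refine measurable_setLIntegral_param (X := (ℝ × ℝ × ℝ) × ℝ)
      (G := fun z ρ => ENNReal.ofReal (gk n s z.1.1 z.2 ρ))
      (A := fun z => Ico (min z.1.2.1 z.1.2.2) (max z.1.2.1 z.1.2.2)) ?_ ?_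
    · unfold gk; fun_prop
    · exact measurableSet_Ico_param (p := fun z : (ℝ × ℝ × ℝ) × ℝ => min z.1.2.1 z.1.2.2)
        (q := fun z => max z.1.2.1 z.1.2.2) (by fun_prop) (by fun_prop)
  · exact measurableSet_Ico_param (p := fun z : ℝ × ℝ × ℝ => min z.2.1 z.2.2)
      (q := fun z => max z.2.1 z.2.2) (by fun_prop) (by fun_prop)

/-- The interaction of two sets of radii. -/
noncomputable def radI (n : ℕ) (s t : ℝ) (A B : Set ℝ) : ℝ≥0∞ :=
  ∫⁻ r in A, ∫⁻ ρ in B, ENNReal.ofReal (gk n s t r ρ)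

lemma radI_comm (n : ℕ) (s t : ℝ) (A B : Set ℝ) : radI n s t A B = radI n s t B A := by
  unfold radI
  rw [lintegral_lintegral_swap]
  · simp_rw [gk_comm n s t]
  · unfold gk; fun_prop

lemma radI_union_left (n : ℕ) (s t : ℝ) {A A' : Set ℝ} (B : Set ℝ) (hA : MeasurableSet A')
    (h : Disjoint A A') : radI n s t (A ∪ A') B = radI n s t A B + radI n s t A' B := by
  unfold radI
  rw [lintegral_union hA h]

lemma radI_union_right (n : ℕ) (s t : ℝ) {A A' : Set ℝ} (B : Set ℝ) (hA : MeasurableSet A')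
    (h : Disjoint A A') : radI n s t B (A ∪ A') = radI n s t B A + radI n s t B A' := by
  rw [radI_comm, radI_union_left n s t B hA h, radI_comm n s t B, radI_comm n s t B]

lemma radW_add_of_le (n : ℕ) (s t : ℝ) {p q : ℝ} (hp : 0 < p) (hpq : p ≤ q) :
    radW n s t p q + radW n s t q p
      = radSq n s t p q + radW n s t p p + radW n s t q q := by
  have e1 : Ioo 0 q = Ioo 0 p ∪ Ico p q := (Ioo_union_Ico_eq_Ioo hp hpq).symm
  have e2 : Ici p = Ico p q ∪ Ici q := (Ico_union_Ici_eq_Ici hpq).symm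
  have d1 : Disjoint (Ioo 0 p) (Ico p q) := by
    rw [Set.disjoint_left]; intro z h1 h2; exact not_le.2 h1.2 h2.1
  have d2 : Disjoint (Ico p q) (Ici q) := by
    rw [Set.disjoint_left]; intro z h1 h2; exact not_le.2 h1.2 h2
  have w : ∀ p q, radW n s t p q = radI n s t (Ioo 0 p) (Ici q) := fun _ _ => rfl
  have sq : radSq n s t p q = radI n s t (Ico p q) (Ico p q) := by
    unfold radSq radI; rw [min_eq_left hpq, max_eq_right hpq]
  rw [w, w, w, w, sq, e1, e2, radI_union_left n s t _ measurableSet_Ico d1,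
    radI_union_left n s t _ measurableSet_Ico d1,
    radI_union_right n s t _ measurableSet_Ici d2,
    radI_union_right n s t _ measurableSet_Ici d2]
  ring

lemma radSq_comm (n : ℕ) (s t p q : ℝ) : radSq n s t p q = radSq n s t q p := by
  unfold radSq; rw [min_comm, max_comm]

lemma radW_add (n : ℕ) (s t : ℝ) {p q : ℝ} (hp : 0 < p) (hq : 0 < q) :
    radW n s t p q + radW n s t q p
      = radSq n s t p q + radW n s t p p + radW n s t q q := by
  rcases le_total p q with h | h
  · exact radW_add_of_le n s t hp h
  · rw [add_comm, radW_add_of_le n s t hq h, radSq_comm]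
    ring

lemma lintegral_scale {p : ℝ} (hp : 0 < p) (f : ℝ → ℝ≥0∞) :
    ∫⁻ r, f r = ENNReal.ofReal p * ∫⁻ r, f (p * r) := by
  have h := Real.map_volume_mul_left hp.ne'
  have h2 : ∫⁻ r, f r ∂(Measure.map (p * ·) volume) = ∫⁻ r, f (p * r) :=
    lintegral_map_equiv f (Homeomorph.mulLeft₀ p hp.ne').toMeasurableEquiv
  rw [← h2, h, lintegral_smul_measure, smul_eq_mul, ← mul_assoc, ← ENNReal.ofReal_mul hp.le,
    abs_of_pos (inv_pos.2 hp), mul_inv_cancel₀ hp.ne', ENNReal.ofReal_one, one_mul]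

lemma setLIntegral_scale_Ioo {p : ℝ} (hp : 0 < p) (f : ℝ → ℝ≥0∞) (a b : ℝ) :
    ∫⁻ r in Ioo (p * a) (p * b), f r = ENNReal.ofReal p * ∫⁻ r in Ioo a b, f (p * r) := by
  rw [← lintegral_indicator measurableSet_Ioo, lintegral_scale hp,
    ← lintegral_indicator measurableSet_Ioo]
  congr 2
  ext r
  simp [indicator_apply, hp]

lemma setLIntegral_scale_Ici {p : ℝ} (hp : 0 < p) (f : ℝ → ℝ≥0∞) (a : ℝ) :
    ∫⁻ r in Ici (p * a), f r = ENNReal.ofReal p * ∫⁻ r in Ici a, f (p * r) := by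
  rw [← lintegral_indicator measurableSet_Ici, lintegral_scale hp,
    ← lintegral_indicator measurableSet_Ici]
  congr 2
  ext r
  simp [indicator_apply, hp]

lemma gk_scale {n : ℕ} (hn : 1 ≤ n) (s t : ℝ) (ht : t ≤ 1) {p r ρ : ℝ} (hp : 0 < p)
    (hr : 0 ≤ r) (hρ : 0 ≤ ρ) :
    p * (p * gk n s t (p * r) (p * ρ)) = p ^ ((n : ℝ) - s) * gk n s t r ρ := by
  unfold gk
  have h1 : (p * r) ^ 2 + (p * ρ) ^ 2 - 2 * (p * r) * (p * ρ) * t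
      = p ^ 2 * (r ^ 2 + ρ ^ 2 - 2 * r * ρ * t) := by ring
  have h2 : 0 ≤ r ^ 2 + ρ ^ 2 - 2 * r * ρ * t := by
    nlinarith [sq_nonneg (r - ρ), mul_nonneg hr hρ]
  rw [h1, Real.mul_rpow (by positivity) h2]
  have h3 : p ^ ((n : ℝ) - s) = p * p * (p ^ (n - 1) * p ^ (n - 1))
      * (p ^ 2) ^ (-(((n : ℝ) + s) / 2)) := by
    have e : p * p * (p ^ (n - 1) * p ^ (n - 1)) = p ^ (2 * (n : ℝ)) := by
      obtain ⟨m, rfl⟩ : ∃ m, n = m + 1 := ⟨n - 1, by omega⟩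
      rw [show (2 : ℝ) * ((m + 1 : ℕ) : ℝ) = ((2 * (m + 1) : ℕ) : ℝ) by push_cast; ring,
        Real.rpow_natCast]
      simp only [Nat.add_sub_cancel]
      ring
    rw [e, ← Real.rpow_natCast p 2, ← Real.rpow_mul hp.le, ← Real.rpow_add hp]
    congr 1
    push_cast
    ring
  rw [h3]
  ring

lemma radW_diag {n : ℕ} (hn : 1 ≤ n) (s t : ℝ) (ht : t ≤ 1) {p : ℝ} (hp : 0 < p) :
    radW n s t p p = ENNReal.ofReal (p ^ ((n : ℝ) - s)) * radW n s t 1 1 := by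
  unfold radW
  have h1 := setLIntegral_scale_Ioo hp (fun r => ∫⁻ ρ in Ici p, ENNReal.ofReal (gk n s t r ρ)) 0 1
  rw [mul_zero, mul_one] at h1
  rw [h1, ← lintegral_const_mul', ← lintegral_const_mul']
  · refine setLIntegral_congr_fun measurableSet_Ioo fun r hr => ?_
    have h2 := setLIntegral_scale_Ici hp (fun ρ => ENNReal.ofReal (gk n s t (p * r) ρ)) 1
    rw [mul_one] at h2
    rw [h2, ← lintegral_const_mul', ← lintegral_const_mul', ← lintegral_const_mul']
    · refine setLIntegral_congr_fun measurableSet_Ici fun ρ hρ => ?_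
      rw [← ENNReal.ofReal_mul hp.le, ← ENNReal.ofReal_mul hp.le,
        ← ENNReal.ofReal_mul (by positivity),
        gk_scale hn s t ht hp hr.1.le (zero_le_one.trans hρ)]
    all_goals exact ENNReal.ofReal_ne_top
  all_goals exact ENNReal.ofReal_ne_top

lemma fracPer_polar {n : ℕ} (hn : 1 ≤ n) (s : ℝ) {E : Set (V n)} {U : V n → ℝ}
    (hE : MeasurableSet E) (hEU : IsStar E U) (hUc : Continuous U) (hU : ∀ x, ‖x‖ = 1 → 0 < U x) :
    fracPer n s E = ∫⁻ x, ∫⁻ y, radW n s ⟪x, y⟫ (U x) (U y) ∂sph n ∂sph n := by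
  unfold fracPer
  have hUm := hUc.measurable
  have hm : Measurable fun z : V n × V n => ENNReal.ofReal (‖z.1 - z.2‖ ^ (-((n : ℝ) + s))) := by
    fun_prop
  rw [setLIntegral_star hn hE hEU (Measurable.lintegral_prod_right' hm)]
  refine lintegral_congr_ae ?_
  filter_upwards [sph_ae_norm n] with x hx
  have h1 : ∀ r ∈ Ioo 0 (U x), ENNReal.ofReal (r ^ (n - 1))
        * ∫⁻ y in Eᶜ, ENNReal.ofReal (‖r • x - y‖ ^ (-((n : ℝ) + s)))
      = ∫⁻ y, (∫⁻ ρ in Ici (U y), ENNReal.ofReal (gk n s ⟪x, y⟫ r ρ)) ∂sph n := by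
    intro r hr
    rw [setLIntegral_star_compl hn hE hEU hU (by fun_prop),
      ← lintegral_const_mul' _ _ ENNReal.ofReal_ne_top]
    refine lintegral_congr_ae ?_
    filter_upwards [sph_ae_norm n] with y hy
    rw [← lintegral_const_mul' _ _ ENNReal.ofReal_ne_top]
    refine setLIntegral_congr_fun measurableSet_Ici fun ρ hρ => ?_
    have hr0 := hr.1
    have hρ0 : 0 < ρ := (hU y hy).trans_le hρ
    rw [← ENNReal.ofReal_mul (by positivity), ← ENNReal.ofReal_mul (by positivity),
      norm_smul_sub_rpow s hx hy, gk, ← mul_assoc]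
  rw [setLIntegral_congr_fun measurableSet_Ioo h1, lintegral_lintegral_swap]
  · rfl
  · refine Measurable.aemeasurable ?_
    refine measurable_setLIntegral_param (X := ℝ × V n)
      (G := fun z ρ => ENNReal.ofReal (gk n s ⟪x, z.2⟫ z.1 ρ)) (A := fun z => Ici (U z.2)) ?_ ?_
    · unfold gk; fun_prop
    · exact measurableSet_Ici_param (p := fun z : ℝ × V n => U z.2) (by fun_prop)

/-- The radial profile of the perimeter of the unit ball. -/
noncomputable def ballΦ (n : ℕ) (s : ℝ) (x : V n) : ℝ≥0∞ :=
  ∫⁻ y, radW n s ⟪x, y⟫ 1 1 ∂sph n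

lemma ballΦ_eq {n : ℕ} (s : ℝ) {x x' : V n} (hx : ‖x‖ = 1) (hx' : ‖x'‖ = 1) :
    ballΦ n s x = ballΦ n s x' :=
  lintegral_zonal hx hx' fun t => radW n s t 1 1

lemma fracPer_ball {n : ℕ} (hn : 1 ≤ n) (s : ℝ) {e : V n} (he : ‖e‖ = 1) :
    fracPer n s (ball (0 : V n) 1) = ballΦ n s e * sph n univ := by
  rw [fracPer_polar hn s measurableSet_ball isStar_ball continuous_const (by simp),
    ← lintegral_const]
  refine lintegral_congr_ae ?_
  filter_upwards [sph_ae_norm n] with x hx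
  exact ballΦ_eq s hx he

lemma inner_le_one_of_norm {n : ℕ} {x y : V n} (hx : ‖x‖ = 1) (hy : ‖y‖ = 1) : ⟪x, y⟫ ≤ 1 := by
  simpa [hx, hy] using real_inner_le_norm x y

lemma two_mul_fracPer {n : ℕ} (hn : 1 ≤ n) (s : ℝ) {E : Set (V n)} {U : V n → ℝ}
    (hE : MeasurableSet E) (hEU : IsStar E U) (hUc : Continuous U) (hU : ∀ x, ‖x‖ = 1 → 0 < U x)
    {e : V n} (he : ‖e‖ = 1) :
    2 * fracPer n s E = ∫⁻ x, ∫⁻ y, radSq n s ⟪x, y⟫ (U x) (U y) ∂sph n ∂sph n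
      + 2 * (ballΦ n s e * ∫⁻ x, ENNReal.ofReal (U x ^ ((n : ℝ) - s)) ∂sph n) := by
  have hUm := hUc.measurable
  have hWm : ∀ {f g h : V n × V n → ℝ}, Measurable f → Measurable g → Measurable h →
      Measurable fun z => radW n s (f z) (g z) (h z) := fun hf hg hh =>
    (measurable_radW n s).comp (hf.prodMk (hg.prodMk hh))
  have hSm : Measurable fun z : V n × V n => radSq n s ⟪z.1, z.2⟫ (U z.1) (U z.2) :=
    (measurable_radSq n s).comp (g := fun z : ℝ × ℝ × ℝ => radSq n s z.1 z.2.1 z.2.2)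
      (f := fun z : V n × V n => (⟪z.1, z.2⟫, U z.1, U z.2)) (by fun_prop)
  have hW1 : Measurable fun z : V n × V n => radW n s ⟪z.1, z.2⟫ (U z.1) (U z.2) :=
    hWm (by fun_prop) (by fun_prop) (by fun_prop)
  have hW2 : Measurable fun z : V n × V n => radW n s ⟪z.1, z.2⟫ (U z.2) (U z.1) :=
    hWm (by fun_prop) (by fun_prop) (by fun_prop)
  have hD1 : Measurable fun z : V n × V n => radW n s ⟪z.1, z.2⟫ (U z.1) (U z.1) :=
    hWm (by fun_prop) (by fun_prop) (by fun_prop)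
  have hD2 : Measurable fun z : V n × V n => radW n s ⟪z.1, z.2⟫ (U z.2) (U z.2) :=
    hWm (by fun_prop) (by fun_prop) (by fun_prop)
  have sw : ∀ f : V n × V n → ℝ≥0∞, Measurable f → ∫⁻ x, ∫⁻ y, f (x, y) ∂sph n ∂sph n
      = ∫⁻ z, f z ∂((sph n).prod (sph n)) := fun f hf => (lintegral_prod f hf.aemeasurable).symm
  have e1 := fracPer_polar hn s hE hEU hUc hU
  have e2 : fracPer n s E = ∫⁻ x, ∫⁻ y, radW n s ⟪x, y⟫ (U y) (U x) ∂sph n ∂sph n := by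
    rw [e1, lintegral_lintegral_swap hW1.aemeasurable]
    simp_rw [real_inner_comm]
  have d1 : ∫⁻ x, ∫⁻ y, radW n s ⟪x, y⟫ (U x) (U x) ∂sph n ∂sph n
      = ballΦ n s e * ∫⁻ x, ENNReal.ofReal (U x ^ ((n : ℝ) - s)) ∂sph n := by
    rw [← lintegral_const_mul _ (by fun_prop)]
    refine lintegral_congr_ae ?_
    filter_upwards [sph_ae_norm n] with x hx
    rw [← ballΦ_eq s hx he, ballΦ, mul_comm, ← lintegral_const_mul' _ _ ENNReal.ofReal_ne_top]
    refine lintegral_congr_ae ?_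
    filter_upwards [sph_ae_norm n] with y hy
    exact radW_diag hn s _ (inner_le_one_of_norm hx hy) (hU x hx)
  have d2 : ∫⁻ x, ∫⁻ y, radW n s ⟪x, y⟫ (U y) (U y) ∂sph n ∂sph n
      = ballΦ n s e * ∫⁻ x, ENNReal.ofReal (U x ^ ((n : ℝ) - s)) ∂sph n := by
    rw [← d1, lintegral_lintegral_swap hD2.aemeasurable]
    simp_rw [real_inner_comm]
  rw [two_mul]
  nth_rewrite 1 [e1]
  rw [e2, two_mul]
  nth_rewrite 1 [← d1]
  rw [← d2, sw _ hW1, sw _ hW2, sw _ hSm, sw _ hD1, sw _ hD2, ← lintegral_add_left hW1,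
    ← lintegral_add_left hD1, ← lintegral_add_left hSm]
  refine lintegral_congr_ae ?_
  have hx : ∀ᵐ z ∂((sph n).prod (sph n)), ‖z.1‖ = 1 :=
    Measure.quasiMeasurePreserving_fst.ae (sph_ae_norm n)
  have hy : ∀ᵐ z ∂((sph n).prod (sph n)), ‖z.2‖ = 1 :=
    Measure.quasiMeasurePreserving_snd.ae (sph_ae_norm n)
  filter_upwards [hx, hy] with z hz1 hz2
  rw [radW_add n s _ (hU _ hz1) (hU _ hz2), add_assoc]

lemma radSq_ge {n : ℕ} {s t p q c : ℝ} (hc : 0 ≤ c)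
    (h : ∀ r ∈ Ico (min p q) (max p q), ∀ ρ ∈ Ico (min p q) (max p q), c ≤ gk n s t r ρ) :
    ENNReal.ofReal (c * (p - q) ^ 2) ≤ radSq n s t p q := by
  unfold radSq
  have e : (max p q - min p q) * (max p q - min p q) = (p - q) ^ 2 := by
    rcases le_total p q with h | h <;> simp [h] <;> ring
  have hmm : 0 ≤ max p q - min p q := sub_nonneg.2 (min_le_max)
  calc ENNReal.ofReal (c * (p - q) ^ 2)
      = ∫⁻ r in Ico (min p q) (max p q), ∫⁻ ρ in Ico (min p q) (max p q), ENNReal.ofReal c := by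
        simp only [lintegral_const, Measure.restrict_apply MeasurableSet.univ, univ_inter,
          Real.volume_Ico]
        rw [mul_assoc, ← ENNReal.ofReal_mul hmm, ← ENNReal.ofReal_mul hc, e]
    _ ≤ _ := by
        refine setLIntegral_mono' measurableSet_Ico fun r hr => ?_
        refine setLIntegral_mono' measurableSet_Ico fun ρ hρ => ?_
        exact ENNReal.ofReal_le_ofReal (h r hr ρ hρ)

lemma radSq_le {n : ℕ} {s t p q c : ℝ} (hc : 0 ≤ c)
    (h : ∀ r ∈ Ico (min p q) (max p q), ∀ ρ ∈ Ico (min p q) (max p q), gk n s t r ρ ≤ c) :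
    radSq n s t p q ≤ ENNReal.ofReal (c * (p - q) ^ 2) := by
  unfold radSq
  have e : (max p q - min p q) * (max p q - min p q) = (p - q) ^ 2 := by
    rcases le_total p q with h | h <;> simp [h] <;> ring
  have hmm : 0 ≤ max p q - min p q := sub_nonneg.2 (min_le_max)
  calc _ ≤ ∫⁻ r in Ico (min p q) (max p q), ∫⁻ ρ in Ico (min p q) (max p q), ENNReal.ofReal c := by
        refine setLIntegral_mono' measurableSet_Ico fun r hr => ?_
        refine setLIntegral_mono' measurableSet_Ico fun ρ hρ => ?_
        exact ENNReal.ofReal_le_ofReal (h r hr ρ hρ)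
    _ = ENNReal.ofReal (c * (p - q) ^ 2) := by
        simp only [lintegral_const, Measure.restrict_apply MeasurableSet.univ, univ_inter,
          Real.volume_Ico]
        rw [mul_assoc, ← ENNReal.ofReal_mul hmm, ← ENNReal.ofReal_mul hc, e]

lemma sq_rpow_half {θ : ℝ} (hθ : 0 ≤ θ) (k : ℝ) : (θ ^ 2) ^ (-(k / 2)) = θ ^ (-k) := by
  rw [← Real.rpow_natCast, ← Real.rpow_mul hθ]
  congr 1
  push_cast
  ring

set_option maxHeartbeats 800000 in
lemma gk_bounds {n : ℕ} (hn : 2 ≤ n) {s ε θ t r ρ : ℝ} (hs : s ∈ Ioo (0 : ℝ) 1) (hε : 0 ≤ ε)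
    (hε1 : ε ≤ 1 / 5) (hθ : 0 < θ) (hθt : θ ^ 2 = 2 - 2 * t)
    (hr : r ∈ Icc (1 - ε) (1 + ε)) (hρ : ρ ∈ Icc (1 - ε) (1 + ε)) (hrρ : |r - ρ| ≤ ε * θ) :
    (1 - 5 * n * ε) * θ ^ (-((n : ℝ) + s)) ≤ gk n s t r ρ ∧
      gk n s t r ρ ≤ 16 ^ n * θ ^ (-((n : ℝ) + s)) := by
  obtain ⟨hr1, hr2⟩ := hr
  obtain ⟨hρ1, hρ2⟩ := hρ
  have hnR : (2 : ℝ) ≤ n := by exact_mod_cast hn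
  set N := r ^ 2 + ρ ^ 2 - 2 * r * ρ * t with hN
  have hNe : N = (r - ρ) ^ 2 + r * ρ * θ ^ 2 := by rw [hN, hθt]; ring
  have hd : (r - ρ) ^ 2 ≤ (ε * θ) ^ 2 := by
    rw [← sq_abs (r - ρ)]; exact pow_le_pow_left₀ (abs_nonneg _) hrρ 2
  have hprod1 : (1 - ε) ^ 2 ≤ r * ρ := by nlinarith
  have hprod2 : r * ρ ≤ (1 + ε) ^ 2 := by nlinarith
  have hN1 : (1 / 4) * θ ^ 2 ≤ N := by
    rw [hNe]
    nlinarith [sq_nonneg (r - ρ), mul_le_mul_of_nonneg_right hprod1 (sq_nonneg θ),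
      mul_nonneg (show 0 ≤ (1 - ε) ^ 2 - 1 / 4 by nlinarith) (sq_nonneg θ)]
  have hN2 : N ≤ (1 + 3 * ε) * θ ^ 2 := by
    rw [hNe]
    nlinarith [mul_le_mul_of_nonneg_right hprod2 (sq_nonneg θ),
      mul_nonneg (show 0 ≤ 1 + 3 * ε - (1 + ε) ^ 2 - ε ^ 2 by nlinarith) (sq_nonneg θ)]
  have hN0 : 0 < N := lt_of_lt_of_le (by positivity) hN1
  have ha0 : -(((n : ℝ) + s) / 2) ≤ 0 := by linarith [hs.1]
  have ha1 : -(n : ℝ) ≤ -(((n : ℝ) + s) / 2) := by linarith [hs.2]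
  have hpow : r ^ (n - 1) * ρ ^ (n - 1) = (r * ρ) ^ (n - 1) := (mul_pow _ _ _).symm
  have hθp : 0 < θ ^ (-((n : ℝ) + s)) := Real.rpow_pos_of_pos hθ _
  have hP0 : 0 ≤ r ^ (n - 1) * ρ ^ (n - 1) :=
    mul_nonneg (pow_nonneg (by linarith) _) (pow_nonneg (by linarith) _)
  have hr0 : 0 ≤ r * ρ := mul_nonneg (by linarith) (by linarith)
  have hr4 : r * ρ ≤ 4 := hprod2.trans (by nlinarith)
  clear_value N
  constructor
  · have h1 : (1 - 3 * ε) ^ n ≤ (1 + 3 * ε) ^ (-(((n : ℝ) + s) / 2)) := by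
      calc (1 - 3 * ε) ^ n ≤ ((1 + 3 * ε)⁻¹) ^ n := by
            gcongr
            · linarith
            rw [le_inv_comm₀ (by linarith) (by linarith), ← one_div, le_div_iff₀ (by linarith)]
            nlinarith
        _ = (1 + 3 * ε) ^ (-(n : ℝ)) := by
            rw [Real.rpow_neg (by linarith), Real.rpow_natCast, inv_pow]
        _ ≤ _ := Real.rpow_le_rpow_of_exponent_le (by linarith) ha1
    have h2 : (1 - ε) ^ (2 * n) ≤ r ^ (n - 1) * ρ ^ (n - 1) := by
      rw [hpow, pow_mul]
      calc ((1 - ε) ^ 2) ^ n ≤ ((1 - ε) ^ 2) ^ (n - 1) :=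
            pow_le_pow_of_le_one (by positivity) (by nlinarith) (by omega)
        _ ≤ _ := by gcongr
    have h3 : (1 + 3 * ε) ^ (-(((n : ℝ) + s) / 2)) * θ ^ (-((n : ℝ) + s))
        ≤ N ^ (-(((n : ℝ) + s) / 2)) := by
      rw [← sq_rpow_half hθ.le, ← Real.mul_rpow (by linarith) (by positivity)]
      exact Real.rpow_le_rpow_of_nonpos hN0 hN2 ha0
    have h4 : 1 - 5 * n * ε ≤ (1 - ε) ^ (2 * n) * (1 - 3 * ε) ^ n := by
      calc 1 - 5 * n * ε = 1 + n * (-(5 * ε)) := by ring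
        _ ≤ (1 + -(5 * ε)) ^ n := one_add_mul_le_pow (by linarith) n
        _ ≤ ((1 - ε) ^ 2 * (1 - 3 * ε)) ^ n := by
            gcongr
            · linarith
            · nlinarith [mul_nonneg hε hε]
        _ = _ := by rw [mul_pow, pow_mul]
    calc _ ≤ ((1 - ε) ^ (2 * n) * (1 - 3 * ε) ^ n) * θ ^ (-((n : ℝ) + s)) := by gcongr
      _ ≤ (r ^ (n - 1) * ρ ^ (n - 1) * (1 + 3 * ε) ^ (-(((n : ℝ) + s) / 2)))
            * θ ^ (-((n : ℝ) + s)) := by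
          have : 0 ≤ (1 - 3 * ε) ^ n := pow_nonneg (by linarith) n
          refine mul_le_mul_of_nonneg_right (mul_le_mul h2 h1 this hP0) hθp.le
      _ ≤ gk n s t r ρ := by
          rw [gk, ← hN, mul_assoc]
          exact mul_le_mul_of_nonneg_left h3 hP0
  · have h3 : N ^ (-(((n : ℝ) + s) / 2)) ≤ (1 / 4) ^ (-(((n : ℝ) + s) / 2))
        * θ ^ (-((n : ℝ) + s)) := by
      rw [← sq_rpow_half hθ.le, ← Real.mul_rpow (by norm_num) (by positivity)]
      exact Real.rpow_le_rpow_of_nonpos (by positivity) hN1 ha0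
    have h4 : (1 / 4 : ℝ) ^ (-(((n : ℝ) + s) / 2)) ≤ 4 ^ n := by
      rw [one_div, Real.inv_rpow (by norm_num), ← Real.rpow_neg (by norm_num), neg_neg,
        ← Real.rpow_natCast]
      exact Real.rpow_le_rpow_of_exponent_le (by norm_num) (by linarith)
    have h5 : r ^ (n - 1) * ρ ^ (n - 1) ≤ 4 ^ n := by
      rw [hpow]
      calc (r * ρ) ^ (n - 1) ≤ 4 ^ (n - 1) := by
            gcongr
        _ ≤ 4 ^ n := pow_le_pow_right₀ (by norm_num) (by omega)
    rw [gk, ← hN]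
    calc _ ≤ (4 : ℝ) ^ n * ((4 : ℝ) ^ n * θ ^ (-((n : ℝ) + s))) := by
          have h6 : 0 ≤ N ^ (-(((n : ℝ) + s) / 2)) := Real.rpow_nonneg hN0.le _
          have h7 := h3.trans (mul_le_mul_of_nonneg_right h4 hθp.le)
          exact mul_le_mul h5 h7 h6 (by positivity)
      _ = _ := by rw [← mul_assoc, ← mul_pow]; norm_num

lemma radSq_bounds {n : ℕ} (hn : 2 ≤ n) {s ε θ t p q : ℝ} (hs : s ∈ Ioo (0 : ℝ) 1) (hε : 0 ≤ ε)
    (hε1 : 5 * n * ε ≤ 1) (hθ : 0 < θ) (hθt : θ ^ 2 = 2 - 2 * t)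
    (hp : p ∈ Icc (1 - ε) (1 + ε)) (hq : q ∈ Icc (1 - ε) (1 + ε)) (hpq : |p - q| ≤ ε * θ) :
    ENNReal.ofReal ((1 - 5 * n * ε) * ((p - q) ^ 2 * θ ^ (-((n : ℝ) + s)))) ≤ radSq n s t p q ∧
      radSq n s t p q ≤ ENNReal.ofReal (16 ^ n * ((p - q) ^ 2 * θ ^ (-((n : ℝ) + s)))) := by
  have hnR : (2 : ℝ) ≤ n := by exact_mod_cast hn
  have hε2 : ε ≤ 1 / 5 := by nlinarith
  have hθp : 0 < θ ^ (-((n : ℝ) + s)) := Real.rpow_pos_of_pos hθ _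
  have key : ∀ r ∈ Ico (min p q) (max p q), ∀ ρ ∈ Ico (min p q) (max p q),
      (1 - 5 * n * ε) * θ ^ (-((n : ℝ) + s)) ≤ gk n s t r ρ ∧
      gk n s t r ρ ≤ 16 ^ n * θ ^ (-((n : ℝ) + s)) := by
    intro r hr ρ hρ
    have m1 : 1 - ε ≤ min p q := le_min hp.1 hq.1
    have m2 : max p q ≤ 1 + ε := max_le hp.2 hq.2
    refine gk_bounds hn hs hε hε2 hθ hθt ⟨m1.trans hr.1, hr.2.le.trans m2⟩
      ⟨m1.trans hρ.1, hρ.2.le.trans m2⟩ (le_trans ?_ hpq)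
    rw [← max_sub_min_eq_abs' p q, abs_le]
    constructor <;> linarith [hr.1, hr.2, hρ.1, hρ.2]
  constructor
  · rw [show (1 - 5 * n * ε) * ((p - q) ^ 2 * θ ^ (-((n : ℝ) + s)))
      = (1 - 5 * n * ε) * θ ^ (-((n : ℝ) + s)) * (p - q) ^ 2 by ring]
    exact radSq_ge (mul_nonneg (by linarith) hθp.le) fun r hr ρ hρ => (key r hr ρ hρ).1
  · rw [show 16 ^ n * ((p - q) ^ 2 * θ ^ (-((n : ℝ) + s)))
      = 16 ^ n * θ ^ (-((n : ℝ) + s)) * (p - q) ^ 2 by ring]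
    exact radSq_le (by positivity) fun r hr ρ hρ => (key r hr ρ hρ).2

lemma one_add_pow_le {ε : ℝ} (h0 : 0 ≤ ε) (h1 : ε ≤ 1) (m : ℕ) :
    (1 + ε) ^ m ≤ 1 + (2 ^ m - 1) * ε := by
  induction m with
  | zero => simp
  | succ m ih =>
    have h2 : (1 : ℝ) ≤ 2 ^ m := one_le_pow₀ (by norm_num)
    rw [pow_succ, pow_succ]
    calc (1 + ε) ^ m * (1 + ε) ≤ (1 + (2 ^ m - 1) * ε) * (1 + ε) := by gcongr
      _ ≤ _ := by
        nlinarith [mul_nonneg (mul_nonneg (sub_nonneg.2 h2) h0) (sub_nonneg.2 h1)]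

lemma hasDerivAt_profile {n : ℕ} (hn : 2 ≤ n) (s K : ℝ) {u : ℝ} (hu : 0 < 1 + u) :
    HasDerivAt (fun u : ℝ => (1 + u) ^ ((n : ℝ) - s) - 1
        - (((n : ℝ) - s) / n) * ((1 + u) ^ n - 1) + K / 2 * u ^ 2)
      (((n : ℝ) - s) * (1 + u) ^ (n - 1) * ((1 + u) ^ (-s) - 1) + K * u) u := by
  have hn0 : (n : ℝ) ≠ 0 := by positivity
  have h1 : HasDerivAt (fun u : ℝ => 1 + u) 1 u := by simpa using (hasDerivAt_id u).const_add 1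
  have h2 := h1.rpow_const (p := (n : ℝ) - s) (Or.inl hu.ne')
  have h3 := h1.fun_pow n
  have h4 := (hasDerivAt_pow 2 u).const_mul (K / 2)
  refine (((h2.sub_const 1).fun_sub ((h3.sub_const 1).const_mul (((n : ℝ) - s) / n))).fun_add
    h4).congr_deriv ?_
  have e : (1 + u) ^ ((n : ℝ) - s - 1) = (1 + u) ^ (n - 1) * (1 + u) ^ (-s) := by
    rw [← Real.rpow_natCast, ← Real.rpow_add hu, Nat.cast_sub (by omega)]
    congr 1
    push_cast
    ring
  rw [e]
  field_simp
  push_cast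
  ring

lemma profile_ge {n : ℕ} (hn : 2 ≤ n) {s ε u : ℝ} (hs : s ∈ Ioo (0 : ℝ) 1)
    (hε1 : ε ≤ 1 / 2) (hu : |u| ≤ ε) :
    -(s * ((n : ℝ) - s) / 2 * (1 + 2 ^ n * ε) * u ^ 2) ≤ (1 + u) ^ ((n : ℝ) - s) - 1
        - (((n : ℝ) - s) / n) * ((1 + u) ^ n - 1) := by
  have hε : 0 ≤ ε := (abs_nonneg u).trans hu
  obtain ⟨hs0, hs1⟩ := hs
  have hnR : (2 : ℝ) ≤ n := by exact_mod_cast hn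
  have hns : 0 < (n : ℝ) - s := by linarith
  set K := s * ((n : ℝ) - s) * (1 + 2 ^ n * ε) with hK
  have hK0 : 0 ≤ K := by positivity
  have hKge : s * ((n : ℝ) - s) ≤ K := by
    rw [hK]
    exact le_mul_of_one_le_right (by positivity) (by nlinarith [pow_pos (two_pos : (0 : ℝ) < 2) n])
  set H : ℝ → ℝ := fun u => (1 + u) ^ ((n : ℝ) - s) - 1
        - (((n : ℝ) - s) / n) * ((1 + u) ^ n - 1) + K / 2 * u ^ 2 with hH
  have hd : ∀ u, 0 < 1 + u → HasDerivAt H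
      (((n : ℝ) - s) * (1 + u) ^ (n - 1) * ((1 + u) ^ (-s) - 1) + K * u) u :=
    fun u hu => hasDerivAt_profile hn s K hu
  have hH0 : H 0 = 0 := by simp [hH]
  have hu2 := abs_le.1 hu
  suffices 0 ≤ H u by
    simp only [hH] at this
    have e : s * ((n : ℝ) - s) / 2 * (1 + 2 ^ n * ε) * u ^ 2 = K / 2 * u ^ 2 := by rw [hK]; ring
    rw [e]; linarith
  rcases le_total 0 u with h0 | h0
  · have hm : MonotoneOn H (Icc 0 ε) := by
      refine monotoneOn_of_hasDerivWithinAt_nonneg (convex_Icc _ _)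
        (fun v hv => (hd v (by linarith [hv.1])).continuousAt.continuousWithinAt)
        (fun v hv => (hd v ?_).hasDerivWithinAt) ?_
      · rw [interior_Icc] at hv; linarith [hv.1]
      · intro v hv
        rw [interior_Icc] at hv
        have hv0 := hv.1
        have b1 : 1 - s * v ≤ (1 + v) ^ (-s) := by
          have := rpow_one_add_le_one_add_mul_self (s := v) (by linarith) hs0.le hs1.le
          have hp : 0 < (1 + v) ^ s := Real.rpow_pos_of_pos (by linarith) _
          rw [Real.rpow_neg (by linarith), ← one_div, le_div_iff₀ hp]
          have h5 : 0 ≤ s * v := by positivity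
          by_cases h6 : s * v ≤ 1
          · nlinarith
          · nlinarith
        have b2 : (1 + v) ^ (n - 1) ≤ 1 + 2 ^ n * ε := by
          calc (1 + v) ^ (n - 1) ≤ (1 + ε) ^ (n - 1) := by
                gcongr
                exact hv.2.le
            _ ≤ (1 + ε) ^ n := pow_le_pow_right₀ (by linarith) (by omega)
            _ ≤ 1 + (2 ^ n - 1) * ε := one_add_pow_le hε (by linarith) n
            _ ≤ _ := by nlinarith
        have b3 : ((n : ℝ) - s) * (1 + v) ^ (n - 1) * (-(s * v))
            ≤ ((n : ℝ) - s) * (1 + v) ^ (n - 1) * ((1 + v) ^ (-s) - 1) := by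
          gcongr
          linarith
        have b4 : ((n : ℝ) - s) * s * v * (1 + v) ^ (n - 1) ≤ ((n : ℝ) - s) * s * v
            * (1 + 2 ^ n * ε) := by gcongr
        rw [hK]
        linarith
    have := hm ⟨le_rfl, hε⟩ ⟨h0, hu2.2⟩ h0
    rwa [hH0] at this
  · have hm : AntitoneOn H (Icc (-ε) 0) := by
      refine antitoneOn_of_hasDerivWithinAt_nonpos (convex_Icc _ _)
        (fun v hv => (hd v (by linarith [hv.1])).continuousAt.continuousWithinAt)
        (fun v hv => (hd v ?_).hasDerivWithinAt) ?_
      · rw [interior_Icc] at hv; linarith [hv.1]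
      · intro v hv
        rw [interior_Icc] at hv
        have hv0 := hv.1
        have hv1 := hv.2
        have hpos : 0 < 1 + v := by linarith
        have b1 : (1 + v) ^ (-s) ≤ 1 + s * (-v / (1 + v)) := by
          have := rpow_one_add_le_one_add_mul_self (s := -v / (1 + v))
            (le_trans (by norm_num) (div_nonneg (by linarith) hpos.le)) hs0.le hs1.le
          have e : 1 + -v / (1 + v) = (1 + v)⁻¹ := by field_simp; ring
          rw [e, Real.inv_rpow hpos.le, ← Real.rpow_neg hpos.le] at this
          exact this
        have b2 : (1 + v) ^ (n - 1) * (-v / (1 + v)) ≤ -v := by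
          have : (1 + v) ^ (n - 1) ≤ (1 + v) ^ 1 :=
            pow_le_pow_of_le_one hpos.le (by linarith) (by omega)
          calc _ ≤ (1 + v) ^ 1 * (-v / (1 + v)) := by
                gcongr
                exact div_nonneg (by linarith) hpos.le
            _ = -v := by field_simp
        have b3 : ((n : ℝ) - s) * (1 + v) ^ (n - 1) * ((1 + v) ^ (-s) - 1)
            ≤ ((n : ℝ) - s) * (1 + v) ^ (n - 1) * (s * (-v / (1 + v))) := by
          gcongr
          linarith
        have b4 : ((n : ℝ) - s) * s * ((1 + v) ^ (n - 1) * (-v / (1 + v)))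
            ≤ ((n : ℝ) - s) * s * (-v) := by gcongr
        nlinarith
    have := hm ⟨hu2.1, h0⟩ ⟨by linarith, le_rfl⟩ h0
    rwa [hH0] at this

lemma sph_restrict (n : ℕ) : (sph n).restrict (sphere 0 1) = sph n :=
  Measure.restrict_eq_self_of_ae_mem (sph_ae_sphere n)

lemma aestronglyMeasurable_sph {n : ℕ} {F : Type*} [NormedAddCommGroup F] {f : V n → F}
    (hf : ContinuousOn f (sphere 0 1)) : AEStronglyMeasurable f (sph n) := by
  rw [← sph_restrict]
  exact hf.aestronglyMeasurable_of_isCompact (isCompact_sphere _ _) isClosed_sphere.measurableSet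

lemma integrable_sph_of_continuousOn {n : ℕ} {f : V n → ℝ}
    (hf : ContinuousOn f (sphere 0 1)) : Integrable f (sph n) := by
  obtain ⟨C, hC⟩ := (isCompact_sphere (0 : V n) 1).exists_bound_of_continuousOn hf
  refine Integrable.of_bound (aestronglyMeasurable_sph hf) C ?_
  filter_upwards [sph_ae_sphere n] with x hx using hC x hx

/-- Infinitesimal rotation invariance of the surface measure. -/
lemma integral_skew {n : ℕ} {f : V n → ℝ} {f' : V n → V n →L[ℝ] ℝ}
    (hf : ∀ z ∈ sphere (0 : V n) 1, HasFDerivAt f (f' z) z)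
    (hf' : ContinuousOn f' (sphere 0 1)) {S : V n →L[ℝ] V n} (hS : star S = -S) :
    ∫ z, f' z (S z) ∂sph n = 0 := by
  have hu : ∀ τ : ℝ, NormedSpace.exp (τ • S) ∈ unitary (V n →L[ℝ] V n) := fun τ =>
    let _ : NormedAlgebra ℚ (V n →L[ℝ] V n) := NormedAlgebra.restrictScalars ℚ ℝ _
    NormedSpace.exp_mem_unitary_of_mem_skewAdjoint (by
      rw [skewAdjoint.mem_iff, star_smul, hS]; simp)
  set R : ℝ → V n ≃ₗᵢ[ℝ] V n := fun τ => Unitary.linearIsometryEquiv ⟨_, hu τ⟩ with hR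
  have hRe : ∀ τ z, R τ z = NormedSpace.exp (τ • S) z := fun τ z => rfl
  have hfc : ContinuousOn f (sphere 0 1) := fun z hz => (hf z hz).continuousAt.continuousWithinAt
  have hRs : ∀ τ z, z ∈ sphere (0 : V n) 1 → R τ z ∈ sphere (0 : V n) 1 := by
    intro τ z hz
    simpa using hz
  obtain ⟨C, hC⟩ := (isCompact_sphere (0 : V n) 1).exists_bound_of_continuousOn hf'
  have hd : ∀ τ z, HasDerivAt (fun τ => R τ z) (R τ (S z)) τ := by
    intro τ z
    have h := (hasDerivAt_exp_smul_const (𝕂 := ℝ) S τ).clm_apply (hasDerivAt_const τ z)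
    simp only [map_zero, add_zero] at h
    exact h
  have key := hasDerivAt_integral_of_dominated_loc_of_deriv_le (μ := sph n) (x₀ := (0 : ℝ))
    (s := univ) (F := fun τ z => f (R τ z)) (F' := fun τ z => f' (R τ z) (R τ (S z)))
    (bound := fun _ => C * ‖S‖) univ_mem
    (Eventually.of_forall fun τ => aestronglyMeasurable_sph
      (hfc.comp (R τ).continuous.continuousOn fun z hz => hRs τ z hz))
    (integrable_sph_of_continuousOn
      (hfc.comp (R 0).continuous.continuousOn fun z hz => hRs 0 z hz))
    (aestronglyMeasurable_sph
      ((hf'.comp (R 0).continuous.continuousOn fun z hz => hRs 0 z hz).clm_apply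
        ((R 0).continuous.comp S.continuous).continuousOn))
    (by
      filter_upwards [sph_ae_sphere n] with z hz τ _
      have hz1 : ‖z‖ = 1 := by simpa using hz
      calc ‖f' (R τ z) (R τ (S z))‖ ≤ ‖f' (R τ z)‖ * ‖R τ (S z)‖ := (f' _).le_opNorm _
        _ ≤ C * ‖S‖ := by
          rw [LinearIsometryEquiv.norm_map]
          have h1 := hC _ (hRs τ z hz)
          have h2 : ‖S z‖ ≤ ‖S‖ := by simpa [hz1] using S.le_opNorm z
          exact mul_le_mul h1 h2 (norm_nonneg _) ((norm_nonneg _).trans h1))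
    (integrable_const _)
    (by
      filter_upwards [sph_ae_sphere n] with z hz τ _
      exact (hf _ (hRs τ z hz)).comp_hasDerivAt τ (hd τ z))
  have hconst : (fun τ => ∫ z, f (R τ z) ∂sph n) = fun _ => ∫ z, f z ∂sph n := by
    funext τ
    exact (sph_map_isometry (R τ)).integral_comp (R τ).toHomeomorph.measurableEmbedding f
  have h2 := key.2
  rw [hconst] at h2
  have h3 := h2.unique (hasDerivAt_const _ _)
  have hR0 : ∀ z, R 0 z = z := by
    intro z
    rw [hRe, zero_smul ℝ S, NormedSpace.exp_zero, one_apply_eq_self]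
  simpa only [hR0] using h3

/-- Integration by parts on the sphere in the direction of a fixed vector. -/
lemma integral_by_parts {n : ℕ} {g : V n → ℝ} {g' : V n → V n →L[ℝ] ℝ}
    (hg : ∀ z ∈ sphere (0 : V n) 1, HasFDerivAt g (g' z) z)
    (hg' : ContinuousOn g' (sphere 0 1)) (x : V n) :
    ∫ z, (((n : ℝ) - 1) * ⟪x, z⟫ * g z + ⟪x, z⟫ * g' z z - g' z x) ∂sph n = 0 := by
  have hgc : ContinuousOn g (sphere 0 1) := fun z hz => (hg z hz).continuousAt.continuousWithinAt
  let e := EuclideanSpace.basisFun (Fin n) ℝ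
  let S : Fin n → V n →L[ℝ] V n := fun b =>
    (innerSL ℝ x).smulRight (e b) - (innerSL ℝ (e b)).smulRight x
  have hSe : ∀ b z, S b z = ⟪x, z⟫ • e b - ⟪e b, z⟫ • x := fun b z => by simp [S]
  have hS : ∀ b, star (S b) = -S b := by
    intro b
    rw [ContinuousLinearMap.star_eq_adjoint, eq_comm, ContinuousLinearMap.eq_adjoint_iff]
    intro z w
    rw [neg_apply, hSe, hSe]
    simp only [inner_neg_left, inner_sub_left, inner_sub_right, real_inner_smul_left,
      real_inner_smul_right]
    rw [real_inner_comm z (e b), real_inner_comm z x]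
    ring
  let f' : Fin n → V n → V n →L[ℝ] ℝ := fun b z => ⟪e b, z⟫ • g' z + g z • innerSL ℝ (e b)
  have hf : ∀ b, ∀ z ∈ sphere (0 : V n) 1,
      HasFDerivAt (fun z => ⟪e b, z⟫ * g z) (f' b z) z := fun b z hz =>
    ((innerSL ℝ (e b)).hasFDerivAt (x := z)).mul (hg z hz)
  have hf' : ∀ b, ContinuousOn (f' b) (sphere 0 1) := fun b =>
    ((by fun_prop : Continuous fun z : V n => ⟪e b, z⟫).continuousOn.smul hg').add
      (hgc.smul continuousOn_const)
  have h1 : ∀ b, ∫ z, f' b z (S b z) ∂sph n = 0 := fun b => integral_skew (hf b) (hf' b) (hS b)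
  have h2 : ∫ z, ∑ b, f' b z (S b z) ∂sph n = 0 := by
    rw [integral_finsetSum]
    · simp [h1]
    · intro b _
      exact integrable_sph_of_continuousOn ((hf' b).clm_apply (S b).continuous.continuousOn)
  rw [← h2]
  refine integral_congr_ae ?_
  filter_upwards [sph_ae_norm n] with z hz
  have hb : ∀ b, f' b z (S b z) = ⟪x, z⟫ * g' z (⟪e b, z⟫ • e b) - ⟪e b, z⟫ ^ 2 * g' z x
      + (⟪x, z⟫ * g z - g z * (⟪x, e b⟫ * ⟪e b, z⟫)) := by
    intro b
    have : ⟪e b, e b⟫ = 1 := by simp [e]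
    simp only [f', hSe, add_apply, smul_apply, map_sub,
      map_smul, innerSL_apply_apply, smul_eq_mul, this]
    rw [real_inner_comm (e b) x]
    ring
  simp only [hb]
  have s1 : ∑ b, ⟪e b, z⟫ • e b = z := e.sum_repr' z
  have s2 : ∑ b, ⟪e b, z⟫ ^ 2 = 1 := by
    have := e.sum_sq_norm_inner_right z
    rw [hz] at this
    simpa using this
  have s3 : ∑ b, ⟪x, e b⟫ * ⟪e b, z⟫ = ⟪x, z⟫ := e.sum_inner_mul_inner x z
  rw [Finset.sum_add_distrib, Finset.sum_sub_distrib, Finset.sum_sub_distrib, ← Finset.mul_sum,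
    ← map_sum, s1, ← Finset.sum_mul, s2, Finset.sum_const, ← Finset.mul_sum, s3]
  simp
  ring

lemma inner_mem_Icc {n : ℕ} {x y : V n} (hx : ‖x‖ = 1) (hy : ‖y‖ = 1) :
    ⟪x, y⟫ ∈ Icc (-1 : ℝ) 1 := by
  have := abs_le.1 (abs_real_inner_le_norm x y)
  rw [hx, hy] at this
  simpa using this

lemma integral_by_parts_zonal {n : ℕ} {x : V n} (hx : ‖x‖ = 1) {ψ ψ' : ℝ → ℝ}
    (hψ : ∀ t ∈ Icc (-1 : ℝ) 1, HasDerivAt ψ (ψ' t) t) (hψ' : ContinuousOn ψ' (Icc (-1) 1)) :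
    ∫ z, (((n : ℝ) - 1) * ⟪x, z⟫ * ψ ⟪x, z⟫ - (1 - ⟪x, z⟫ ^ 2) * ψ' ⟪x, z⟫) ∂sph n = 0 := by
  have hm : MapsTo (fun z : V n => ⟪x, z⟫) (sphere 0 1) (Icc (-1) 1) := fun z hz =>
    inner_mem_Icc hx (by simpa using hz)
  have := integral_by_parts (g := fun z => ψ ⟪x, z⟫) (g' := fun z => ψ' ⟪x, z⟫ • innerSL ℝ x)
    (fun z hz => by
      have h := (hψ _ (hm hz)).hasFDerivAt.comp z ((innerSL ℝ x).hasFDerivAt (x := z))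
      refine h.congr_fderiv ?_
      ext w
      simp [mul_comm])
    ((hψ'.comp (by fun_prop) hm).smul continuousOn_const) x
  rw [← this]
  refine integral_congr_ae (Eventually.of_forall fun z => ?_)
  simp [hx]
  ring

lemma sph_singleton {n : ℕ} (hn : 2 ≤ n) (x : V n) : sph n {x} = 0 := by
  rw [sph_apply (measurableSet_singleton x)]
  have hlt : (Submodule.span ℝ {x} : Submodule ℝ (V n)) ≠ ⊤ := by
    intro h
    have h1 := finrank_span_le_card (R := ℝ) ({x} : Set (V n))
    rw [h, finrank_top] at h1
    simp at h1
    omega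
  have h0 := Measure.addHaar_submodule (volume : Measure (V n)) _ hlt
  refine mul_eq_zero_of_right _ (measure_mono_null ?_ h0)
  rintro z ⟨r, -, y, ⟨hy, -⟩, rfl⟩
  rw [mem_singleton_iff.1 hy]
  exact Submodule.smul_mem _ _ (Submodule.mem_span_singleton_self x)

lemma ae_inner_lt_one {n : ℕ} (hn : 2 ≤ n) {x : V n} (hx : ‖x‖ = 1) :
    ∀ᵐ z ∂sph n, ⟪x, z⟫ < 1 := by
  have h : ∀ᵐ z ∂sph n, z ≠ x := by
    rw [ae_iff]; simpa using sph_singleton hn x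
  filter_upwards [h, sph_ae_norm n] with z hz hz1
  refine lt_of_le_of_ne (inner_mem_Icc hx hz1).2 fun h1 => hz ?_
  exact ((inner_eq_one_iff_of_norm_eq_one hx hz1).1 h1).symm

lemma integral_zonal_rpow_le {n : ℕ} {b δ r : ℝ} (hb : 0 < b) (hδ : 0 < δ)
    (hbδ : 2 * b + δ = n - 1) (hr : r ∈ Ico (0 : ℝ) 1) {x : V n} (hx : ‖x‖ = 1) :
    ∫ z, (1 - r * ⟪x, z⟫) ^ (-b) ∂sph n
      ≤ 8 * (δ + b) / δ * (δ / (4 * (δ + b))) ^ (-b) * (sph n).real univ := by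
  obtain ⟨hr0, hr1⟩ := hr
  have hX : ∀ t ∈ Icc (-1 : ℝ) 1, 0 < 1 - r * t := fun t ht => by nlinarith [ht.1, ht.2]
  have hd : ∀ t ∈ Icc (-1 : ℝ) 1, HasDerivAt (fun t => (1 - r * t) ^ (-b))
      (b * r * (1 - r * t) ^ (-b - 1)) t := by
    intro t ht
    have h1 : HasDerivAt (fun t : ℝ => 1 - r * t) (-r) t := by
      simpa using ((hasDerivAt_id t).const_mul r).const_sub 1
    refine (h1.rpow_const (p := -b) (Or.inl (hX t ht).ne')).congr_deriv ?_
    ring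
  have hcp : ∀ p : ℝ, ContinuousOn (fun t : ℝ => (1 - r * t) ^ p) (Icc (-1) 1) := fun p =>
    ContinuousOn.rpow_const (by fun_prop) fun t ht => Or.inl (hX t ht).ne'
  have hibp := integral_by_parts_zonal (n := n) hx hd (continuousOn_const.mul (hcp _))
  have hm : MapsTo (fun z : V n => ⟪x, z⟫) (sphere 0 1) (Icc (-1) 1) := fun z hz =>
    inner_mem_Icc hx (by simpa using hz)
  have hcomp : ∀ p : ℝ, ContinuousOn (fun z : V n => (1 - r * ⟪x, z⟫) ^ p) (sphere 0 1) :=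
    fun p => (hcp p).comp (by fun_prop) hm
  have hfi := integrable_sph_of_continuousOn (hcomp (-b))
  set η := δ / (4 * (δ + b)) with hη
  have hη0 : 0 < η := by positivity
  have hle : ∫ z, (δ / 2 * (1 - r * ⟪x, z⟫) ^ (-b) - 4 * (δ + b) * η ^ (-b)) ∂sph n ≤ 0 := by
    rw [← hibp]
    refine integral_mono_ae ((hfi.const_mul _).sub (integrable_const _)) ?_ ?_
    · refine integrable_sph_of_continuousOn ?_
      have h1 := hcomp (-b)
      have h2 := hcomp (-b - 1)
      have h3 : ContinuousOn (fun z : V n => ⟪x, z⟫) (sphere 0 1) := by fun_prop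
      exact ((continuousOn_const.mul h3).mul h1).sub
        ((continuousOn_const.sub (h3.pow 2)).mul (continuousOn_const.mul h2))
    · filter_upwards [sph_ae_norm n] with z hz
      have ht := inner_mem_Icc hx hz
      set t := ⟪x, z⟫
      have hX0 := hX t ht
      have e : (1 - r * t) ^ (-b - 1) = (1 - r * t) ^ (-b) / (1 - r * t) :=
        Real.rpow_sub_one hX0.ne' _
      set X := 1 - r * t with hXd
      have hP : 0 < X ^ (-b) := Real.rpow_pos_of_pos hX0 _
      have hX2 : X ≤ 2 := by nlinarith [ht.1, ht.2]
      have h1t : 1 - t ≤ 2 * X := by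
        rcases le_total 0 t with h | h <;> nlinarith [ht.1, ht.2]
      have hk : (1 - t ^ 2) * (b * r * (X ^ (-b) / X)) ≤ b * (1 + t) * X ^ (-b) := by
        have h5 : r * (1 - t) / X ≤ 1 := by
          rw [div_le_one hX0]; nlinarith [ht.2]
        calc _ = (b * (1 + t) * X ^ (-b)) * (r * (1 - t) / X) := by ring
          _ ≤ (b * (1 + t) * X ^ (-b)) * 1 := by
            refine mul_le_mul_of_nonneg_left h5 ?_
            have : 0 ≤ 1 + t := by linarith [ht.1]
            positivity
          _ = _ := mul_one _
      have hq : 2 * (δ + b) * X * X ^ (-b) ≤ δ / 2 * X ^ (-b) + 4 * (δ + b) * η ^ (-b) := by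
        have hηp : 0 < η ^ (-b) := Real.rpow_pos_of_pos hη0 _
        rcases le_total X η with h | h
        · have : 2 * (δ + b) * X ≤ δ / 2 := by
            rw [hη, le_div_iff₀ (by positivity)] at h
            linarith
          have := mul_le_mul_of_nonneg_right this hP.le
          have : 0 ≤ 4 * (δ + b) * η ^ (-b) := by positivity
          linarith
        · have h6 : X ^ (-b) ≤ η ^ (-b) :=
            Real.rpow_le_rpow_of_nonpos hη0 h (by linarith)
          have h7 : 2 * (δ + b) * X * X ^ (-b) ≤ 2 * (δ + b) * 2 * η ^ (-b) := by gcongr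
          have : 0 ≤ δ / 2 * X ^ (-b) := by positivity
          linarith
      rw [e, ← hbδ]
      have h8 : (δ + b) * (1 - t) * X ^ (-b) ≤ 2 * (δ + b) * X * X ^ (-b) := by
        have := mul_le_mul_of_nonneg_left h1t (show 0 ≤ (δ + b) * X ^ (-b) by positivity)
        linarith
      have e2 : (2 * b + δ) * t * X ^ (-b) = δ * X ^ (-b) + b * (1 + t) * X ^ (-b)
        - (δ + b) * (1 - t) * X ^ (-b) - b * (1 - t) * X ^ (-b) + b * (1 - t) * X ^ (-b)
        - (δ + b) * (1 - t) * X ^ (-b) + (δ + b) * (1 - t) * X ^ (-b) := by ring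
      linarith
  rw [integral_sub (hfi.const_mul _) (integrable_const _), integral_const_mul, integral_const,
    smul_eq_mul] at hle
  rw [show 8 * (δ + b) / δ * η ^ (-b) * (sph n).real univ
    = (2 / δ) * ((sph n).real univ * (4 * (δ + b) * η ^ (-b))) by ring]
  have : ∫ z, (1 - r * ⟪x, z⟫) ^ (-b) ∂sph n
      = (2 / δ) * (δ / 2 * ∫ z, (1 - r * ⟪x, z⟫) ^ (-b) ∂sph n) := by field_simp
  rw [this]
  exact mul_le_mul_of_nonneg_left (by linarith) (by positivity)

lemma integrable_one_sub_inner {n : ℕ} (hn : 2 ≤ n) {b : ℝ} (hb : 0 < b) (hb2 : 2 * b < n - 1)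
    {x : V n} (hx : ‖x‖ = 1) : Integrable (fun z => (1 - ⟪x, z⟫) ^ (-b)) (sph n) := by
  obtain ⟨C, hC⟩ : ∃ C : ℝ, ∀ r ∈ Ico (0 : ℝ) 1, ∫ z, (1 - r * ⟪x, z⟫) ^ (-b) ∂sph n ≤ C :=
    ⟨_, fun r hr => integral_zonal_rpow_le (δ := n - 1 - 2 * b) hb (by linarith) (by ring) hr hx⟩
  have hm : Measurable fun z : V n => (1 - ⟪x, z⟫) ^ (-b) := by fun_prop
  refine ⟨hm.aestronglyMeasurable, ?_⟩
  let ρ : ℕ → ℝ := fun k => 1 - 1 / ((k : ℝ) + 1)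
  have hρ : ∀ k, ρ k ∈ Ico (0 : ℝ) 1 := fun k => by
    have h1 : (0 : ℝ) < 1 / ((k : ℝ) + 1) := by positivity
    have h2 : 1 / ((k : ℝ) + 1) ≤ 1 := by
      rw [div_le_one (by positivity)]; linarith [Nat.cast_nonneg (α := ℝ) k]
    constructor <;> simp only [ρ] <;> linarith
  have hρt : Tendsto ρ atTop (𝓝 1) := by
    simpa [ρ] using (tendsto_one_div_add_atTop_nhds_zero_nat (𝕜 := ℝ)).const_sub 1
  have hle : ∫⁻ z, ENNReal.ofReal ((1 - ⟪x, z⟫) ^ (-b)) ∂sph n ≤ ENNReal.ofReal C := by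
    calc _ ≤ ∫⁻ z, liminf (fun k => ENNReal.ofReal ((1 - ρ k * ⟪x, z⟫) ^ (-b))) atTop ∂sph n := by
          refine lintegral_mono_ae ?_
          filter_upwards [ae_inner_lt_one hn hx] with z hz
          refine le_of_eq (Tendsto.liminf_eq ?_).symm
          refine ENNReal.tendsto_ofReal ?_
          refine Tendsto.rpow_const ?_ (Or.inl (by linarith))
          simpa using (hρt.mul_const ⟪x, z⟫).const_sub 1
      _ ≤ liminf (fun k => ∫⁻ z, ENNReal.ofReal ((1 - ρ k * ⟪x, z⟫) ^ (-b)) ∂sph n) atTop :=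
          lintegral_liminf_le fun k => by fun_prop
      _ ≤ ENNReal.ofReal C := by
          refine liminf_le_of_le (by isBoundedDefault) fun c hc => ?_
          obtain ⟨k, hk⟩ := hc.exists
          refine hk.trans ?_
          have hpos : ∀ z : V n, ‖z‖ = 1 → 0 < 1 - ρ k * ⟪x, z⟫ := fun z hz => by
            have := inner_mem_Icc hx hz
            nlinarith [this.1, this.2, (hρ k).1, (hρ k).2]
          rw [← ofReal_integral_eq_lintegral_ofReal]
          · exact ENNReal.ofReal_le_ofReal (hC _ (hρ k))
          · refine integrable_sph_of_continuousOn (ContinuousOn.rpow_const (by fun_prop) ?_)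
            exact fun z hz => Or.inl (hpos z (by simpa using hz)).ne'
          · filter_upwards [sph_ae_norm n] with z hz
            exact Real.rpow_nonneg (hpos z hz).le _
  refine lt_of_le_of_lt (le_of_eq ?_) (hle.trans_lt ENNReal.ofReal_lt_top)
  refine lintegral_congr_ae ?_
  filter_upwards [sph_ae_norm n] with z hz
  rw [← ofReal_norm, Real.norm_of_nonneg]
  exact Real.rpow_nonneg (by linarith [(inner_mem_Icc hx hz).2]) _

/-- The exponent `(n+s)/2 - 1`, at which the chordal kernel is integrable. -/
lemma integrable_chord {n : ℕ} (hn : 2 ≤ n) {s : ℝ} (hs : s ∈ Ioo (0 : ℝ) 1)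
    {x : V n} (hx : ‖x‖ = 1) :
    Integrable (fun z => (1 - ⟪x, z⟫) ^ (1 - ((n : ℝ) + s) / 2)) (sph n) := by
  have hnR : (2 : ℝ) ≤ n := by exact_mod_cast hn
  have := integrable_one_sub_inner hn (b := ((n : ℝ) + s) / 2 - 1) (by linarith [hs.1])
    (by linarith [hs.2]) hx
  simpa using this

/-- The first eigenvalue `∫ |x-z|^{2-n-s}` of the fractional operator on the sphere. -/
noncomputable def lamOne (n : ℕ) (s : ℝ) (x : V n) : ℝ :=
  ∫ z, (2 - 2 * ⟪x, z⟫) ^ (1 - ((n : ℝ) + s) / 2) ∂sph n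

/-- The squared distance `|x - q z|²` in terms of `t = ⟪x, z⟫`. -/
def qd (q t : ℝ) : ℝ := 1 + q ^ 2 - 2 * q * t

lemma qd_pos {q t : ℝ} (hq : q ∈ Ioo (-1 : ℝ) 1) (ht : t ∈ Icc (-1 : ℝ) 1) : 0 < qd q t := by
  obtain ⟨h1, h2⟩ := hq
  obtain ⟨h3, h4⟩ := ht
  unfold qd
  nlinarith [mul_nonneg (sub_nonneg.2 h4) (sq_nonneg (q + 1)),
    mul_nonneg (show 0 ≤ 1 + t by linarith) (sq_nonneg (q - 1)), mul_pos (sub_pos.2 h2) (show 0 < 1 + q by linarith),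
    sq_pos_of_pos (sub_pos.2 h2), sq_pos_of_pos (show 0 < 1 + q by linarith)]

/-- Integrand of the auxiliary potential comparing the perimeter with `lamOne`. -/
noncomputable def jInt (n : ℕ) (s q t : ℝ) : ℝ :=
  (q ^ s * (1 - q * t) - q ^ (n - 1) * (t - q)) * qd q t ^ (-(((n : ℝ) + s) / 2))

/-- The `q`-derivative of `jInt`. -/
noncomputable def jDer (n : ℕ) (s q t : ℝ) : ℝ :=
  s * (q ^ (s - 1) - q ^ (n - 1)) * qd q t ^ (-(((n : ℝ) + s) / 2))
    + (q ^ s - q ^ (n - 2)) * (((n : ℝ) - 1) * t * qd q t ^ (-(((n : ℝ) + s) / 2))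
      - (1 - t ^ 2) * (((n : ℝ) + s) * q * qd q t ^ (-(((n : ℝ) + s) / 2) - 1)))

lemma hasDerivAt_jInt {n : ℕ} (hn : 2 ≤ n) (s : ℝ) {q t : ℝ} (hq : q ∈ Ioo (0 : ℝ) 1)
    (ht : t ∈ Icc (-1 : ℝ) 1) : HasDerivAt (fun q => jInt n s q t) (jDer n s q t) q := by
  obtain ⟨m, rfl⟩ : ∃ m, n = m + 2 := ⟨n - 2, by omega⟩
  have hN := qd_pos ⟨by linarith [hq.1], hq.2⟩ ht
  have h1 : HasDerivAt (fun q : ℝ => q ^ s) (s * q ^ (s - 1)) q :=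
    Real.hasDerivAt_rpow_const (Or.inl hq.1.ne')
  have h2 : HasDerivAt (fun q : ℝ => 1 - q * t) (-t) q := by
    simpa using ((hasDerivAt_id q).mul_const t).const_sub 1
  have h3 : HasDerivAt (fun q : ℝ => q ^ (m + 1)) ((m + 1) * q ^ m) q := by
    simpa using hasDerivAt_pow (m + 1) q
  have h4 : HasDerivAt (fun q : ℝ => t - q) (-1) q := by
    simpa using (hasDerivAt_id q).const_sub t
  have h5 : HasDerivAt (fun q : ℝ => qd q t) (2 * q - 2 * t) q := by
    have := ((hasDerivAt_pow 2 q).const_add 1).fun_sub (((hasDerivAt_id q).const_mul 2).mul_const t)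
    refine this.congr_deriv ?_
    norm_num
  have h6 := h5.rpow_const (p := -((((m + 2 : ℕ) : ℝ) + s) / 2)) (Or.inl hN.ne')
  have h7 := ((h1.fun_mul h2).fun_sub (h3.fun_mul h4)).fun_mul h6
  refine h7.congr_deriv ?_
  unfold jDer
  have e1 : q ^ s = q ^ (s - 1) * q := by
    rw [← Real.rpow_add_one hq.1.ne', sub_add_cancel]
  have e2 : qd q t ^ (-((((m + 2 : ℕ) : ℝ) + s) / 2))
      = qd q t ^ (-((((m + 2 : ℕ) : ℝ) + s) / 2) - 1) * qd q t := by
    rw [← Real.rpow_add_one hN.ne', sub_add_cancel]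
  rw [e2, e1]
  simp only [Nat.add_sub_cancel, show m + 2 - 1 = m + 1 by omega]
  generalize qd q t ^ (-((((m + 2 : ℕ) : ℝ) + s) / 2) - 1) = P
  generalize q ^ (s - 1) = A
  unfold qd
  push_cast
  ring

lemma continuousOn_qd_rpow (p : ℝ) :
    ContinuousOn (fun z : ℝ × ℝ => qd z.1 z.2 ^ p) (Ioo (-1) 1 ×ˢ Icc (-1) 1) := by
  refine ContinuousOn.rpow_const (by unfold qd; fun_prop) ?_
  exact fun z hz => Or.inl (qd_pos hz.1 hz.2).ne'

lemma continuousOn_jDer (n : ℕ) (s : ℝ) :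
    ContinuousOn (fun z : ℝ × ℝ => jDer n s z.1 z.2) (Ioo 0 1 ×ˢ Icc (-1) 1) := by
  have hsub : Ioo (0 : ℝ) 1 ×ˢ Icc (-1 : ℝ) 1 ⊆ Ioo (-1) 1 ×ˢ Icc (-1) 1 :=
    prod_mono (Ioo_subset_Ioo_left (by norm_num)) Subset.rfl
  have h1 := (continuousOn_qd_rpow (-(((n : ℝ) + s) / 2))).mono hsub
  have h2 := (continuousOn_qd_rpow (-(((n : ℝ) + s) / 2) - 1)).mono hsub
  have h3 : ∀ p : ℝ, ContinuousOn (fun z : ℝ × ℝ => z.1 ^ p) (Ioo 0 1 ×ˢ Icc (-1) 1) := fun p =>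
    ContinuousOn.rpow_const (by fun_prop) fun z hz => Or.inl hz.1.1.ne'
  have h4 := h3 s
  have h5 := h3 (s - 1)
  unfold jDer
  fun_prop

lemma mapsTo_inner {n : ℕ} {x : V n} (hx : ‖x‖ = 1) :
    MapsTo (fun z : V n => ⟪x, z⟫) (sphere 0 1) (Icc (-1) 1) := fun z hz =>
  inner_mem_Icc hx (by simpa using hz)

lemma integral_jDer {n : ℕ} (s : ℝ) {q : ℝ} (hq : q ∈ Ioo (0 : ℝ) 1) {x : V n} (hx : ‖x‖ = 1) :
    ∫ z, jDer n s q ⟪x, z⟫ ∂sph n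
      = s * (q ^ (s - 1) - q ^ (n - 1)) * ∫ z, qd q ⟪x, z⟫ ^ (-(((n : ℝ) + s) / 2)) ∂sph n := by
  have hq' : q ∈ Ioo (-1 : ℝ) 1 := ⟨by linarith [hq.1], hq.2⟩
  have hc : ∀ p : ℝ, ContinuousOn (fun t : ℝ => qd q t ^ p) (Icc (-1) 1) := fun p =>
    ContinuousOn.rpow_const (by unfold qd; fun_prop) fun t ht => Or.inl (qd_pos hq' ht).ne'
  have hcz : ∀ p : ℝ, ContinuousOn (fun z : V n => qd q ⟪x, z⟫ ^ p) (sphere 0 1) := fun p =>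
    (hc p).comp (by fun_prop) (mapsTo_inner hx)
  have hibp := integral_by_parts_zonal (n := n) hx
    (ψ := fun t => qd q t ^ (-(((n : ℝ) + s) / 2)))
    (ψ' := fun t => ((n : ℝ) + s) * q * qd q t ^ (-(((n : ℝ) + s) / 2) - 1))
    (fun t ht => by
      have h5 : HasDerivAt (fun t : ℝ => qd q t) (-(2 * q)) t := by
        simpa [qd] using ((hasDerivAt_id t).const_mul (2 * q)).const_sub (1 + q ^ 2)
      refine (h5.rpow_const (p := -(((n : ℝ) + s) / 2))
        (Or.inl (qd_pos hq' ht).ne')).congr_deriv ?_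
      ring)
    (continuousOn_const.mul (hc _))
  unfold jDer
  have c1 := hcz (-(((n : ℝ) + s) / 2))
  have c2 := hcz (-(((n : ℝ) + s) / 2) - 1)
  have c3 : ContinuousOn (fun z : V n => ⟪x, z⟫) (sphere 0 1) := by fun_prop
  rw [integral_add, integral_const_mul, integral_const_mul, hibp, mul_zero, add_zero]
  · exact (integrable_sph_of_continuousOn c1).const_mul _
  · exact (integrable_sph_of_continuousOn (((continuousOn_const.mul c3).mul c1).sub
      ((continuousOn_const.sub (c3.pow 2)).mul (continuousOn_const.mul c2)))).const_mul _

lemma continuousOn_jInt {n : ℕ} (s : ℝ) {q : ℝ} (hq : q ∈ Ioo (0 : ℝ) 1) {x : V n}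
    (hx : ‖x‖ = 1) : ContinuousOn (fun z : V n => jInt n s q ⟪x, z⟫) (sphere 0 1) := by
  have hq' : q ∈ Ioo (-1 : ℝ) 1 := ⟨by linarith [hq.1], hq.2⟩
  have c1 : ContinuousOn (fun z : V n => qd q ⟪x, z⟫ ^ (-(((n : ℝ) + s) / 2))) (sphere 0 1) :=
    ContinuousOn.rpow_const (by unfold qd; fun_prop) fun z hz =>
      Or.inl (qd_pos hq' (mapsTo_inner hx hz)).ne'
  unfold jInt
  exact ContinuousOn.mul (by fun_prop) c1

lemma hasDerivAt_integral_jInt {n : ℕ} (hn : 2 ≤ n) (s : ℝ) {q : ℝ} (hq : q ∈ Ioo (0 : ℝ) 1)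
    {x : V n} (hx : ‖x‖ = 1) :
    HasDerivAt (fun q => ∫ z, jInt n s q ⟪x, z⟫ ∂sph n)
      (s * (q ^ (s - 1) - q ^ (n - 1)) * ∫ z, qd q ⟪x, z⟫ ^ (-(((n : ℝ) + s) / 2)) ∂sph n) q := by
  rw [← integral_jDer s hq hx]
  have hsub : Icc (q / 2) ((1 + q) / 2) ⊆ Ioo 0 1 := fun p hp =>
    ⟨by linarith [hp.1, hq.1], by linarith [hp.2, hq.2]⟩
  have hnhds : Icc (q / 2) ((1 + q) / 2) ∈ 𝓝 q :=
    Icc_mem_nhds (by linarith [hq.1]) (by linarith [hq.2])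
  obtain ⟨C, hC⟩ := (isCompact_Icc.prod isCompact_Icc).exists_bound_of_continuousOn
    ((continuousOn_jDer n s).mono (prod_mono hsub Subset.rfl))
  refine (hasDerivAt_integral_of_dominated_loc_of_deriv_le (μ := sph n)
    (F := fun q z => jInt n s q ⟪x, z⟫) (F' := fun q z => jDer n s q ⟪x, z⟫)
    (bound := fun _ => C) hnhds ?_ ?_ ?_ ?_ (integrable_const _) ?_).2
  · filter_upwards [hnhds] with p hp
    exact aestronglyMeasurable_sph (continuousOn_jInt s (hsub hp) hx)
  · exact integrable_sph_of_continuousOn (continuousOn_jInt s hq hx)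
  · refine aestronglyMeasurable_sph ?_
    exact (continuousOn_jDer n s).comp (f := fun z : V n => (q, ⟪x, z⟫)) (by fun_prop)
      fun z hz => ⟨hq, mapsTo_inner hx hz⟩
  · filter_upwards [sph_ae_sphere n] with z hz p hp
    exact hC (p, ⟪x, z⟫) ⟨hp, mapsTo_inner hx hz⟩
  · filter_upwards [sph_ae_sphere n] with z hz p hp
    exact hasDerivAt_jInt hn s (hsub hp) (mapsTo_inner hx hz)

lemma tendsto_integral_jInt_zero {n : ℕ} (hn : 2 ≤ n) {s : ℝ} (hs : s ∈ Ioo (0 : ℝ) 1)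
    {x : V n} (hx : ‖x‖ = 1) :
    Tendsto (fun q => ∫ z, jInt n s q ⟪x, z⟫ ∂sph n) (𝓝[>] 0) (𝓝 0) := by
  rw [show (0 : ℝ) = ∫ z : V n, (0 : ℝ) ∂sph n by simp]
  have hI : Ioo (0 : ℝ) (1 / 2) ∈ 𝓝[>] ∫ z : V n, (0 : ℝ) ∂sph n := by
    rw [integral_zero]; exact Ioo_mem_nhdsGT (by norm_num)
  refine tendsto_integral_filter_of_dominated_convergence
    (fun _ => 4 * (1 / 4 : ℝ) ^ (-(((n : ℝ) + s) / 2))) ?_ ?_ (integrable_const _) ?_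
  · filter_upwards [hI] with q hq
    exact aestronglyMeasurable_sph (continuousOn_jInt s ⟨hq.1, by linarith [hq.2]⟩ hx)
  · filter_upwards [hI] with q hq
    filter_upwards [sph_ae_sphere n] with z hz
    have ht := mapsTo_inner hx hz
    simp only at ht
    set t := ⟪x, z⟫
    obtain ⟨hq0, hq1⟩ := hq
    have hN : 1 / 4 ≤ qd q t := by unfold qd; nlinarith [ht.1, ht.2]
    have h1 : |q ^ s| ≤ 1 := by
      rw [abs_of_nonneg (by positivity)]; exact Real.rpow_le_one hq0.le (by linarith) hs.1.le
    have h2 : |q ^ (n - 1)| ≤ 1 := by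
      rw [abs_of_nonneg (by positivity)]; exact pow_le_one₀ hq0.le (by linarith)
    have h3 : |1 - q * t| ≤ 2 := by rw [abs_le]; constructor <;> nlinarith [ht.1, ht.2]
    have h4 : |t - q| ≤ 2 := by rw [abs_le]; constructor <;> linarith [ht.1, ht.2]
    unfold jInt
    rw [Real.norm_eq_abs, abs_mul]
    have h5 : |q ^ s * (1 - q * t) - q ^ (n - 1) * (t - q)| ≤ 4 := by
      calc _ ≤ |q ^ s * (1 - q * t)| + |q ^ (n - 1) * (t - q)| := abs_sub _ _
        _ ≤ 1 * 2 + 1 * 2 := by rw [abs_mul, abs_mul]; gcongr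
        _ = 4 := by norm_num
    have h6 : |qd q t ^ (-(((n : ℝ) + s) / 2))| ≤ (1 / 4 : ℝ) ^ (-(((n : ℝ) + s) / 2)) := by
      rw [abs_of_nonneg (Real.rpow_nonneg (by linarith) _)]
      exact Real.rpow_le_rpow_of_nonpos (by norm_num) hN (by
        have := hs.1; have : (0 : ℝ) ≤ n := Nat.cast_nonneg n; linarith)
    gcongr
  · filter_upwards [sph_ae_sphere n] with z hz
    rw [integral_zero]
    have hc : ContinuousAt (fun q => jInt n s q ⟪x, z⟫) 0 := by
      unfold jInt
      have h1 : ContinuousAt (fun q : ℝ => q ^ s) 0 :=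
        continuousAt_id.rpow_const (Or.inr hs.1.le)
      have h2 : ContinuousAt (fun q : ℝ => qd q ⟪x, z⟫ ^ (-(((n : ℝ) + s) / 2))) 0 :=
        ContinuousAt.rpow_const (by unfold qd; fun_prop) (Or.inl (by simp [qd]))
      exact ((h1.mul (by fun_prop)).sub (by fun_prop)).mul h2
    have h0 : jInt n s 0 ⟪x, z⟫ = 0 := by
      simp [jInt, Real.zero_rpow hs.1.ne', show n - 1 ≠ 0 by omega]
    have := hc.tendsto.mono_left (nhdsWithin_le_nhds (s := Ioi 0))
    rwa [h0] at this

lemma jInt_bound {n : ℕ} (hn : 2 ≤ n) {s q t : ℝ} (hs : s ∈ Ioo (0 : ℝ) 1)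
    (hq : q ∈ Ioo (1 / 2 : ℝ) 1) (ht : t ∈ Ico (-1 : ℝ) 1) :
    |jInt n s q t| ≤ (n + 1) * (1 - t) ^ (1 - ((n : ℝ) + s) / 2) := by
  obtain ⟨hq0, hq1⟩ := hq
  have hnR : (2 : ℝ) ≤ n := by exact_mod_cast hn
  have hqp : 0 < q := by linarith
  have ht1 := ht.2
  have hNe : qd q t = (1 - q) ^ 2 + 2 * q * (1 - t) := by unfold qd; ring
  have hN1 : (1 - q) ^ 2 + (1 - t) ≤ qd q t := by
    rw [hNe]; nlinarith
  have hN0 : 0 < qd q t := by nlinarith [sq_nonneg (1 - q)]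
  have a1 : q ^ s ≤ 1 := Real.rpow_le_one hqp.le hq1.le hs.1.le
  have a2 : q ^ (n - 1) ≤ q ^ s := by
    rw [← Real.rpow_natCast]
    refine Real.rpow_le_rpow_of_exponent_ge hqp hq1.le ?_
    rw [Nat.cast_sub (by omega)]
    push_cast
    linarith [hs.2]
  have a3 : 1 - ((n : ℝ) - 1) * (1 - q) ≤ q ^ (n - 1) := by
    have := one_add_mul_le_pow (a := -(1 - q)) (by linarith) (n - 1)
    rw [Nat.cast_sub (by omega)] at this
    push_cast at this
    have e : 1 + -(1 - q) = q := by ring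
    rw [e] at this
    linarith
  have a4 : 0 ≤ q ^ (n - 1) := by positivity
  have hB : q ^ s * (1 - q * t) - q ^ (n - 1) * (t - q)
      = (1 - q) * (q ^ s - q ^ (n - 1)) + (1 - t) * (q * q ^ s + q ^ (n - 1)) := by ring
  have b0 : 0 ≤ (1 - q) * (q ^ s - q ^ (n - 1)) :=
    mul_nonneg (by linarith) (by linarith)
  have b1 : (1 - q) * (q ^ s - q ^ (n - 1)) ≤ (1 - q) * (((n : ℝ) - 1) * (1 - q)) :=
    mul_le_mul_of_nonneg_left (by linarith) (by linarith)
  have b2 : 0 ≤ q * q ^ s + q ^ (n - 1) := by positivity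
  have b3 : q * q ^ s + q ^ (n - 1) ≤ 2 := by nlinarith [Real.rpow_nonneg hqp.le s]
  have b4 : (1 - t) * (q * q ^ s + q ^ (n - 1)) ≤ (1 - t) * 2 :=
    mul_le_mul_of_nonneg_left b3 (by linarith)
  have b5 : 0 ≤ (1 - t) * (q * q ^ s + q ^ (n - 1)) := mul_nonneg (by linarith) b2
  have hBle : q ^ s * (1 - q * t) - q ^ (n - 1) * (t - q) ≤ (n + 1) * qd q t := by
    rw [hB]
    calc _ ≤ (n + 1) * ((1 - q) ^ 2 + (1 - t)) := by nlinarith [sq_nonneg (1 - q)]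
      _ ≤ _ := by gcongr
  have hB0 : 0 ≤ q ^ s * (1 - q * t) - q ^ (n - 1) * (t - q) := by rw [hB]; linarith
  unfold jInt
  rw [abs_of_nonneg (mul_nonneg hB0 (Real.rpow_nonneg hN0.le _))]
  calc _ ≤ (n + 1) * qd q t * qd q t ^ (-(((n : ℝ) + s) / 2)) := by gcongr
    _ = (n + 1) * qd q t ^ (1 - ((n : ℝ) + s) / 2) := by
      rw [mul_assoc, sub_eq_add_neg, Real.rpow_add hN0, Real.rpow_one]
    _ ≤ _ := by
      refine mul_le_mul_of_nonneg_left ?_ (by positivity)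
      exact Real.rpow_le_rpow_of_nonpos (by linarith) (by nlinarith [sq_nonneg (1 - q)])
        (by linarith [hs.1])

lemma tendsto_integral_jInt_one {n : ℕ} (hn : 2 ≤ n) {s : ℝ} (hs : s ∈ Ioo (0 : ℝ) 1)
    {x : V n} (hx : ‖x‖ = 1) :
    Tendsto (fun q => ∫ z, jInt n s q ⟪x, z⟫ ∂sph n) (𝓝[<] 1) (𝓝 (lamOne n s x)) := by
  have hI : Ioo (1 / 2 : ℝ) 1 ∈ 𝓝[<] (1 : ℝ) := Ioo_mem_nhdsLT (by norm_num)
  refine tendsto_integral_filter_of_dominated_convergence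
    (fun z => (n + 1) * (1 - ⟪x, z⟫) ^ (1 - ((n : ℝ) + s) / 2)) ?_ ?_
    ((integrable_chord hn hs hx).const_mul _) ?_
  · filter_upwards [hI] with q hq
    exact aestronglyMeasurable_sph (continuousOn_jInt s ⟨by linarith [hq.1], hq.2⟩ hx)
  · filter_upwards [hI] with q hq
    filter_upwards [sph_ae_norm n, ae_inner_lt_one hn hx] with z hz hz1
    exact jInt_bound hn hs hq ⟨(inner_mem_Icc hx hz).1, hz1⟩
  · filter_upwards [ae_inner_lt_one hn hx] with z hz1
    have h0 : qd 1 ⟪x, z⟫ = 2 - 2 * ⟪x, z⟫ := by unfold qd; ring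
    have hp : 0 < 2 - 2 * ⟪x, z⟫ := by linarith
    have hc : ContinuousAt (fun q => jInt n s q ⟪x, z⟫) 1 := by
      unfold jInt
      have h1 : ContinuousAt (fun q : ℝ => q ^ s) 1 :=
        continuousAt_id.rpow_const (Or.inr hs.1.le)
      have h2 : ContinuousAt (fun q : ℝ => qd q ⟪x, z⟫ ^ (-(((n : ℝ) + s) / 2))) 1 :=
        ContinuousAt.rpow_const (by unfold qd; fun_prop) (Or.inl (by rw [h0]; exact hp.ne'))
      exact ((h1.mul (by fun_prop)).sub (by fun_prop)).mul h2
    have e : jInt n s 1 ⟪x, z⟫ = (2 - 2 * ⟪x, z⟫) ^ (1 - ((n : ℝ) + s) / 2) := by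
      rw [jInt, h0, sub_eq_add_neg (1 : ℝ) (((n : ℝ) + s) / 2), Real.rpow_add hp, Real.rpow_one,
        Real.one_rpow, one_pow]
      ring
    rw [← e]
    exact hc.tendsto.mono_left nhdsWithin_le_nhds

lemma lintegral_qd {n : ℕ} (hn : 2 ≤ n) {s : ℝ} (hs : s ∈ Ioo (0 : ℝ) 1) {x : V n}
    (hx : ‖x‖ = 1) :
    ∫⁻ q in Ioo (0 : ℝ) 1, ENNReal.ofReal (s * (q ^ (s - 1) - q ^ (n - 1)) *
      ∫ z, qd q ⟪x, z⟫ ^ (-(((n : ℝ) + s) / 2)) ∂sph n) = ENNReal.ofReal (lamOne n s x) := by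
  set J := fun q => ∫ z, jInt n s q ⟪x, z⟫ ∂sph n with hJ
  set f' := fun q : ℝ => s * (q ^ (s - 1) - q ^ (n - 1)) *
      ∫ z, qd q ⟪x, z⟫ ^ (-(((n : ℝ) + s) / 2)) ∂sph n with hf'
  have hd : ∀ q ∈ Ioo (0 : ℝ) 1, HasDerivAt J (f' q) q := fun q hq =>
    hasDerivAt_integral_jInt hn s hq hx
  have h0 : Tendsto J (𝓝[>] 0) (𝓝 0) := tendsto_integral_jInt_zero hn hs hx
  have h1 : Tendsto J (𝓝[<] 1) (𝓝 (lamOne n s x)) := tendsto_integral_jInt_one hn hs hx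
  have hpos : ∀ q ∈ Ioo (0 : ℝ) 1, 0 ≤ f' q := by
    intro q hq
    have a2 : q ^ (n - 1) ≤ q ^ (s - 1) := by
      rw [← Real.rpow_natCast]
      refine Real.rpow_le_rpow_of_exponent_ge hq.1 hq.2.le ?_
      have : (0 : ℝ) ≤ (n - 1 : ℕ) := Nat.cast_nonneg _
      linarith [hs.2]
    refine mul_nonneg (mul_nonneg hs.1.le (sub_nonneg.2 a2)) (integral_nonneg_of_ae ?_)
    filter_upwards [sph_ae_norm n] with z hz
    exact Real.rpow_nonneg (qd_pos ⟨by linarith [hq.1], hq.2⟩ (inner_mem_Icc hx hz)).le _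
  have hc : ContinuousOn J (Ioo 0 1) := fun q hq => (hd q hq).continuousAt.continuousWithinAt
  have hext := continuousOn_Icc_extendFrom_Ioo hc h0 h1
  have hEq : EqOn (extendFrom (Ioo 0 1) J) J (Ioo 0 1) := fun q hq =>
    extendFrom_extends hc q hq
  have hfi : IntegrableOn f' (Ioc 0 1) := by
    refine intervalIntegral.integrableOn_deriv_of_nonneg hext (fun q hq => ?_) hpos
    exact (hd q hq).congr_of_eventuallyEq (hEq.eventuallyEq_of_mem (Ioo_mem_nhds hq.1 hq.2))
  have hval := intervalIntegral.integral_eq_sub_of_hasDerivAt_of_tendsto one_pos hd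
    ((intervalIntegrable_iff_integrableOn_Ioc_of_le zero_le_one).2 hfi) h0 h1
  rw [intervalIntegral.integral_of_le zero_le_one, integral_Ioc_eq_integral_Ioo, sub_zero] at hval
  rw [← hval, ofReal_integral_eq_lintegral_ofReal (hfi.mono_set Ioo_subset_Ioc_self)]
  filter_upwards [ae_restrict_mem measurableSet_Ioo] with q hq using hpos q hq

lemma lintegral_rpow_Ioo {c A : ℝ} (hc : 0 < c) (hA : 1 ≤ A) :
    ∫⁻ ρ in Ioo 1 A, ENNReal.ofReal (ρ ^ (c - 1)) = ENNReal.ofReal ((A ^ c - 1) / c) := by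
  have hi : IntervalIntegrable (fun ρ : ℝ => ρ ^ (c - 1)) volume 1 A := by
    refine intervalIntegral.intervalIntegrable_rpow (Or.inr ?_)
    rw [uIcc_of_le hA]
    exact fun h => absurd h.1 (by norm_num)
  rw [← ofReal_integral_eq_lintegral_ofReal]
  · rw [← integral_Ioc_eq_integral_Ioo, ← intervalIntegral.integral_of_le hA,
      integral_rpow (Or.inl (by linarith))]
    simp
  · exact ((intervalIntegrable_iff_integrableOn_Ioc_of_le hA).1 hi).mono_set Ioo_subset_Ioc_self
  · filter_upwards [ae_restrict_mem measurableSet_Ioo] with r hr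
    exact Real.rpow_nonneg (by linarith [hr.1]) _

lemma gk_mul {n : ℕ} (hn : 1 ≤ n) (s : ℝ) {t q ρ : ℝ} (ht : t ≤ 1) (hq : 0 < q) (hρ : 0 < ρ) :
    ρ * gk n s t (ρ * q) ρ
      = q ^ (n - 1) * qd q t ^ (-(((n : ℝ) + s) / 2)) * ρ ^ ((n : ℝ) - s - 1) := by
  unfold gk
  have h1 : (ρ * q) ^ 2 + ρ ^ 2 - 2 * (ρ * q) * ρ * t = ρ ^ 2 * qd q t := by unfold qd; ring
  have h2 : 0 ≤ qd q t := by unfold qd; nlinarith [sq_nonneg (1 - q)]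
  obtain ⟨m, rfl⟩ : ∃ m, n = m + 1 := ⟨n - 1, by omega⟩
  rw [h1, Real.mul_rpow (by positivity) h2, sq_rpow_half hρ.le]
  have h3 : ρ ^ ((((m + 1 : ℕ) : ℝ)) - s - 1)
      = ρ * ρ ^ m * ρ ^ m * ρ ^ (-(((m + 1 : ℕ) : ℝ) + s)) := by
    nth_rewrite 2 [← Real.rpow_one ρ]
    rw [← Real.rpow_natCast ρ m, ← Real.rpow_add hρ, ← Real.rpow_add hρ, ← Real.rpow_add hρ]
    congr 1
    push_cast
    ring
  rw [h3]
  simp only [Nat.add_sub_cancel]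
  ring

lemma radW_one {n : ℕ} (hn : 2 ≤ n) {s t : ℝ} (hs : s ∈ Ioo (0 : ℝ) 1) (ht : t ≤ 1) :
    radW n s t 1 1 = ∫⁻ q in Ioo (0 : ℝ) 1, ENNReal.ofReal
      ((q ^ (s - 1) - q ^ (n - 1)) / ((n : ℝ) - s) * qd q t ^ (-(((n : ℝ) + s) / 2))) := by
  have hnR : (2 : ℝ) ≤ n := by exact_mod_cast hn
  have hns : 0 < (n : ℝ) - s := by linarith [hs.2]
  have hgm : Measurable fun z : ℝ × ℝ => ENNReal.ofReal (gk n s t z.1 z.2) := by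
    unfold gk; fun_prop
  unfold radW
  rw [lintegral_lintegral_swap hgm.aemeasurable]
  set F : ℝ → ℝ → ℝ≥0∞ := fun ρ q => if ρ * q < 1 then
    ENNReal.ofReal (ρ * gk n s t (ρ * q) ρ) else 0 with hF
  have hFm : Measurable fun z : ℝ × ℝ => F z.1 z.2 := by
    refine Measurable.ite (measurableSet_lt (by fun_prop) (by fun_prop)) ?_ measurable_const
    unfold gk; fun_prop
  have h_inner : ∀ ρ ∈ Ici (1 : ℝ), ∫⁻ r in Ioo 0 1, ENNReal.ofReal (gk n s t r ρ)
      = ∫⁻ q in Ioo 0 1, F ρ q := by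
    intro ρ hρ
    have hρ0 : 0 < ρ := lt_of_lt_of_le one_pos hρ
    have h := setLIntegral_scale_Ioo hρ0 (fun r => ENNReal.ofReal (gk n s t r ρ)) 0 (1 / ρ)
    rw [mul_zero, mul_one_div_cancel hρ0.ne'] at h
    rw [h, ← lintegral_const_mul' _ _ ENNReal.ofReal_ne_top,
      ← lintegral_indicator measurableSet_Ioo, ← lintegral_indicator measurableSet_Ioo]
    refine lintegral_congr fun q => ?_
    have hle : 1 / ρ ≤ 1 := by rw [div_le_one hρ0]; exact hρ
    by_cases hq : q ∈ Ioo 0 (1 / ρ)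
    · have hq1 : q ∈ Ioo (0 : ℝ) 1 := ⟨hq.1, hq.2.trans_le hle⟩
      have h2 : ρ * q < 1 := by rw [mul_comm]; exact (lt_div_iff₀ hρ0).1 hq.2
      rw [indicator_of_mem hq, indicator_of_mem hq1, ← ENNReal.ofReal_mul hρ0.le]
      simp only [hF, h2, if_true]
    · rw [indicator_of_notMem hq]
      by_cases hq1 : q ∈ Ioo (0 : ℝ) 1
      · have h2 : ¬ ρ * q < 1 := fun h3 => hq ⟨hq1.1, by rw [lt_div_iff₀ hρ0, mul_comm]; exact h3⟩
        rw [indicator_of_mem hq1]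
        simp only [hF, h2, if_false]
      · rw [indicator_of_notMem hq1]
  rw [setLIntegral_congr_fun measurableSet_Ici h_inner, lintegral_lintegral_swap hFm.aemeasurable]
  refine setLIntegral_congr_fun measurableSet_Ioo fun q hq => ?_
  have hqn : 0 ≤ qd q t := by unfold qd; nlinarith [sq_nonneg (1 - q), hq.1]
  have hqi : 1 ≤ 1 / q := by rw [le_div_iff₀ hq.1]; linarith [hq.2]
  have e1 : ∫⁻ ρ in Ici (1 : ℝ), F ρ q = ∫⁻ ρ in Ioo 1 (1 / q),
      ENNReal.ofReal (q ^ (n - 1) * qd q t ^ (-(((n : ℝ) + s) / 2)))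
        * ENNReal.ofReal (ρ ^ ((n : ℝ) - s - 1)) := by
    rw [← setLIntegral_congr (Ioi_ae_eq_Ici (a := (1 : ℝ))),
      ← lintegral_indicator measurableSet_Ioi, ← lintegral_indicator measurableSet_Ioo]
    refine lintegral_congr fun ρ => ?_
    by_cases h1 : ρ ∈ Ioo 1 (1 / q)
    · have h2 : ρ * q < 1 := (lt_div_iff₀ hq.1).1 h1.2
      rw [indicator_of_mem (show ρ ∈ Ioi 1 from h1.1), indicator_of_mem h1,
        ← ENNReal.ofReal_mul (mul_nonneg (pow_nonneg hq.1.le _) (Real.rpow_nonneg hqn _))]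
      simp only [hF, h2, if_true]
      rw [gk_mul (by omega) s ht hq.1 (by linarith [h1.1])]
    · rw [indicator_of_notMem h1]
      by_cases h3 : ρ ∈ Ioi 1
      · have h2 : ¬ ρ * q < 1 := fun h4 => h1 ⟨h3, (lt_div_iff₀ hq.1).2 h4⟩
        rw [indicator_of_mem h3]
        simp only [hF, h2, if_false]
      · rw [indicator_of_notMem h3]
  rw [e1, lintegral_const_mul' _ _ ENNReal.ofReal_ne_top, lintegral_rpow_Ioo hns hqi,
    ← ENNReal.ofReal_mul (mul_nonneg (pow_nonneg hq.1.le _) (Real.rpow_nonneg hqn _))]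
  congr 1
  have e2 : q ^ (n - 1) * (1 / q) ^ ((n : ℝ) - s) = q ^ (s - 1) := by
    rw [one_div, Real.inv_rpow hq.1.le, ← Real.rpow_neg hq.1.le, ← Real.rpow_natCast,
      ← Real.rpow_add hq.1, Nat.cast_sub (by omega)]
    congr 1
    push_cast
    ring
  rw [← e2]
  ring

/-- The constant density of the fractional perimeter of the ball is controlled by `lamOne`. -/
lemma ballΦ_lamOne {n : ℕ} (hn : 2 ≤ n) {s : ℝ} (hs : s ∈ Ioo (0 : ℝ) 1) {x : V n}
    (hx : ‖x‖ = 1) :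
    ENNReal.ofReal (s * ((n : ℝ) - s)) * ballΦ n s x = ENNReal.ofReal (lamOne n s x) := by
  have hnR : (2 : ℝ) ≤ n := by exact_mod_cast hn
  have hns : 0 < (n : ℝ) - s := by linarith [hs.2]
  have hm : Measurable fun z : V n × ℝ => ENNReal.ofReal
      ((z.2 ^ (s - 1) - z.2 ^ (n - 1)) / ((n : ℝ) - s) * qd z.2 ⟪x, z.1⟫ ^ (-(((n : ℝ) + s) / 2))) := by
    unfold qd; fun_prop
  have e1 : ballΦ n s x = ∫⁻ z, (∫⁻ q in Ioo (0 : ℝ) 1, ENNReal.ofReal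
      ((q ^ (s - 1) - q ^ (n - 1)) / ((n : ℝ) - s) * qd q ⟪x, z⟫ ^ (-(((n : ℝ) + s) / 2)))) ∂sph n := by
    unfold ballΦ
    refine lintegral_congr_ae ?_
    filter_upwards [sph_ae_norm n] with z hz
    exact radW_one hn hs (inner_mem_Icc hx hz).2
  rw [e1, lintegral_lintegral_swap hm.aemeasurable, ← lintegral_qd hn hs hx,
    ← lintegral_const_mul' _ _ ENNReal.ofReal_ne_top]
  refine setLIntegral_congr_fun measurableSet_Ioo fun q hq => ?_
  have a2 : q ^ (n - 1) ≤ q ^ (s - 1) := by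
    rw [← Real.rpow_natCast]
    refine Real.rpow_le_rpow_of_exponent_ge hq.1 hq.2.le ?_
    have : (0 : ℝ) ≤ (n - 1 : ℕ) := Nat.cast_nonneg _
    linarith [hs.2]
  have hc0 : 0 ≤ (q ^ (s - 1) - q ^ (n - 1)) / ((n : ℝ) - s) := div_nonneg (by linarith) hns.le
  have hq' : q ∈ Ioo (-1 : ℝ) 1 := ⟨by linarith [hq.1], hq.2⟩
  have hci : Integrable (fun z : V n => qd q ⟪x, z⟫ ^ (-(((n : ℝ) + s) / 2))) (sph n) :=
    integrable_sph_of_continuousOn <| ContinuousOn.rpow_const (by unfold qd; fun_prop) fun z hz =>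
      Or.inl (qd_pos hq' (mapsTo_inner hx hz)).ne'
  simp only [ENNReal.ofReal_mul hc0]
  rw [lintegral_const_mul' _ _ ENNReal.ofReal_ne_top, ← ofReal_integral_eq_lintegral_ofReal hci,
    ← ENNReal.ofReal_mul hc0, ← ENNReal.ofReal_mul (mul_nonneg hs.1.le hns.le)]
  · congr 1
    field_simp
  · filter_upwards [sph_ae_norm n] with z hz
    exact Real.rpow_nonneg (qd_pos hq' (inner_mem_Icc hx hz)).le _

/-- The kernel `∫ ⟪x, z⟫ ^ i * ⟪y, z⟫ ^ j` of the composition of two power-kernel operators. -/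
noncomputable def powK (n i j : ℕ) (x y : V n) : ℝ := ∫ z, ⟪x, z⟫ ^ i * ⟪y, z⟫ ^ j ∂sph n

lemma powK_swap {n : ℕ} (i j : ℕ) (x y : V n) : powK n i j x y = powK n j i y x := by
  unfold powK
  simp only [mul_comm]

lemma powK_symm {n : ℕ} (i j : ℕ) {x y : V n} (hx : ‖x‖ = 1) (hy : ‖y‖ = 1) :
    powK n i j x y = powK n i j y x := by
  have hR : ∃ R : V n ≃ₗᵢ[ℝ] V n, R x = y ∧ R y = x := by
    refine ⟨Submodule.reflection (ℝ ∙ (x - y))ᗮ, Submodule.reflection_sub (by rw [hx, hy]), ?_⟩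
    have h := Submodule.reflection_reflection (ℝ ∙ (x - y))ᗮ x
    rwa [Submodule.reflection_sub (show ‖x‖ = ‖y‖ by rw [hx, hy])] at h
  obtain ⟨R, h1, h2⟩ := hR
  unfold powK
  rw [← (sph_map_isometry R).integral_comp R.toHomeomorph.measurableEmbedding]
  refine integral_congr_ae (ae_of_all _ fun z => ?_)
  have e1 : ⟪x, R z⟫ = ⟪y, z⟫ := by rw [← h2, R.inner_map_map]
  have e2 : ⟪y, R z⟫ = ⟪x, z⟫ := by rw [← h1, R.inner_map_map]
  simp only [e1, e2]

lemma powK_succ {n : ℕ} (p j : ℕ) {x y : V n} (hx : ‖x‖ = 1) :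
    ((n : ℝ) - 1 + p + j) * powK n (p + 1) j x y
      = p * powK n (p - 1) j x y + j * ⟪x, y⟫ * powK n p (j - 1) x y := by
  have hd : ∀ z : V n, HasFDerivAt (fun z : V n => ⟪x, z⟫ ^ p * ⟪y, z⟫ ^ j)
      (⟪x, z⟫ ^ p • ((j * ⟪y, z⟫ ^ (j - 1)) • innerSL ℝ y)
        + ⟪y, z⟫ ^ j • ((p * ⟪x, z⟫ ^ (p - 1)) • innerSL ℝ x)) z := by
    intro z
    have h1 : ∀ (w : V n) (k : ℕ), HasFDerivAt (fun z : V n => ⟪w, z⟫ ^ k)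
        ((k * ⟪w, z⟫ ^ (k - 1)) • innerSL ℝ w) z := by
      intro w k
      have h2 : HasFDerivAt (fun z : V n => ⟪w, z⟫) (innerSL ℝ w) z :=
        (innerSL ℝ w).hasFDerivAt
      have h3 := HasFDerivAt.pow h2 k
      refine h3.congr_fderiv ?_
      ext v
      simp
    exact (h1 x p).mul (h1 y j)
  have key := integral_by_parts (n := n) (fun z _ => hd z) (by fun_prop) x
  have hi : ∀ a b : ℕ, Integrable (fun z : V n => ⟪x, z⟫ ^ a * ⟪y, z⟫ ^ b) (sph n) := fun a b =>
    integrable_sph_of_continuous (by fun_prop)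
  have h0 : ∀ᵐ z ∂sph n, ((n : ℝ) - 1) * ⟪x, z⟫ * (⟪x, z⟫ ^ p * ⟪y, z⟫ ^ j)
      + ⟪x, z⟫ * ((⟪x, z⟫ ^ p • ((j * ⟪y, z⟫ ^ (j - 1)) • innerSL ℝ y)
        + ⟪y, z⟫ ^ j • ((p * ⟪x, z⟫ ^ (p - 1)) • innerSL ℝ x)) z)
      - (⟪x, z⟫ ^ p • ((j * ⟪y, z⟫ ^ (j - 1)) • innerSL ℝ y)
        + ⟪y, z⟫ ^ j • ((p * ⟪x, z⟫ ^ (p - 1)) • innerSL ℝ x)) x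
      = ((n : ℝ) - 1 + p + j) * (⟪x, z⟫ ^ (p + 1) * ⟪y, z⟫ ^ j)
        - p * (⟪x, z⟫ ^ (p - 1) * ⟪y, z⟫ ^ j) - j * ⟪x, y⟫ * (⟪x, z⟫ ^ p * ⟪y, z⟫ ^ (j - 1)) := by
    refine ae_of_all _ fun z => ?_
    have hpw : ∀ (k : ℕ) (a : ℝ), (k : ℝ) * a ^ (k - 1) * a = k * a ^ k := by
      intro k a
      rcases k with _ | k
      · simp
      · rw [Nat.add_sub_cancel, mul_assoc, pow_succ]
    have hxx : ⟪x, x⟫ = 1 := by rw [real_inner_self_eq_norm_sq, hx]; norm_num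
    simp only [add_apply, smul_apply, innerSL_apply_apply,
      smul_eq_mul, hxx, real_inner_comm y x]
    linear_combination ⟪x, z⟫ ^ (p + 1) * hpw j ⟪y, z⟫ + ⟪y, z⟫ ^ j * ⟪x, z⟫ * hpw p ⟪x, z⟫
  have hI1 := (hi (p + 1) j).const_mul ((n : ℝ) - 1 + p + j)
  have hI2 := (hi (p - 1) j).const_mul (p : ℝ)
  have hI3 := (hi p (j - 1)).const_mul ((j : ℝ) * ⟪x, y⟫)
  rw [integral_congr_ae h0, integral_sub (by exact hI1.sub hI2) hI3, integral_sub hI1 hI2,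
    integral_const_mul, integral_const_mul, integral_const_mul] at key
  unfold powK
  linarith

lemma powK_relation {n : ℕ} (p q : ℕ) {x y : V n} (hx : ‖x‖ = 1) (hy : ‖y‖ = 1) :
    ((q : ℝ) - p) * (n + p + q) * powK n (p + 1) (q + 1) x y
      = (q + 1) * q * powK n (p + 1) (q - 1) x y - (p + 1) * p * powK n (p - 1) (q + 1) x y := by
  have h1 := powK_succ p (q + 1) (y := y) hx
  have h2 := powK_succ q (p + 1) (y := x) hy
  rw [powK_swap (q + 1), powK_swap (q - 1), powK_swap q, real_inner_comm] at h2
  simp only [Nat.add_sub_cancel] at h1 h2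
  push_cast at h1 h2
  linear_combination (q + 1 : ℝ) * h2 - (p + 1 : ℝ) * h1

section Abstract
variable {H : Type*} [NormedAddCommGroup H] [InnerProductSpace ℝ H]

lemma eq_zero_of_range_ker {T : H →ₗ[ℝ] H} (hT : T.IsSymmetric) {y : H} (h : T (T y) = 0) :
    T y = 0 := by
  have h1 := hT y (T y)
  rw [h, inner_zero_right] at h1
  exact inner_self_eq_zero.1 h1

lemma exists_range_add_ker {T : H →ₗ[ℝ] H} (hT : T.IsSymmetric)
    [FiniteDimensional ℝ (LinearMap.range T)] (u : H) :
    ∃ v w : H, u = T v + w ∧ T w = 0 := by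
  obtain ⟨v, hv⟩ := ((LinearMap.range T).orthogonalProjectionOnto u).2
  refine ⟨v, u - T v, by abel, ?_⟩
  refine ext_inner_right ℝ fun x => ?_
  rw [inner_zero_left, hT, hv]
  have h1 := Submodule.sub_starProjection_mem_orthogonal (K := LinearMap.range T) u
  rw [Submodule.starProjection_apply] at h1
  rw [real_inner_comm]
  exact (Submodule.mem_orthogonal _ _).1 h1 _ ⟨x, rfl⟩

/-- Comparison of consecutive quadratic forms in a commuting family of finite-rank operators
satisfying a three-term relation. -/
lemma form_le_form {a : ℕ → H →ₗ[ℝ] H} (hsym : ∀ i, (a i).IsSymmetric)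
    (hfin : ∀ i, FiniteDimensional ℝ (LinearMap.range (a i)))
    (hpos : ∀ i u, 0 ≤ ⟪a i u, u⟫) (hcomm : ∀ i j u, a i (a j u) = a j (a i u))
    {ν β : ℕ → ℝ} (hν : Monotone ν)
    (hrel : ∀ i j u, (ν (j + 1) - ν (i + 1)) • a (j + 1) (a (i + 1) u)
      = β (j + 1) • a j (a (i + 1) u) - β (i + 1) • a (j + 1) (a i u))
    (j k : ℕ) (hk : k ≤ j) (u : H) (hu : ∀ i < k + 1, a i u = 0) :
    β (j + 1) * ⟪a j u, u⟫ ≤ (ν (j + 1) - ν (k + 1)) * ⟪a (j + 1) u, u⟫ := by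
  induction hk using Nat.decreasingInduction generalizing u with
  | self => simp [hu j (Nat.lt_succ_self j)]
  | of_succ k hk ih =>
    obtain ⟨v, w', huw, hw'⟩ := exists_range_add_ker (hsym (k + 1)) u
    obtain ⟨y, v', hv, hv'⟩ := exists_range_add_ker (hsym (k + 1)) v
    set b := a (k + 1) with hb
    have hbv : b v = b (b y) := by rw [hv, map_add, hv', add_zero]
    have hc : ∀ i y, a i (b y) = b (a i y) := fun i y => hcomm i (k + 1) y
    have hz : ∀ y, b (b y) = 0 → b y = 0 := fun y => eq_zero_of_range_ker (hsym (k + 1))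
    have hw0 : ∀ i < k + 1, a i (b v) = 0 := by
      intro i hi
      rw [hc]
      refine hz _ ?_
      rw [← hc i]
      have h1 : b v = u - w' := by rw [huw]; abel
      rw [h1, map_sub, map_sub, hu i hi, ← hc i, hw', map_zero, map_zero, sub_zero]
    have hw1 : ∀ i < k + 1 + 1, a i w' = 0 := by
      intro i hi
      rcases Nat.lt_succ_iff_lt_or_eq.1 hi with h | h
      · have h1 : w' = u - b v := by rw [huw]; abel
        rw [h1, map_sub, hu i h, hw0 i h, sub_zero]
      · rw [h]; exact hw'
    have hak : a k (b y) = 0 := by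
      rw [hc]
      refine hz _ ?_
      rw [← hc k, ← hc k, ← hbv]
      exact hw0 k (Nat.lt_succ_self k)
    have heq : β (j + 1) • a j (b v) = (ν (j + 1) - ν (k + 1)) • a (j + 1) (b v) := by
      have h1 := hrel k j (b y)
      rw [hak, map_zero, smul_zero, sub_zero, ← hb, ← hbv] at h1
      exact h1.symm
    have hcr : ∀ i, ⟪a i u, u⟫ = ⟪a i (b v), b v⟫ + ⟪a i w', w'⟫ := by
      intro i
      have h1 : ⟪a i (b v), w'⟫ = 0 := by
        rw [hc, hsym (k + 1), ← hb, hw', inner_zero_right]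
      have h2 : ⟪a i w', b v⟫ = 0 := by
        rw [hsym i, real_inner_comm, h1]
      rw [huw, map_add, inner_add_left, inner_add_right, inner_add_right, h1, h2]
      ring
    have h1 := ih w' hw1
    have h2 : β (j + 1) * ⟪a j (b v), b v⟫ = (ν (j + 1) - ν (k + 1)) * ⟪a (j + 1) (b v), b v⟫ := by
      rw [← real_inner_smul_left, heq, real_inner_smul_left]
    have h3 := mul_le_mul_of_nonneg_right (hν (Nat.le_succ (k + 1))) (hpos (j + 1) w')
    rw [hcr j, hcr (j + 1)]
    simp only [Nat.succ_eq_add_one] at h3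
    linarith

end Abstract

section SumOp
variable {H : Type*} [NormedAddCommGroup H] [InnerProductSpace ℝ H] {ι : Type*} [Fintype ι]

/-- The operator `u ↦ ∑ i, ⟪e i, u⟫ • e i`. -/
noncomputable def gramOp (e : ι → H) : H →ₗ[ℝ] H :=
  ∑ i, ((innerSL ℝ (e i)).smulRight (e i) : H →L[ℝ] H).toLinearMap

lemma gramOp_apply (e : ι → H) (u : H) : gramOp e u = ∑ i, ⟪e i, u⟫ • e i := by
  simp [gramOp]

lemma inner_gramOp (e : ι → H) (u w : H) : ⟪gramOp e u, w⟫ = ∑ i, ⟪e i, u⟫ * ⟪e i, w⟫ := by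
  rw [gramOp_apply, sum_inner]
  simp only [real_inner_smul_left]

lemma gramOp_isSymmetric (e : ι → H) : (gramOp e).IsSymmetric := by
  intro u w
  rw [inner_gramOp, real_inner_comm, inner_gramOp]
  exact Finset.sum_congr rfl fun i _ => mul_comm _ _

lemma gramOp_nonneg (e : ι → H) (u : H) : 0 ≤ ⟪gramOp e u, u⟫ := by
  rw [inner_gramOp]
  exact Finset.sum_nonneg fun i _ => mul_self_nonneg _

lemma gramOp_finite (e : ι → H) : FiniteDimensional ℝ (LinearMap.range (gramOp e)) := by
  have h : LinearMap.range (gramOp e) ≤ Submodule.span ℝ (range e) := by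
    rintro _ ⟨u, rfl⟩
    rw [gramOp_apply]
    exact Submodule.sum_mem _ fun i _ => Submodule.smul_mem _ _ (Submodule.subset_span ⟨i, rfl⟩)
  have : FiniteDimensional ℝ (Submodule.span ℝ (range e)) :=
    FiniteDimensional.span_of_finite ℝ (finite_range e)
  exact Submodule.finiteDimensional_of_le h

end SumOp

lemma memLp_sph {n : ℕ} (f : C(V n, ℝ)) : MemLp f 2 (sph n) := by
  obtain ⟨C, hC⟩ := (isCompact_sphere (0 : V n) 1).exists_bound_of_continuousOn
    f.continuous.continuousOn
  refine MemLp.of_bound f.continuous.aestronglyMeasurable C ?_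
  filter_upwards [sph_ae_sphere n] with x hx using hC x hx

/-- The class in `L²` of a continuous function. -/
noncomputable def toL {n : ℕ} (f : C(V n, ℝ)) : Lp ℝ 2 (sph n) := (memLp_sph f).toLp f

lemma inner_toL {n : ℕ} (f : C(V n, ℝ)) (u : Lp ℝ 2 (sph n)) :
    ⟪toL f, u⟫ = ∫ x, f x * u x ∂sph n := by
  rw [L2.inner_def]
  refine integral_congr_ae ?_
  filter_upwards [(memLp_sph f).coeFn_toLp] with x hx
  simp only [toL, hx, RCLike.inner_apply, conj_trivial, mul_comm]

lemma inner_toL_toL {n : ℕ} (f g : C(V n, ℝ)) : ⟪toL f, toL g⟫ = ∫ x, f x * g x ∂sph n := by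
  rw [inner_toL]
  refine integral_congr_ae ?_
  filter_upwards [(memLp_sph g).coeFn_toLp] with x hx
  simp only [toL, hx]

lemma integrable_toL_mul {n : ℕ} (f : C(V n, ℝ)) (u : Lp ℝ 2 (sph n)) :
    Integrable (fun x => f x * u x) (sph n) :=
  (memLp_sph f).integrable_mul (Lp.memLp u)

/-- Monomials indexed by words. -/
noncomputable def mono {n j : ℕ} (I : Fin j → Fin n) : C(V n, ℝ) :=
  ⟨fun x => ∏ k, x (I k), by fun_prop⟩

lemma inner_pow_eq {n : ℕ} (j : ℕ) (x y : V n) :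
    ⟪x, y⟫ ^ j = ∑ I : Fin j → Fin n, mono I x * mono I y := by
  rw [PiLp.inner_apply, Fintype.sum_pow]
  refine Finset.sum_congr rfl fun I _ => ?_
  simp only [RCLike.inner_apply, conj_trivial, Finset.prod_mul_distrib, mono, ContinuousMap.coe_mk]
  ring

/-- The operator with kernel `⟪x, y⟫ ^ j`. -/
noncomputable def powOp (n j : ℕ) : Lp ℝ 2 (sph n) →ₗ[ℝ] Lp ℝ 2 (sph n) :=
  gramOp fun I : Fin j → Fin n => toL (mono I)

lemma powK_eq {n : ℕ} (i j : ℕ) (x y : V n) :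
    powK n i j x y = ∑ I : Fin i → Fin n, ∑ J : Fin j → Fin n,
      mono I x * ⟪toL (mono J), toL (mono I)⟫ * mono J y := by
  unfold powK
  simp only [inner_pow_eq i, inner_pow_eq j, Finset.sum_mul_sum]
  rw [integral_finsetSum _ fun I _ => integrable_finsetSum _ fun J _ =>
    integrable_sph_of_continuous (by fun_prop)]
  refine Finset.sum_congr rfl fun I _ => ?_
  rw [integral_finsetSum _ fun J _ => integrable_sph_of_continuous (by fun_prop)]
  refine Finset.sum_congr rfl fun J _ => ?_
  rw [inner_toL_toL, ← integral_const_mul, ← integral_mul_const]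
  refine integral_congr_ae (ae_of_all _ fun z => ?_)
  ring

lemma powOp_comp {n : ℕ} (i j : ℕ) (u w : Lp ℝ 2 (sph n)) :
    Integrable (fun z : V n × V n => powK n i j z.1 z.2 * (u z.1 * w z.2)) ((sph n).prod (sph n)) ∧
    ⟪powOp n j (powOp n i u), w⟫
      = ∫ z, powK n i j z.1 z.2 * (u z.1 * w z.2) ∂((sph n).prod (sph n)) := by
  have e1 : (fun z : V n × V n => powK n i j z.1 z.2 * (u z.1 * w z.2))
      = fun z => ∑ I : Fin i → Fin n, ∑ J : Fin j → Fin n,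
        ⟪toL (mono J), toL (mono I)⟫ * ((mono I z.1 * u z.1) * (mono J z.2 * w z.2)) := by
    funext z
    rw [powK_eq, Finset.sum_mul]
    refine Finset.sum_congr rfl fun I _ => ?_
    rw [Finset.sum_mul]
    refine Finset.sum_congr rfl fun J _ => ?_
    ring
  have hI : ∀ (I : Fin i → Fin n) (J : Fin j → Fin n), Integrable (fun z : V n × V n =>
      ⟪toL (mono J), toL (mono I)⟫ * ((mono I z.1 * u z.1) * (mono J z.2 * w z.2)))
      ((sph n).prod (sph n)) := fun I J =>
    ((integrable_toL_mul _ u).mul_prod (integrable_toL_mul _ w)).const_mul _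
  rw [e1]
  refine ⟨integrable_finsetSum _ fun I _ => integrable_finsetSum _ fun J _ => hI I J, ?_⟩
  rw [integral_finsetSum _ fun I _ => integrable_finsetSum _ fun J _ => hI I J,
    powOp, inner_gramOp, powOp, gramOp_apply]
  simp only [inner_sum, real_inner_smul_right, Finset.sum_mul]
  rw [Finset.sum_comm]
  refine Finset.sum_congr rfl fun I _ => ?_
  rw [integral_finsetSum _ fun J _ => hI I J]
  refine Finset.sum_congr rfl fun J _ => ?_
  rw [integral_const_mul, integral_prod_mul (fun x => mono I x * u x) (fun x => mono J x * w x),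
    inner_toL _ u, inner_toL _ w]
  ring

lemma ae_prod_norm (n : ℕ) :
    ∀ᵐ z ∂((sph n).prod (sph n)), ‖z.1‖ = 1 ∧ ‖z.2‖ = 1 :=
  (Measure.quasiMeasurePreserving_fst.ae (sph_ae_norm n)).and
    (Measure.quasiMeasurePreserving_snd.ae (sph_ae_norm n))

lemma powOp_comm {n : ℕ} (i j : ℕ) (u : Lp ℝ 2 (sph n)) :
    powOp n i (powOp n j u) = powOp n j (powOp n i u) := by
  refine ext_inner_right ℝ fun w => ?_
  rw [(powOp_comp _ _ _ _).2, (powOp_comp _ _ _ _).2]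
  refine integral_congr_ae ?_
  filter_upwards [ae_prod_norm n] with z hz
  rw [powK_swap, powK_symm _ _ hz.2 hz.1]

lemma powOp_relation {n : ℕ} (p q : ℕ) (u : Lp ℝ 2 (sph n)) :
    (((q : ℝ) - p) * (n + p + q)) • powOp n (q + 1) (powOp n (p + 1) u)
      = ((q + 1 : ℝ) * q) • powOp n (q - 1) (powOp n (p + 1) u)
        - ((p + 1 : ℝ) * p) • powOp n (q + 1) (powOp n (p - 1) u) := by
  refine ext_inner_right ℝ fun w => ?_
  rw [inner_sub_left, real_inner_smul_left, real_inner_smul_left, real_inner_smul_left,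
    (powOp_comp _ _ _ _).2, (powOp_comp _ _ _ _).2, (powOp_comp _ _ _ _).2,
    ← integral_const_mul, ← integral_const_mul, ← integral_const_mul,
    ← integral_sub ((powOp_comp _ _ _ _).1.const_mul _) ((powOp_comp _ _ _ _).1.const_mul _)]
  refine integral_congr_ae ?_
  filter_upwards [ae_prod_norm n] with z hz
  linear_combination (u z.1 * w z.2) * powK_relation p q hz.1 hz.2

/-- The quadratic form with kernel `⟪x, y⟫ ^ l`. -/
noncomputable def powQ (n l : ℕ) (v : V n → ℝ) : ℝ :=
  ∫ z, ⟪z.1, z.2⟫ ^ l * (v z.1 * v z.2) ∂((sph n).prod (sph n))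

lemma powQ_eq {n : ℕ} (l : ℕ) (v : C(V n, ℝ)) :
    powQ n l v = ⟪powOp n l (toL v), toL v⟫ := by
  unfold powQ
  have e1 : (fun z : V n × V n => ⟪z.1, z.2⟫ ^ l * (v z.1 * v z.2))
      = fun z => ∑ I : Fin l → Fin n, (mono I z.1 * v z.1) * (mono I z.2 * v z.2) := by
    funext z
    rw [inner_pow_eq, Finset.sum_mul]
    exact Finset.sum_congr rfl fun I _ => by ring
  have hi : ∀ I : Fin l → Fin n, Integrable (fun x => mono I x * v x) (sph n) := fun I =>
    integrable_sph_of_continuous (by fun_prop)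
  rw [e1, integral_finsetSum _ fun I _ => (hi I).mul_prod (hi I), powOp, inner_gramOp]
  refine Finset.sum_congr rfl fun I _ => ?_
  rw [integral_prod_mul (fun x => mono I x * v x) (fun x => mono I x * v x), inner_toL_toL]

lemma powQ_le_powQ {n : ℕ} (hn : 2 ≤ n) (v : C(V n, ℝ)) (hv : ∫ x, v x ∂sph n = 0) (j : ℕ) :
    (2 * j + 2 : ℝ) * (2 * j + 1) * powQ n (2 * j) v
      ≤ 2 * j * (2 * j + 2 + n) * powQ n (2 * j + 2) v := by
  have hnR : (2 : ℝ) ≤ n := by exact_mod_cast hn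
  have h := form_le_form (a := fun i => powOp n (2 * i)) (fun i => gramOp_isSymmetric _)
    (fun i => gramOp_finite _) (fun i u => gramOp_nonneg _ u) (fun i j u => powOp_comm _ _ _)
    (ν := fun i => 2 * (i : ℝ) * (2 * i + (n - 2))) (β := fun i => 2 * (i : ℝ) * (2 * i - 1))
    (by
      intro i k hik
      have h1 : (i : ℝ) ≤ k := by exact_mod_cast hik
      have h2 : (0 : ℝ) ≤ i := Nat.cast_nonneg i
      have h3 : (0 : ℝ) ≤ n - 2 := by linarith
      show 2 * (i : ℝ) * (2 * i + (n - 2)) ≤ 2 * (k : ℝ) * (2 * k + (n - 2))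
      gcongr)
    (by
      intro i j u
      have h1 := powOp_relation (n := n) (2 * i + 1) (2 * j + 1) u
      simp only [Nat.add_sub_cancel] at h1
      show _ • powOp n (2 * (j + 1)) (powOp n (2 * (i + 1)) u)
        = _ • powOp n (2 * j) (powOp n (2 * (i + 1)) u)
          - _ • powOp n (2 * (j + 1)) (powOp n (2 * i) u)
      have e1 : ∀ k, 2 * (k + 1) = 2 * k + 1 + 1 := fun k => by ring
      rw [e1, e1]
      convert h1 using 2
      · push_cast; ring
      · congr 1
        push_cast; ring
      · congr 1
        push_cast; ring)
    j 0 (Nat.zero_le j) (toL v) (by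
      intro i hi
      obtain rfl : i = 0 := by omega
      show powOp n 0 (toL v) = 0
      rw [powOp, gramOp_apply]
      refine Finset.sum_eq_zero fun I _ => ?_
      rw [inner_toL_toL]
      have : ∫ x, mono I x * v x ∂sph n = 0 := by simpa [mono] using hv
      rw [this, zero_smul])
  rw [← powQ_eq, ← powQ_eq] at h
  have e1 : 2 * (j + 1) = 2 * j + 2 := by ring
  rw [e1] at h
  push_cast at h
  linarith

/-- The zonal moments `∫ ⟪x, z⟫ ^ l`. -/
noncomputable def mom (n l : ℕ) (x : V n) : ℝ := ∫ z, ⟪x, z⟫ ^ l ∂sph n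

lemma mom_eq {n : ℕ} (l : ℕ) {x y : V n} (hx : ‖x‖ = 1) (hy : ‖y‖ = 1) : mom n l x = mom n l y :=
  integral_zonal hx hy (fun t => t ^ l)

lemma mom_succ {n : ℕ} (l : ℕ) {x : V n} (hx : ‖x‖ = 1) :
    ((n : ℝ) + l) * mom n (l + 2) x = (l + 1) * mom n l x := by
  have h := powK_succ (l + 1) 0 (y := x) hx
  simp only [powK, pow_zero, mul_one, Nat.add_sub_cancel, Nat.cast_zero, zero_mul, add_zero] at h
  push_cast at h
  unfold mom
  linarith

lemma mom_zero {n : ℕ} (x : V n) : mom n 0 x = (sph n).real univ := by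
  simp [mom]

lemma mom_odd {n : ℕ} (hn : 2 ≤ n) (k : ℕ) {x : V n} (hx : ‖x‖ = 1) : mom n (2 * k + 1) x = 0 := by
  have hnR : (2 : ℝ) ≤ n := by exact_mod_cast hn
  induction k with
  | zero =>
    have h := powK_succ 0 0 (y := x) hx
    simp only [powK, pow_zero, mul_one, Nat.cast_zero, zero_mul, add_zero, zero_add] at h
    rcases mul_eq_zero.1 h with h | h
    · linarith
    · exact h
  | succ k ih =>
    have h := mom_succ (2 * k + 1) hx
    rw [ih, mul_zero] at h
    rcases mul_eq_zero.1 h with h | h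
    · have : (0 : ℝ) ≤ ((2 * k + 1 : ℕ) : ℝ) := Nat.cast_nonneg _
      linarith
    · exact h

lemma sph_real_pos {n : ℕ} (hn : 1 ≤ n) : 0 < (sph n).real univ :=
  ENNReal.toReal_pos (sph_univ_ne_zero hn) (measure_ne_top _ _)

lemma mom_even_pos {n : ℕ} (hn : 2 ≤ n) (k : ℕ) {x : V n} (hx : ‖x‖ = 1) : 0 < mom n (2 * k) x := by
  have hnR : (2 : ℝ) ≤ n := by exact_mod_cast hn
  induction k with
  | zero => rw [mul_zero, mom_zero]; exact sph_real_pos (by omega)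
  | succ k ih =>
    have h := mom_succ (2 * k) hx
    have h0 : (0 : ℝ) ≤ ((2 * k : ℕ) : ℝ) := Nat.cast_nonneg _
    have h1 : 0 < ((n : ℝ) + ((2 * k : ℕ) : ℝ)) * mom n (2 * k + 2) x := by rw [h]; positivity
    exact pos_of_mul_pos_right h1 (by linarith)

lemma integrable_prod_sph {n : ℕ} {F : V n × V n → ℝ} (hF : Continuous F) :
    Integrable F ((sph n).prod (sph n)) := by
  obtain ⟨C, hC⟩ := ((isCompact_sphere (0 : V n) 1).prod (isCompact_sphere (0 : V n) 1)
    ).exists_bound_of_continuousOn hF.continuousOn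
  refine Integrable.of_bound hF.aestronglyMeasurable C ?_
  filter_upwards [ae_prod_norm n] with z hz
  exact hC z ⟨by simpa using hz.1, by simpa using hz.2⟩

lemma integral_prod_inner_fst {n : ℕ} (l : ℕ) {e : V n} (he : ‖e‖ = 1) (f : C(V n, ℝ)) :
    ∫ z, ⟪z.1, z.2⟫ ^ l * f z.1 ∂((sph n).prod (sph n)) = mom n l e * ∫ x, f x ∂sph n := by
  rw [integral_prod _ (integrable_prod_sph (by fun_prop)), ← integral_const_mul]
  refine integral_congr_ae ?_
  filter_upwards [sph_ae_norm n] with x hx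
  rw [integral_mul_const, mom_eq l he hx]
  rfl

lemma powQ_le_mom {n : ℕ} (k : ℕ) {e : V n} (he : ‖e‖ = 1) (v : C(V n, ℝ)) :
    powQ n (2 * k) v ≤ mom n (2 * k) e * ∫ x, v x ^ 2 ∂sph n := by
  have h1 := integral_prod_inner_fst (2 * k) he (v ^ 2)
  have h2 : ∫ z, ⟪z.1, z.2⟫ ^ (2 * k) * (v ^ 2) z.2 ∂((sph n).prod (sph n))
      = mom n (2 * k) e * ∫ x, (v ^ 2) x ∂sph n := by
    rw [← h1, ← integral_prod_swap]
    refine integral_congr_ae (ae_of_all _ fun z => ?_)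
    simp only [Prod.fst_swap, Prod.snd_swap, real_inner_comm]
  have h3 : powQ n (2 * k) v ≤ ∫ z, (1 / 2) * (⟪z.1, z.2⟫ ^ (2 * k) * (v ^ 2) z.1
      + ⟪z.1, z.2⟫ ^ (2 * k) * (v ^ 2) z.2) ∂((sph n).prod (sph n)) := by
    refine integral_mono (integrable_prod_sph (by fun_prop)) (integrable_prod_sph (by fun_prop))
      fun z => ?_
    have h4 : 0 ≤ ⟪z.1, z.2⟫ ^ (2 * k) := by rw [pow_mul]; positivity
    simp only [ContinuousMap.pow_apply]
    nlinarith [mul_nonneg h4 (sq_nonneg (v z.1 - v z.2))]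
  rw [integral_const_mul, integral_add (integrable_prod_sph (by fun_prop))
    (integrable_prod_sph (by fun_prop)), h1, h2] at h3
  simp only [ContinuousMap.pow_apply] at h3
  linarith

lemma powQ_even_le {n : ℕ} (hn : 2 ≤ n) {e : V n} (he : ‖e‖ = 1) (v : C(V n, ℝ))
    (hv : ∫ x, v x ∂sph n = 0) (k : ℕ) :
    powQ n (2 * k) v * (n + 2 * k) ≤ mom n (2 * k) e * (2 * k) * ∫ x, v x ^ 2 ∂sph n := by
  have hnR : (2 : ℝ) ≤ n := by exact_mod_cast hn
  rcases k with _ | k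
  · have h := powQ_le_powQ hn v hv 0
    simp at h ⊢
    exact mul_nonpos_of_nonpos_of_nonneg (by linarith) (by linarith)
  set N := ∫ x, v x ^ 2 ∂sph n with hN
  set q : ℕ → ℝ := fun j => powQ n (2 * j + 2) v / mom n (2 * j + 2) e * ((2 * j + 2 + n) / (2 * j + 2))
    with hq
  have hm : ∀ j, 0 < mom n (2 * j + 2) e := fun j => mom_even_pos hn (j + 1) he
  have hmono : Monotone q := by
    refine monotone_nat_of_le_succ fun j => ?_
    have h1 := powQ_le_powQ hn v hv (j + 1)
    have h2 := mom_succ (2 * j + 2) he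
    have e1 : 2 * (j + 1) = 2 * j + 2 := by ring
    have h3 := hm (j + 1)
    rw [e1] at h1 h3
    simp only [hq, e1]
    push_cast at h1 h2 ⊢
    have hj : (0 : ℝ) ≤ j := Nat.cast_nonneg j
    have h4 : mom n (2 * j + 2 + 2) e * (n + (2 * j + 2)) = (2 * j + 2 + 1) * mom n (2 * j + 2) e := by
      linarith
    have h5 : mom n (2 * j + 2) e = mom n (2 * j + 2 + 2) e * (n + (2 * j + 2)) / (2 * j + 3) := by
      field_simp
      linarith
    rw [h5]
    have h6 : powQ n (2 * j + 2) v / (mom n (2 * j + 2 + 2) e * (n + (2 * j + 2)) / (2 * j + 3))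
        * ((2 * j + 2 + n) / (2 * j + 2)) = (2 * j + 4) * (2 * j + 3) * powQ n (2 * j + 2) v
          / (mom n (2 * j + 2 + 2) e * ((2 * j + 4) * (2 * j + 2))) := by
      field_simp
      ring
    have h7 : powQ n (2 * j + 2 + 2) v / mom n (2 * j + 2 + 2) e
        * ((2 * (j + 1) + 2 + n) / (2 * (j + 1) + 2)) = (2 * j + 2) * (2 * j + 4 + n)
          * powQ n (2 * j + 2 + 2) v / (mom n (2 * j + 2 + 2) e * ((2 * j + 4) * (2 * j + 2))) := by
      field_simp
      ring
    rw [h6, h7]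
    refine div_le_div_of_nonneg_right ?_ (by positivity)
    linarith
  have hup : ∀ j : ℕ, q j ≤ N * (1 + n / (2 * (j : ℝ) + 2)) := by
    intro j
    have h1 := powQ_le_mom (j + 1) he v
    have e1 : 2 * (j + 1) = 2 * j + 2 := by ring
    rw [e1, ← hN] at h1
    have hj : (0 : ℝ) ≤ j := Nat.cast_nonneg j
    have h2 : powQ n (2 * j + 2) v / mom n (2 * j + 2) e ≤ N := by
      rw [div_le_iff₀ (hm j)]; linarith
    have h3 : (2 * j + 2 + n : ℝ) / (2 * j + 2) = 1 + n / (2 * (j : ℝ) + 2) := by field_simp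
    simp only [hq]
    rw [h3]
    exact mul_le_mul_of_nonneg_right h2 (by positivity)
  have hlim : Tendsto (fun j : ℕ => N * (1 + n / (2 * (j : ℝ) + 2))) atTop (𝓝 N) := by
    have h1 : Tendsto (fun j : ℕ => 2 * (j : ℝ) + 2) atTop atTop :=
      tendsto_atTop_add_const_right _ _
        (tendsto_natCast_atTop_atTop.const_mul_atTop (by norm_num : (0 : ℝ) < 2))
    have h2 := ((tendsto_const_nhds (x := (n : ℝ))).div_atTop h1).const_add 1 |>.const_mul N
    simpa using h2
  have hfin : q k ≤ N := by
    refine ge_of_tendsto hlim ?_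
    filter_upwards [eventually_ge_atTop k] with j hj
    exact (hmono hj).trans (hup j)
  simp only [hq] at hfin
  have e1 : 2 * (k + 1) = 2 * k + 2 := by ring
  have hk : (0 : ℝ) ≤ k := Nat.cast_nonneg k
  rw [e1]
  rw [div_mul_div_comm, div_le_iff₀ (mul_pos (hm k) (by positivity))] at hfin
  push_cast
  linarith

lemma powQ_odd_le {n : ℕ} (hn : 2 ≤ n) {e : V n} (he : ‖e‖ = 1) (v : C(V n, ℝ))
    (hv : ∀ i : Fin n, ∫ x, x i * v x ∂sph n = 0) (k : ℕ) :
    powQ n (2 * k + 1) v * (2 * k + 1) ≤ mom n (2 * k + 2) e * (2 * k) * ∫ x, v x ^ 2 ∂sph n := by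
  have hnR : (2 : ℝ) ≤ n := by exact_mod_cast hn
  let w : Fin n → C(V n, ℝ) := fun i => ⟨fun x => x i * v x, by fun_prop⟩
  have h1 : powQ n (2 * k + 1) v = ∑ i, powQ n (2 * k) (w i) := by
    unfold powQ
    rw [← integral_finsetSum _ fun i _ => integrable_prod_sph (by fun_prop)]
    refine integral_congr_ae (ae_of_all _ fun z => ?_)
    show ⟪z.1, z.2⟫ ^ (2 * k + 1) * (v z.1 * v z.2)
      = ∑ i, ⟪z.1, z.2⟫ ^ (2 * k) * ((z.1 i * v z.1) * (z.2 i * v z.2))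
    have e1 : ⟪z.1, z.2⟫ = ∑ i, z.1 i * z.2 i := by
      rw [PiLp.inner_apply]
      exact Finset.sum_congr rfl fun i _ => by simp [mul_comm]
    rw [← Finset.mul_sum, pow_succ, mul_assoc]
    congr 1
    rw [e1, Finset.sum_mul]
    exact Finset.sum_congr rfl fun i _ => by ring
  have h2 : ∑ i, ∫ x, w i x ^ 2 ∂sph n = ∫ x, v x ^ 2 ∂sph n := by
    rw [← integral_finsetSum _ fun i _ => integrable_sph_of_continuous (by fun_prop)]
    refine integral_congr_ae ?_
    filter_upwards [sph_ae_norm n] with x hx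
    show ∑ i, (x i * v x) ^ 2 = v x ^ 2
    have e1 : ∑ i, x i ^ 2 = 1 := by
      have := EuclideanSpace.real_norm_sq_eq x
      rw [hx] at this
      linarith
    simp only [mul_pow]
    rw [← Finset.sum_mul, e1, one_mul]
  have h3 : powQ n (2 * k + 1) v * (n + 2 * k)
      ≤ mom n (2 * k) e * (2 * k) * ∫ x, v x ^ 2 ∂sph n := by
    rw [h1, ← h2, Finset.sum_mul, Finset.mul_sum]
    exact Finset.sum_le_sum fun i _ => powQ_even_le hn he (w i) (hv i) k
  have h4 := mom_succ (2 * k) he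
  push_cast at h4
  have hk : (0 : ℝ) ≤ k := Nat.cast_nonneg k
  set N := ∫ x, v x ^ 2 ∂sph n
  have h5 : powQ n (2 * k + 1) v * (2 * k + 1) * (n + 2 * k)
      ≤ mom n (2 * k + 2) e * (2 * k) * N * (n + 2 * k) := by
    have h6 : mom n (2 * k + 2) e * (2 * k) * N * (n + 2 * k)
      = (2 * k + 1) * (mom n (2 * k) e * (2 * k) * N) := by linear_combination (2 * k * N) * h4
    rw [h6]
    nlinarith [mul_le_mul_of_nonneg_left h3 (by positivity : (0 : ℝ) ≤ 2 * k + 1)]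
  exact le_of_mul_le_mul_right h5 (by positivity)

/-- The Taylor coefficients of `y ↦ (1 - y) ^ (-a)`. -/
noncomputable def coef (a : ℝ) (j : ℕ) : ℝ := Ring.multichoose a j

lemma coef_zero (a : ℝ) : coef a 0 = 1 := by simp [coef]

lemma coef_succ (a : ℝ) (j : ℕ) : (j + 1 : ℝ) * coef a (j + 1) = coef a j * (a + j) := by
  have h : ∀ k : ℕ, (k.factorial : ℝ) * coef a k = (ascPochhammer ℝ k).eval a := by
    intro k
    have := Ring.factorial_nsmul_multichoose_eq_ascPochhammer a k
    rw [Polynomial.ascPochhammer_smeval_eq_eval, nsmul_eq_mul] at this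
    exact this
  have h1 := h (j + 1)
  rw [ascPochhammer_succ_eval, ← h j, Nat.factorial_succ] at h1
  push_cast at h1
  have h2 : (j.factorial : ℝ) ≠ 0 := by exact_mod_cast Nat.factorial_ne_zero j
  refine mul_left_cancel₀ h2 ?_
  linarith

lemma coef_pos {a : ℝ} (ha : 0 < a) (j : ℕ) : 0 < coef a j := by
  induction j with
  | zero => rw [coef_zero]; exact one_pos
  | succ j ih =>
    have h := coef_succ a j
    have h0 : (0 : ℝ) < j + 1 := by positivity
    have h1 : 0 < (j + 1 : ℝ) * coef a (j + 1) := by rw [h]; positivity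
    exact pos_of_mul_pos_right h1 h0.le

lemma hasSum_coef (a : ℝ) {y : ℝ} (hy : |y| < 1) :
    HasSum (fun j => coef a j * y ^ j) ((1 - y) ^ (-a)) := by
  have h := (Real.one_div_one_sub_rpow_hasFPowerSeriesOnBall_zero a).hasSum (y := y)
    (by
      have h1 : ‖y‖₊ < 1 := by rw [← NNReal.coe_lt_coe]; simpa using hy
      simpa [enorm_eq_nnnorm] using h1)
  simp only [FormalMultilinearSeries.ofScalars_apply_eq, zero_add, smul_eq_mul] at h
  rw [Real.rpow_neg (by linarith [(abs_lt.1 hy).2]), ← one_div]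
  have e1 : (fun j : ℕ => coef a j * y ^ j) = fun j : ℕ => Ring.choose (a + j - 1) j * y ^ j := by
    funext j
    rw [coef, Ring.choose]
    congr 2
    ring
  rw [e1]
  exact h

lemma even_series_gap {N a : ℝ} (hN : 2 ≤ N) (ha1 : 1 ≤ a) (ha2 : a ≤ (N + 1) / 2) {E O : ℕ → ℝ}
    (hE : ∀ k, 0 ≤ E k) (hEs : Summable E) (hOs : Summable O)
    (h1 : ∀ k : ℕ, E (k + 1) * (2 * k + 2) ≤ O k * (a + 2 * k + 1)) (h2 : E 0 ≤ 4 * N * E 1) :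
    (1 + 1 / (15 * N ^ 2)) * (∑' k, E k - ∑' k, O k) ≤ ∑' k : ℕ, E k * (N / (N + 2 * k)) := by
  set c := 1 / (15 * N ^ 2) with hc
  have hc0 : 0 < c := by positivity
  set X : ℕ → ℝ := fun k => E (k + 1) * (N / (N + 2 * k + 2)) - (1 + c) * (E (k + 1) - O k) with hX
  have hEs1 : Summable fun k => E (k + 1) := (summable_nat_add_iff 1).2 hEs
  have hEw : Summable fun k : ℕ => E k * (N / (N + 2 * k)) := by
    refine Summable.of_nonneg_of_le (fun k => mul_nonneg (hE k) (by positivity)) (fun k => ?_) hEs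
    refine mul_le_of_le_one_right (hE k) ?_
    rw [div_le_one (by positivity)]
    have : (0 : ℝ) ≤ k := Nat.cast_nonneg k
    linarith
  have hEw1 : Summable fun k : ℕ => E (k + 1) * (N / (N + 2 * k + 2)) := by
    have := (summable_nat_add_iff 1).2 hEw
    refine this.congr fun k => ?_
    push_cast
    ring_nf
  have hXs : Summable X := hEw1.sub ((hEs1.sub hOs).mul_left _)
  have hkey : ∀ k : ℕ, E (k + 1) - O k ≤ E (k + 1) * ((N - 1) / (N + 3 + 4 * k)) := by
    intro k
    have hk : (0 : ℝ) ≤ k := Nat.cast_nonneg k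
    have e1 : E (k + 1) * ((2 * k + 2) / (a + 2 * k + 1)) ≤ O k := by
      rw [← mul_div_assoc, div_le_iff₀ (by positivity)]
      exact h1 k
    have e2 : (4 * k + 4) / (N + 3 + 4 * k) ≤ (2 * k + 2) / (a + 2 * k + 1) := by
      rw [div_le_div_iff₀ (by positivity) (by positivity)]
      nlinarith [mul_nonneg hk (sub_nonneg.2 ha2)]
    have e3 : (N - 1) / (N + 3 + 4 * k) = 1 - (4 * k + 4) / (N + 3 + 4 * k) := by
      field_simp
      ring
    rw [e3]
    nlinarith [mul_le_mul_of_nonneg_left e2 (hE (k + 1))]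
  have hfrac : ∀ k : ℕ, (1 + c) * ((N - 1) / (N + 3 + 4 * k)) ≤ N / (N + 2 * k + 2) := by
    intro k
    have hk : (0 : ℝ) ≤ k := Nat.cast_nonneg k
    have e1 : c * (N - 1) * (N + 2 * k + 2) ≤ 2 * (k + 1) := by
      have : c * N ^ 2 = 1 / 15 := by rw [hc]; field_simp
      have h3 : c * N ≤ 1 / 15 := by nlinarith
      have h4 : c ≤ 1 / 15 := by nlinarith
      nlinarith [mul_nonneg hk (sub_nonneg.2 h3), mul_nonneg hk hc0.le]
    rw [← mul_div_assoc, div_le_div_iff₀ (by positivity) (by positivity)]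
    nlinarith
  have hX0 : ∀ k, 0 ≤ X k := by
    intro k
    have e1 := mul_le_mul_of_nonneg_left (hkey k) (by positivity : 0 ≤ 1 + c)
    have e2 := mul_le_mul_of_nonneg_left (hfrac k) (hE (k + 1))
    simp only [hX]
    linarith
  have hX1 : c * E 0 ≤ X 0 := by
    have e1 := mul_le_mul_of_nonneg_left (hkey 0) (by positivity : 0 ≤ 1 + c)
    have e2 : c * (4 * N) + (1 + c) * ((N - 1) / (N + 3)) ≤ N / (N + 2) := by
      have e3 : N / (N + 2) - (N - 1) / (N + 3) = 2 * (N + 1) / ((N + 2) * (N + 3)) := by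
        field_simp
        ring
      have e4 : c * (4 * N) + c * ((N - 1) / (N + 3)) ≤ 1 / (3 * N) := by
        have e5 : (N - 1) / (N + 3) ≤ N := by
          rw [div_le_iff₀ (by positivity)]; nlinarith
        have e6 : c * (5 * N) = 1 / (3 * N) := by rw [hc]; field_simp; norm_num
        nlinarith [mul_le_mul_of_nonneg_left e5 hc0.le]
      have e7 : 1 / (3 * N) ≤ 2 * (N + 1) / ((N + 2) * (N + 3)) := by
        rw [div_le_div_iff₀ (by positivity) (by positivity)]; nlinarith
      linarith
    have e8 := mul_le_mul_of_nonneg_left e2 (hE 1)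
    have e9 := mul_le_mul_of_nonneg_left h2 hc0.le
    simp only [hX, Nat.cast_zero, mul_zero, add_zero, zero_add] at e1 ⊢
    linarith
  have hXt : X 0 ≤ ∑' k, X k := hXs.le_tsum 0 fun k _ => hX0 k
  have t1 : ∑' k, X k = ∑' k : ℕ, E (k + 1) * (N / (N + 2 * k + 2))
      - (1 + c) * (∑' k, E (k + 1) - ∑' k, O k) := by
    rw [hEw1.tsum_sub ((hEs1.sub hOs).mul_left _), tsum_mul_left, hEs1.tsum_sub hOs]
  have t2 : ∑' k, E k = E 0 + ∑' k, E (k + 1) := hEs.tsum_eq_zero_add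
  have t3 : ∑' k : ℕ, E k * (N / (N + 2 * k)) = E 0 + ∑' k : ℕ, E (k + 1) * (N / (N + 2 * k + 2)) := by
    rw [hEw.tsum_eq_zero_add]
    congr 1
    · have : N ≠ 0 := by positivity
      simp [this]
    · refine tsum_congr fun k => ?_
      push_cast
      ring_nf
  rw [t3, t2]
  rw [t1] at hXt
  linarith

lemma odd_series_gap {N a : ℝ} (hN : 2 ≤ N) (ha2 : a ≤ (N + 1) / 2) {E O : ℕ → ℝ}
    (hO : ∀ k, 0 ≤ O k) (hEs : Summable E) (hOs : Summable O)
    (h1 : ∀ k : ℕ, E (k + 1) * (2 * k + 2) ≤ O k * (a + 2 * k + 1)) (h2 : E 0 ≤ 2 * N * O 0) :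
    (1 + 1 / (15 * N ^ 2)) * (∑' k, E k - ∑' k, O k)
      ≤ ∑' k, E k - ∑' k : ℕ, O k * (2 * k / (2 * k + 1)) := by
  set c := 1 / (15 * N ^ 2) with hc
  have hc0 : 0 < c := by positivity
  set Y : ℕ → ℝ := fun k => O k / (2 * k + 1) with hY
  have hY0 : ∀ k, 0 ≤ Y k := fun k => div_nonneg (hO k) (by positivity)
  have hYs : Summable Y := by
    refine Summable.of_nonneg_of_le hY0 (fun k => ?_) hOs
    refine div_le_self (hO k) ?_
    have : (0 : ℝ) ≤ k := Nat.cast_nonneg k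
    linarith
  have e1 : (fun k : ℕ => O k * (2 * k / (2 * k + 1))) = fun k => O k - Y k := by
    funext k
    simp only [hY]
    field_simp
    ring
  rw [e1, hOs.tsum_sub hYs]
  have hEs1 : Summable fun k => E (k + 1) := (summable_nat_add_iff 1).2 hEs
  have t2 : ∑' k, E k = E 0 + ∑' k, E (k + 1) := hEs.tsum_eq_zero_add
  have hY1 : Y 0 ≤ ∑' k, Y k := hYs.le_tsum 0 fun k _ => hY0 k
  have hYt : 0 ≤ ∑' k, Y k := tsum_nonneg hY0
  have hEO : ∑' k, E (k + 1) - ∑' k, O k ≤ N * ∑' k, Y k := by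
    rw [← hEs1.tsum_sub hOs, ← tsum_mul_left]
    refine (hEs1.sub hOs).tsum_le_tsum (fun k => ?_) (hYs.mul_left _)
    have hk : (0 : ℝ) ≤ k := Nat.cast_nonneg k
    have e2 : E (k + 1) ≤ O k * (a + 2 * k + 1) / (2 * k + 2) := by
      rw [le_div_iff₀ (by positivity)]; exact h1 k
    have e3 : O k * (a + 2 * k + 1) / (2 * k + 2) - O k = O k * ((a - 1) / (2 * k + 2)) := by
      field_simp
      ring
    have e4 : (a - 1) / (2 * k + 2) ≤ N / (2 * k + 1) := by
      rw [div_le_div_iff₀ (by positivity) (by positivity)]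
      nlinarith
    have e5 := mul_le_mul_of_nonneg_left e4 (hO k)
    have e6 : N * Y k = O k * (N / (2 * k + 1)) := by simp only [hY]; ring
    rw [e6]
    linarith
  have hY00 : Y 0 = O 0 := by simp [hY]
  have hS : ∑' k, E k - ∑' k, O k ≤ 3 * N * ∑' k, Y k := by
    have := mul_le_mul_of_nonneg_left hY1 (by positivity : 0 ≤ 2 * N)
    rw [hY00] at this
    rw [t2]
    linarith
  have hcN : c * (3 * N) ≤ 1 := by
    have : c * N ^ 2 = 1 / 15 := by rw [hc]; field_simp
    nlinarith
  have h7 := mul_le_mul_of_nonneg_left hS hc0.le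
  have h8 := mul_le_mul_of_nonneg_right hcN hYt
  linarith

lemma hasSum_kernel {α : Type*} [MeasurableSpace α] {μ : Measure α} {t g : α → ℝ}
    (ht : ∀ᵐ x ∂μ, |t x| ≤ 1) (htm : AEStronglyMeasurable t μ) (hg : Integrable g μ)
    {a r : ℝ} (ha : 0 < a) (hr0 : 0 ≤ r) (hr1 : r < 1) :
    HasSum (fun l : ℕ => coef a l * r ^ l * ∫ x, t x ^ l * g x ∂μ)
      (∫ x, (1 - r * t x) ^ (-a) * g x ∂μ) := by
  set F : ℕ → α → ℝ := fun l x => coef a l * r ^ l * (t x ^ l * g x) with hF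
  have hb : ∀ l : ℕ, ∀ᵐ x ∂μ, ‖t x ^ l * g x‖ ≤ ‖g x‖ := by
    intro l
    filter_upwards [ht] with x hx
    rw [norm_mul, norm_pow, Real.norm_eq_abs (t x)]
    exact mul_le_of_le_one_left (norm_nonneg _) (pow_le_one₀ (abs_nonneg _) hx)
  have hi : ∀ l : ℕ, Integrable (fun x => t x ^ l * g x) μ := fun l =>
    Integrable.mono hg ((htm.pow l).mul hg.aestronglyMeasurable) (hb l)
  have hc : ∀ l, 0 ≤ coef a l * r ^ l := fun l => mul_nonneg (coef_pos ha l).le (pow_nonneg hr0 l)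
  have hs : Summable fun l : ℕ => coef a l * r ^ l :=
    (hasSum_coef a (y := r) (by rwa [abs_of_nonneg hr0])).summable
  have h := hasSum_integral_of_summable_integral_norm (μ := μ) (F := F)
    (fun l => (hi l).const_mul _) (by
      refine Summable.of_nonneg_of_le (fun l => integral_nonneg fun x => norm_nonneg _)
        (fun l => ?_) (hs.mul_right (∫ x, ‖g x‖ ∂μ))
      rw [← integral_const_mul]
      refine integral_mono_ae ((hi l).const_mul _).norm (hg.norm.const_mul _) ?_
      filter_upwards [hb l] with x hx
      simp only [hF]
      rw [norm_mul, Real.norm_of_nonneg (hc l)]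
      exact mul_le_mul_of_nonneg_left hx (hc l))
  have e1 : ∫ x, ∑' l, F l x ∂μ = ∫ x, (1 - r * t x) ^ (-a) * g x ∂μ := by
    refine integral_congr_ae ?_
    filter_upwards [ht] with x hx
    have h1 : |r * t x| < 1 := by
      rw [abs_mul, abs_of_nonneg hr0]
      exact lt_of_le_of_lt (mul_le_of_le_one_right hr0 hx) hr1
    rw [← ((hasSum_coef a h1).mul_right (g x)).tsum_eq]
    refine tsum_congr fun l => ?_
    simp only [hF, mul_pow]
    ring
  rw [e1] at h
  refine h.congr_fun fun l => ?_
  simp only [hF]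
  rw [integral_const_mul]

lemma abs_inner_le_one {n : ℕ} {x y : V n} (hx : ‖x‖ = 1) (hy : ‖y‖ = 1) : |⟪x, y⟫| ≤ 1 :=
  abs_le.2 (inner_mem_Icc hx hy)

/-- The even part of a continuous function. -/
noncomputable def evenPart {n : ℕ} (v : C(V n, ℝ)) : C(V n, ℝ) :=
  ⟨fun x => (v x + v (-x)) / 2, by fun_prop⟩

/-- The odd part of a continuous function. -/
noncomputable def oddPart {n : ℕ} (v : C(V n, ℝ)) : C(V n, ℝ) :=
  ⟨fun x => (v x - v (-x)) / 2, by fun_prop⟩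

lemma integral_neg_sph {n : ℕ} (f : V n → ℝ) : ∫ x, f (-x) ∂sph n = ∫ x, f x ∂sph n :=
  (sph_map_isometry (LinearIsometryEquiv.neg ℝ)).integral_comp
    (LinearIsometryEquiv.neg ℝ : V n ≃ₗᵢ[ℝ] V n).toMeasurableEquiv.measurableEmbedding f

lemma integral_mul_evenPart {n : ℕ} (v f : C(V n, ℝ)) (hf : ∀ x, f (-x) = f x) :
    ∫ x, f x * evenPart v x ∂sph n = ∫ x, f x * v x ∂sph n := by
  have h1 := integral_neg_sph (fun x => f x * v x)
  have h2 : ∫ x, f x * evenPart v x ∂sph n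
      = ∫ x, (1 / 2) * (f x * v x + f (-x) * v (-x)) ∂sph n := by
    refine integral_congr_ae (ae_of_all _ fun x => ?_)
    simp only [evenPart, ContinuousMap.coe_mk, hf]
    ring
  rw [h2, integral_const_mul, integral_add (integrable_sph_of_continuous (by fun_prop))
    (integrable_sph_of_continuous (by fun_prop)), h1]
  ring

lemma integral_mul_oddPart {n : ℕ} (v f : C(V n, ℝ)) (hf : ∀ x, f (-x) = -f x) :
    ∫ x, f x * oddPart v x ∂sph n = ∫ x, f x * v x ∂sph n := by
  have h1 := integral_neg_sph (fun x => f x * v x)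
  have h2 : ∫ x, f x * oddPart v x ∂sph n
      = ∫ x, (1 / 2) * (f x * v x + f (-x) * v (-x)) ∂sph n := by
    refine integral_congr_ae (ae_of_all _ fun x => ?_)
    simp only [oddPart, ContinuousMap.coe_mk, hf]
    ring
  rw [h2, integral_const_mul, integral_add (integrable_sph_of_continuous (by fun_prop))
    (integrable_sph_of_continuous (by fun_prop)), h1]
  ring

lemma mono_neg {n j : ℕ} (I : Fin j → Fin n) (x : V n) : mono I (-x) = (-1) ^ j * mono I x := by
  show ∏ k, (-x) (I k) = (-1) ^ j * ∏ k, x (I k)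
  have : ∀ k, (-x) (I k) = (-1) * x (I k) := fun k => by simp
  simp only [this, Finset.prod_mul_distrib, Finset.prod_const, Finset.card_univ, Fintype.card_fin]

lemma powQ_congr {n l : ℕ} (v w : C(V n, ℝ))
    (h : ∀ I : Fin l → Fin n, ∫ x, mono I x * v x ∂sph n = ∫ x, mono I x * w x ∂sph n) :
    powQ n l v = powQ n l w := by
  rw [powQ_eq, powQ_eq, powOp, inner_gramOp, inner_gramOp]
  refine Finset.sum_congr rfl fun I _ => ?_
  rw [inner_toL_toL, inner_toL_toL, h]

lemma powQ_evenPart {n : ℕ} (k : ℕ) (v : C(V n, ℝ)) :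
    powQ n (2 * k) (evenPart v) = powQ n (2 * k) v :=
  powQ_congr _ _ fun I => integral_mul_evenPart v _ fun x => by rw [mono_neg, pow_mul]; simp

lemma powQ_oddPart {n : ℕ} (k : ℕ) (v : C(V n, ℝ)) :
    powQ n (2 * k + 1) (oddPart v) = powQ n (2 * k + 1) v :=
  powQ_congr _ _ fun I => integral_mul_oddPart v _ fun x => by
    rw [mono_neg, pow_succ, pow_mul]; simp

lemma integral_sq_parts {n : ℕ} (v : C(V n, ℝ)) :
    ∫ x, evenPart v x ^ 2 ∂sph n + ∫ x, oddPart v x ^ 2 ∂sph n = ∫ x, v x ^ 2 ∂sph n := by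
  have h1 := integral_neg_sph (fun x => v x ^ 2)
  rw [← integral_add (integrable_sph_of_continuous (by fun_prop))
    (integrable_sph_of_continuous (by fun_prop))]
  have h2 : ∫ x, (evenPart v x ^ 2 + oddPart v x ^ 2) ∂sph n
      = ∫ x, (1 / 2) * (v x ^ 2 + v (-x) ^ 2) ∂sph n := by
    refine integral_congr_ae (ae_of_all _ fun x => ?_)
    simp only [evenPart, oddPart, ContinuousMap.coe_mk]
    ring
  rw [h2, integral_const_mul, integral_add (integrable_sph_of_continuous (by fun_prop))
    (integrable_sph_of_continuous (by fun_prop)), h1]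
  ring

lemma integral_half_sq {n : ℕ} (l : ℕ) {e : V n} (he : ‖e‖ = 1) (v : C(V n, ℝ)) :
    ∫ z, ⟪z.1, z.2⟫ ^ l * ((v z.1 - v z.2) ^ 2 / 2) ∂((sph n).prod (sph n))
      = mom n l e * ∫ x, v x ^ 2 ∂sph n - powQ n l v := by
  have h1 := integral_prod_inner_fst l he (v ^ 2)
  have h2 : ∫ z, ⟪z.1, z.2⟫ ^ l * (v ^ 2) z.2 ∂((sph n).prod (sph n))
      = mom n l e * ∫ x, (v ^ 2) x ∂sph n := by
    rw [← h1, ← integral_prod_swap]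
    refine integral_congr_ae (ae_of_all _ fun z => ?_)
    simp only [Prod.fst_swap, Prod.snd_swap, real_inner_comm]
  have h3 : ∫ z, ⟪z.1, z.2⟫ ^ l * ((v z.1 - v z.2) ^ 2 / 2) ∂((sph n).prod (sph n))
      = ∫ z, ((1 / 2) * (⟪z.1, z.2⟫ ^ l * (v ^ 2) z.1 + ⟪z.1, z.2⟫ ^ l * (v ^ 2) z.2)
        - ⟪z.1, z.2⟫ ^ l * (v z.1 * v z.2)) ∂((sph n).prod (sph n)) := by
    refine integral_congr_ae (ae_of_all _ fun z => ?_)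
    simp only [ContinuousMap.pow_apply]
    ring
  rw [h3, integral_sub (integrable_prod_sph (by fun_prop)) (integrable_prod_sph (by fun_prop)),
    integral_const_mul, integral_add (integrable_prod_sph (by fun_prop))
    (integrable_prod_sph (by fun_prop)), h1, h2]
  simp only [ContinuousMap.pow_apply, powQ]
  ring

lemma hasSum_even_of_odd_eq_zero {f : ℕ → ℝ} {S : ℝ} (h : HasSum f S)
    (h0 : ∀ k, f (2 * k + 1) = 0) : HasSum (fun k => f (2 * k)) S := by
  have he : Summable fun k => f (2 * k) :=
    h.summable.comp_injective (i := fun k : ℕ => 2 * k) fun x y hxy => by simpa using hxy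
  have ho : Summable fun k => f (2 * k + 1) := by simp [h0]
  have := tsum_even_add_odd he ho
  rw [h.tsum_eq] at this
  simp only [h0, tsum_zero, add_zero] at this
  rw [← this]
  exact he.hasSum

lemma hasSum_odd_of_even_eq_zero {f : ℕ → ℝ} {S : ℝ} (h : HasSum f S)
    (h0 : ∀ k, f (2 * k) = 0) : HasSum (fun k => f (2 * k + 1)) S := by
  have ho : Summable fun k => f (2 * k + 1) :=
    h.summable.comp_injective (i := fun k : ℕ => 2 * k + 1) fun x y hxy => by simpa using hxy
  have he : Summable fun k => f (2 * k) := by simp [h0]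
  have := tsum_even_add_odd he ho
  rw [h.tsum_eq] at this
  simp only [h0, tsum_zero, zero_add] at this
  rw [← this]
  exact ho.hasSum

/-- The even moments of the regularised kernel. -/
noncomputable def evenCoef (n : ℕ) (a r : ℝ) (e : V n) (k : ℕ) : ℝ :=
  coef a (2 * k) * r ^ (2 * k) * mom n (2 * k) e

/-- The odd moments of the regularised kernel against the first harmonic. -/
noncomputable def oddCoef (n : ℕ) (a r : ℝ) (e : V n) (k : ℕ) : ℝ :=
  coef a (2 * k + 1) * r ^ (2 * k + 1) * mom n (2 * k + 2) e

lemma ae_abs_inner_le {n : ℕ} {e : V n} (he : ‖e‖ = 1) : ∀ᵐ z ∂sph n, |⟪e, z⟫| ≤ 1 := by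
  filter_upwards [sph_ae_norm n] with z hz
  exact abs_inner_le_one he hz

lemma hasSum_evenCoef {n : ℕ} (hn : 2 ≤ n) {a r : ℝ} (ha : 0 < a) (hr : r ∈ Ico (1 / 2 : ℝ) 1)
    {e : V n} (he : ‖e‖ = 1) :
    HasSum (evenCoef n a r e) (∫ z, (1 - r * ⟪e, z⟫) ^ (-a) ∂sph n) := by
  have h := hasSum_kernel (μ := sph n) (t := fun z => ⟪e, z⟫) (g := fun _ => 1)
    (ae_abs_inner_le he) (by fun_prop) (integrable_const _) ha (by linarith [hr.1]) hr.2
  simp only [mul_one] at h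
  exact hasSum_even_of_odd_eq_zero h fun k => by
    have := mom_odd hn k he
    rw [mom] at this
    rw [this, mul_zero]

lemma hasSum_oddCoef {n : ℕ} (hn : 2 ≤ n) {a r : ℝ} (ha : 0 < a) (hr : r ∈ Ico (1 / 2 : ℝ) 1)
    {e : V n} (he : ‖e‖ = 1) :
    HasSum (oddCoef n a r e) (∫ z, (1 - r * ⟪e, z⟫) ^ (-a) * ⟪e, z⟫ ∂sph n) := by
  have h := hasSum_kernel (μ := sph n) (t := fun z => ⟪e, z⟫) (g := fun z => ⟪e, z⟫)
    (ae_abs_inner_le he) (by fun_prop) (integrable_sph_of_continuous (by fun_prop)) ha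
    (by linarith [hr.1]) hr.2
  simp only [← pow_succ] at h
  exact hasSum_odd_of_even_eq_zero h fun k => by
    have := mom_odd hn k he
    rw [mom] at this
    rw [this, mul_zero]

lemma evenCoef_nonneg {n : ℕ} (hn : 2 ≤ n) {a r : ℝ} (ha : 0 < a) (hr : 0 ≤ r)
    {e : V n} (he : ‖e‖ = 1) (k : ℕ) : 0 ≤ evenCoef n a r e k :=
  mul_nonneg (mul_nonneg (coef_pos ha _).le (pow_nonneg hr _)) (mom_even_pos hn k he).le

lemma oddCoef_nonneg {n : ℕ} (hn : 2 ≤ n) {a r : ℝ} (ha : 0 < a) (hr : 0 ≤ r)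
    {e : V n} (he : ‖e‖ = 1) (k : ℕ) : 0 ≤ oddCoef n a r e k :=
  mul_nonneg (mul_nonneg (coef_pos ha _).le (pow_nonneg hr _)) (mom_even_pos hn (k + 1) he).le

lemma evenCoef_succ_le {n : ℕ} (hn : 2 ≤ n) {a r : ℝ} (ha : 0 < a) (hr : r ∈ Ico (1 / 2 : ℝ) 1)
    {e : V n} (he : ‖e‖ = 1) (k : ℕ) :
    evenCoef n a r e (k + 1) * (2 * k + 2) ≤ oddCoef n a r e k * (a + 2 * k + 1) := by
  have h1 := coef_succ a (2 * k + 1)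
  push_cast at h1
  have h2 : evenCoef n a r e (k + 1) * (2 * k + 2) = r * (oddCoef n a r e k * (a + 2 * k + 1)) := by
    simp only [evenCoef, oddCoef, show 2 * (k + 1) = 2 * k + 1 + 1 by ring, pow_succ r (2 * k + 1)]
    linear_combination (r ^ (2 * k + 1) * r * mom n (2 * k + 1 + 1) e) * h1
  rw [h2]
  exact mul_le_of_le_one_left (mul_nonneg (oddCoef_nonneg hn ha (by linarith [hr.1]) he k)
    (by positivity)) hr.2.le

lemma mom_two {n : ℕ} (e : V n) (he : ‖e‖ = 1) : n * mom n 2 e = mom n 0 e := by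
  have := mom_succ 0 he
  simpa using this

lemma evenCoef_zero_le {n : ℕ} (hn : 2 ≤ n) {a r : ℝ} (ha : 1 ≤ a) (hr : r ∈ Ico (1 / 2 : ℝ) 1)
    {e : V n} (he : ‖e‖ = 1) : evenCoef n a r e 0 ≤ 4 * n * evenCoef n a r e 1 := by
  have h1 := coef_succ a 0
  have h2 := coef_succ a 1
  norm_num [coef_zero] at h1 h2
  have h3 := mom_two e he
  have hm := mom_even_pos hn 0 he
  simp only [mul_zero] at hm
  simp only [evenCoef, mul_zero, coef_zero, pow_zero, mul_one, one_mul]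
  have hc : 1 ≤ coef a 2 := by rw [h1] at h2; nlinarith
  have hr2 : 1 ≤ 4 * r ^ 2 := by nlinarith [hr.1]
  calc mom n 0 e ≤ (coef a 2 * (4 * r ^ 2)) * mom n 0 e :=
        le_mul_of_one_le_left hm.le (one_le_mul_of_one_le_of_one_le hc hr2)
    _ = _ := by rw [← h3]; ring

lemma evenCoef_zero_le_oddCoef {n : ℕ} (hn : 2 ≤ n) {a r : ℝ} (ha : 1 ≤ a)
    (hr : r ∈ Ico (1 / 2 : ℝ) 1) {e : V n} (he : ‖e‖ = 1) :
    evenCoef n a r e 0 ≤ 2 * n * oddCoef n a r e 0 := by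
  have h1 := coef_succ a 0
  norm_num [coef_zero] at h1
  have h3 := mom_two e he
  have hm := mom_even_pos hn 0 he
  simp only [mul_zero] at hm
  simp only [evenCoef, oddCoef, mul_zero, coef_zero, pow_zero, mul_one, one_mul, zero_add, pow_one,
    h1]
  have hr2 : 1 ≤ 2 * r := by linarith [hr.1]
  calc mom n 0 e ≤ (a * (2 * r)) * mom n 0 e :=
        le_mul_of_one_le_left hm.le (one_le_mul_of_one_le_of_one_le ha hr2)
    _ = _ := by rw [← h3]; ring

theorem regularised_gap {n : ℕ} (hn : 2 ≤ n) {a r : ℝ} (ha1 : 1 ≤ a) (ha2 : a ≤ (n + 1) / 2)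
    (hr : r ∈ Ico (1 / 2 : ℝ) 1) {e : V n} (he : ‖e‖ = 1) (v : C(V n, ℝ))
    (hv0 : ∫ x, v x ∂sph n = 0) (hv1 : ∀ i : Fin n, ∫ x, x i * v x ∂sph n = 0) :
    (1 + 1 / (15 * (n : ℝ) ^ 2)) * (∫ z, (1 - r * ⟪e, z⟫) ^ (-a) ∂sph n
        - ∫ z, (1 - r * ⟪e, z⟫) ^ (-a) * ⟪e, z⟫ ∂sph n) * ∫ x, v x ^ 2 ∂sph n
      ≤ ∫ z, (1 - r * ⟪z.1, z.2⟫) ^ (-a) * ((v z.1 - v z.2) ^ 2 / 2)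
          ∂((sph n).prod (sph n)) := by
  have ha : 0 < a := by linarith
  have hr0 : 0 ≤ r := by linarith [hr.1]
  have hN : (2 : ℝ) ≤ n := by exact_mod_cast hn
  have hE := hasSum_evenCoef hn ha hr he
  have hO := hasSum_oddCoef hn ha hr he
  set E := evenCoef n a r e
  set O := oddCoef n a r e
  have hE0 : ∀ k, 0 ≤ E k := evenCoef_nonneg hn ha hr0 he
  have hO0 : ∀ k, 0 ≤ O k := oddCoef_nonneg hn ha hr0 he
  have hsucc : ∀ k : ℕ, E (k + 1) * (2 * k + 2) ≤ O k * (a + 2 * k + 1) :=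
    evenCoef_succ_le hn ha hr he
  have hge := even_series_gap hN ha1 ha2 hE0 hE.summable hO.summable hsucc
    (evenCoef_zero_le hn ha1 hr he)
  have hgo := odd_series_gap hN ha2 hO0 hE.summable hO.summable hsucc
    (evenCoef_zero_le_oddCoef hn ha1 hr he)
  have hD := hasSum_kernel (μ := (sph n).prod (sph n)) (t := fun z => ⟪z.1, z.2⟫)
    (g := fun z => (v z.1 - v z.2) ^ 2 / 2)
    (by filter_upwards [ae_prod_norm n] with z hz using abs_inner_le_one hz.1 hz.2)
    (by fun_prop) (integrable_prod_sph (by fun_prop)) ha hr0 hr.2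
  simp only [integral_half_sq _ he] at hD
  rw [← integral_sq_parts v] at hD ⊢
  set A := ∫ x, evenPart v x ^ 2 ∂sph n
  set B := ∫ x, oddPart v x ^ 2 ∂sph n
  have hA : 0 ≤ A := integral_nonneg fun x => sq_nonneg _
  have hB : 0 ≤ B := integral_nonneg fun x => sq_nonneg _
  rw [hE.tsum_eq, hO.tsum_eq] at hge hgo
  set κ := ∫ z, (1 - r * ⟪e, z⟫) ^ (-a) ∂sph n
  set τ := ∫ z, (1 - r * ⟪e, z⟫) ^ (-a) * ⟪e, z⟫ ∂sph n
  set f : ℕ → ℝ := fun l => coef a l * r ^ l * (mom n l e * (A + B) - powQ n l v) with hf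
  have hfe : Summable fun k => f (2 * k) :=
    hD.summable.comp_injective (i := fun k : ℕ => 2 * k) fun x y hxy => by simpa using hxy
  have hfo : Summable fun k => f (2 * k + 1) :=
    hD.summable.comp_injective (i := fun k : ℕ => 2 * k + 1) fun x y hxy => by simpa using hxy
  rw [← hD.tsum_eq, ← tsum_even_add_odd hfe hfo]
  have hv0' : ∫ x, evenPart v x ∂sph n = 0 := by
    have := integral_mul_evenPart v 1 (fun x => rfl)
    simpa [hv0] using this
  have hv1' : ∀ i : Fin n, ∫ x, x i * oddPart v x ∂sph n = 0 := fun i => by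
    have := integral_mul_oddPart v ⟨fun x : V n => x i, by fun_prop⟩ (fun x => by simp)
    simpa [hv1] using this
  have he1 : ∀ k : ℕ, E k * (n / (n + 2 * k)) * A + E k * B ≤ f (2 * k) := fun k => by
    have h := powQ_even_le hn he _ hv0' k
    rw [powQ_evenPart] at h
    have hp : (0 : ℝ) < n + 2 * k := by positivity
    have hc : 0 ≤ coef a (2 * k) * r ^ (2 * k) := mul_nonneg (coef_pos ha _).le (pow_nonneg hr0 _)
    have h' : powQ n (2 * k) v ≤ mom n (2 * k) e * (2 * k) * A / (n + 2 * k) := by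
      rw [le_div_iff₀ hp]; exact h
    have h2 := mul_le_mul_of_nonneg_left h' hc
    have e1 : E k * (n / (n + 2 * k)) * A + E k * B = coef a (2 * k) * r ^ (2 * k) *
        (mom n (2 * k) e * (A + B)) - coef a (2 * k) * r ^ (2 * k) *
        (mom n (2 * k) e * (2 * k) * A / (n + 2 * k)) := by
      simp only [E, evenCoef]
      field_simp
      ring
    simp only [hf]
    rw [e1, mul_sub]
    linarith
  have ho1 : ∀ k : ℕ, -(O k * (2 * k / (2 * k + 1)) * B) ≤ f (2 * k + 1) := fun k => by
    have h := powQ_odd_le hn he _ hv1' k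
    rw [powQ_oddPart] at h
    have hp : (0 : ℝ) < 2 * k + 1 := by positivity
    have hc : 0 ≤ coef a (2 * k + 1) * r ^ (2 * k + 1) :=
      mul_nonneg (coef_pos ha _).le (pow_nonneg hr0 _)
    have h' : powQ n (2 * k + 1) v ≤ mom n (2 * k + 2) e * (2 * k) * B / (2 * k + 1) := by
      rw [le_div_iff₀ hp]; exact h
    have h2 := mul_le_mul_of_nonneg_left h' hc
    have e1 : O k * (2 * k / (2 * k + 1)) * B = coef a (2 * k + 1) * r ^ (2 * k + 1) *
        (mom n (2 * k + 2) e * (2 * k) * B / (2 * k + 1)) := by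
      simp only [O, oddCoef]
      ring
    simp only [hf]
    rw [e1, mul_sub, mom_odd hn k he]
    linarith
  have hs1 : Summable fun k : ℕ => E k * (n / (n + 2 * k)) :=
    Summable.of_nonneg_of_le (fun k => mul_nonneg (hE0 k) (by positivity))
      (fun k => mul_le_of_le_one_right (hE0 k) (div_le_one_of_le₀ (by linarith [k.cast_nonneg (α := ℝ)])
        (by positivity))) hE.summable
  have hs2 : Summable fun k : ℕ => O k * (2 * k / (2 * k + 1)) :=
    Summable.of_nonneg_of_le (fun k => mul_nonneg (hO0 k) (by positivity))
      (fun k => mul_le_of_le_one_right (hO0 k) (div_le_one_of_le₀ (by linarith)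
        (by positivity))) hO.summable
  have he2 := (((hs1.mul_right A).add (hE.summable.mul_right B))).tsum_le_tsum he1 hfe
  have ho2 := (hs2.mul_right B).neg.tsum_le_tsum ho1 hfo
  rw [(hs1.mul_right A).tsum_add (hE.summable.mul_right B), tsum_mul_right, tsum_mul_right,
    hE.tsum_eq] at he2
  rw [tsum_neg, tsum_mul_right] at ho2
  have h1 := mul_le_mul_of_nonneg_right hge hA
  have h2 := mul_le_mul_of_nonneg_right hgo hB
  linarith

/-- The squared chordal distance `2 - 2⟪x, y⟫` of two points of the unit sphere. -/
noncomputable def chordSq {n : ℕ} (z : V n × V n) : ℝ := 2 - 2 * ⟪z.1, z.2⟫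

lemma chordSq_eq {n : ℕ} {x y : V n} (hx : ‖x‖ = 1) (hy : ‖y‖ = 1) :
    chordSq (x, y) = ‖x - y‖ ^ 2 := by
  rw [norm_sub_sq_real, hx, hy, chordSq]
  ring

@[fun_prop]
lemma continuous_chordSq {n : ℕ} : Continuous (chordSq (n := n)) := by
  unfold chordSq
  fun_prop

lemma ae_chordSq_pos {n : ℕ} (hn : 2 ≤ n) :
    ∀ᵐ z ∂((sph n).prod (sph n)), ‖z.1‖ = 1 ∧ ‖z.2‖ = 1 ∧ 0 < chordSq z := by
  have h : ∀ᵐ z ∂((sph n).prod (sph n)), 0 < chordSq z := by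
    rw [Measure.ae_prod_iff_ae_ae (measurableSet_lt measurable_const
      continuous_chordSq.measurable)]
    filter_upwards [sph_ae_norm n] with x hx
    filter_upwards [ae_inner_lt_one hn hx] with y hy
    simp only [chordSq]
    linarith
  filter_upwards [h, ae_prod_norm n] with z h1 h2 using ⟨h2.1, h2.2, h1⟩

lemma measurable_chordSq_rpow {n : ℕ} (p : ℝ) :
    Measurable fun z : V n × V n => chordSq z ^ p :=
  continuous_chordSq.measurable.pow_const p

lemma integrable_two_sub {n : ℕ} (hn : 2 ≤ n) {s : ℝ} (hs : s ∈ Ioo (0 : ℝ) 1) {x : V n}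
    (hx : ‖x‖ = 1) :
    Integrable (fun z => (2 - 2 * ⟪x, z⟫) ^ (1 - ((n : ℝ) + s) / 2)) (sph n) := by
  refine ((integrable_chord hn hs hx).const_mul (2 ^ (1 - ((n : ℝ) + s) / 2))).congr ?_
  filter_upwards [sph_ae_norm n] with z hz
  rw [← Real.mul_rpow (by norm_num) (by linarith [(inner_mem_Icc hx hz).2]), mul_sub, mul_one]

lemma lamOne_eq {n : ℕ} (s : ℝ) {x y : V n} (hx : ‖x‖ = 1) (hy : ‖y‖ = 1) :
    lamOne n s x = lamOne n s y :=
  integral_zonal hx hy fun t => (2 - 2 * t) ^ (1 - ((n : ℝ) + s) / 2)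

lemma lamOne_pos {n : ℕ} (hn : 2 ≤ n) {s : ℝ} (hs : s ∈ Ioo (0 : ℝ) 1) {x : V n}
    (hx : ‖x‖ = 1) : 0 < lamOne n s x := by
  have h : ∀ᵐ z ∂sph n, 0 < (2 - 2 * ⟪x, z⟫) ^ (1 - ((n : ℝ) + s) / 2) := by
    filter_upwards [ae_inner_lt_one hn hx] with z hz
    exact Real.rpow_pos_of_pos (by linarith) _
  rw [lamOne, integral_pos_iff_support_of_nonneg_ae (h.mono fun z hz => hz.le)
    (integrable_two_sub hn hs hx)]
  rw [measure_congr (t := univ) (by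
    filter_upwards [h] with z hz
    exact propext ⟨fun _ => trivial, fun _ => hz.ne'⟩)]
  exact pos_iff_ne_zero.2 (sph_univ_ne_zero (by omega))

lemma integrable_prod_chord {n : ℕ} (hn : 2 ≤ n) {s : ℝ} (hs : s ∈ Ioo (0 : ℝ) 1) {e : V n}
    (he : ‖e‖ = 1) :
    Integrable (fun z => chordSq z ^ (1 - ((n : ℝ) + s) / 2)) ((sph n).prod (sph n)) := by
  rw [integrable_prod_iff (measurable_chordSq_rpow _).aestronglyMeasurable]
  constructor
  · filter_upwards [sph_ae_norm n] with x hx using integrable_two_sub hn hs hx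
  · refine (integrable_const (lamOne n s e)).congr ?_
    filter_upwards [sph_ae_norm n] with x hx
    rw [lamOne_eq s he hx, lamOne]
    refine integral_congr_ae ?_
    filter_upwards [sph_ae_norm n] with y hy
    rw [chordSq_eq hx hy, Real.norm_of_nonneg (Real.rpow_nonneg (sq_nonneg _) _),
      ← chordSq_eq hx hy]
    rfl

lemma integral_prod_chord {n : ℕ} (hn : 2 ≤ n) {s : ℝ} (hs : s ∈ Ioo (0 : ℝ) 1) {e : V n}
    (he : ‖e‖ = 1) :
    ∫ z, chordSq z ^ (1 - ((n : ℝ) + s) / 2) ∂((sph n).prod (sph n))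
      = lamOne n s e * (sph n).real univ := by
  rw [integral_prod _ (integrable_prod_chord hn hs he)]
  have : ∫ x, ∫ y, chordSq (x, y) ^ (1 - ((n : ℝ) + s) / 2) ∂sph n ∂sph n
      = ∫ x, lamOne n s e ∂sph n := by
    refine integral_congr_ae ?_
    filter_upwards [sph_ae_norm n] with x hx
    rw [lamOne_eq s he hx, lamOne]
    rfl
  rw [this, integral_const, smul_eq_mul, mul_comm]

/-- The squared Gagliardo seminorm of order `(1+s)/2` on the unit sphere. -/
noncomputable def gag (n : ℕ) (s : ℝ) (v : V n → ℝ) : ℝ :=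
  ∫ z, (v z.1 - v z.2) ^ 2 * chordSq z ^ (-(((n : ℝ) + s) / 2)) ∂((sph n).prod (sph n))

lemma sq_mul_chordSq_le {n : ℕ} {s C : ℝ} {v : V n → ℝ}
    (hv : ∀ x y, ‖x‖ = 1 → ‖y‖ = 1 → |v x - v y| ≤ C * ‖x - y‖) {z : V n × V n}
    (h1 : ‖z.1‖ = 1) (h2 : ‖z.2‖ = 1) (h3 : 0 < chordSq z) :
    (v z.1 - v z.2) ^ 2 * chordSq z ^ (-(((n : ℝ) + s) / 2))
      ≤ C ^ 2 * chordSq z ^ (1 - ((n : ℝ) + s) / 2) := by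
  have e1 : chordSq z ^ (1 - ((n : ℝ) + s) / 2)
      = chordSq z * chordSq z ^ (-(((n : ℝ) + s) / 2)) := by
    rw [sub_eq_add_neg, Real.rpow_add h3, Real.rpow_one]
  rw [e1, ← mul_assoc]
  refine mul_le_mul_of_nonneg_right ?_ (Real.rpow_nonneg h3.le _)
  have := chordSq_eq h1 h2
  rw [Prod.mk.eta] at this
  rw [this, ← mul_pow, ← sq_abs (v z.1 - v z.2)]
  exact pow_le_pow_left₀ (abs_nonneg _) (hv _ _ h1 h2) 2

lemma integrable_gag {n : ℕ} (hn : 2 ≤ n) {s C : ℝ} (hs : s ∈ Ioo (0 : ℝ) 1) {e : V n}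
    (he : ‖e‖ = 1) {v : V n → ℝ} (hvc : Continuous v)
    (hv : ∀ x y, ‖x‖ = 1 → ‖y‖ = 1 → |v x - v y| ≤ C * ‖x - y‖) :
    Integrable (fun z => (v z.1 - v z.2) ^ 2 * chordSq z ^ (-(((n : ℝ) + s) / 2)))
      ((sph n).prod (sph n)) := by
  refine Integrable.mono' ((integrable_prod_chord hn hs he).const_mul (C ^ 2))
    (((by fun_prop : Continuous fun z : V n × V n => (v z.1 - v z.2) ^ 2).measurable.mul
      (measurable_chordSq_rpow _)).aestronglyMeasurable) ?_
  filter_upwards [ae_chordSq_pos hn] with z hz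
  rw [Real.norm_of_nonneg (mul_nonneg (sq_nonneg _) (Real.rpow_nonneg hz.2.2.le _))]
  exact sq_mul_chordSq_le hv hz.1 hz.2.1 hz.2.2

lemma gag_le {n : ℕ} (hn : 2 ≤ n) {s C : ℝ} (hs : s ∈ Ioo (0 : ℝ) 1) {e : V n}
    (he : ‖e‖ = 1) {v : V n → ℝ} (hvc : Continuous v)
    (hv : ∀ x y, ‖x‖ = 1 → ‖y‖ = 1 → |v x - v y| ≤ C * ‖x - y‖) :
    gag n s v ≤ C ^ 2 * (lamOne n s e * (sph n).real univ) := by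
  rw [← integral_prod_chord hn hs he, ← integral_const_mul]
  refine integral_mono_ae (integrable_gag hn hs he hvc hv)
    ((integrable_prod_chord hn hs he).const_mul _) ?_
  filter_upwards [ae_chordSq_pos hn] with z hz
  exact sq_mul_chordSq_le hv hz.1 hz.2.1 hz.2.2

lemma regularised_kernel_le {a r t : ℝ} (ha : 0 ≤ a) (hr : r ∈ Ico (1 / 2 : ℝ) 1) (ht : t < 1) :
    (1 - r * t) ^ (-a) ≤ 4 ^ a * (2 - 2 * t) ^ (-a) := by
  have h1 : 0 < (2 - 2 * t) / 4 := by linarith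
  have h2 : (2 - 2 * t) / 4 ≤ 1 - r * t := by nlinarith [hr.1, hr.2]
  refine (Real.rpow_le_rpow_of_nonpos h1 h2 (by linarith)).trans_eq ?_
  rw [Real.div_rpow (by linarith) (by norm_num), Real.rpow_neg (x := 4) (by norm_num), div_inv_eq_mul,
    mul_comm]

lemma tendsto_regularised_kernel {a t : ℝ} (ht : t < 1) :
    Tendsto (fun r : ℝ => (1 - r * t) ^ (-a)) (𝓝[<] 1) (𝓝 (2 ^ a * (2 - 2 * t) ^ (-a))) := by
  have e : 2 ^ a * (2 - 2 * t) ^ (-a) = (1 - 1 * t) ^ (-a) := by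
    rw [show 2 - 2 * t = 2 * (1 - 1 * t) by ring, Real.mul_rpow (by norm_num) (by linarith),
      ← mul_assoc, ← Real.rpow_add (by norm_num)]
    simp
  rw [e]
  have : ContinuousAt (fun r : ℝ => (1 - r * t) ^ (-a)) 1 :=
    ContinuousAt.rpow_const (by fun_prop) (Or.inl (by linarith))
  exact this.tendsto.mono_left nhdsWithin_le_nhds

lemma regularised_pos {r t : ℝ} (hr : r ∈ Ico (1 / 2 : ℝ) 1) (ht : t ∈ Icc (-1 : ℝ) 1) :
    0 < 1 - r * t := by nlinarith [hr.1, hr.2, ht.1, ht.2]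

theorem gag_gap {n : ℕ} (hn : 2 ≤ n) {s C : ℝ} (hs : s ∈ Ioo (0 : ℝ) 1) {e : V n}
    (he : ‖e‖ = 1) (v : C(V n, ℝ))
    (hv : ∀ x y, ‖x‖ = 1 → ‖y‖ = 1 → |v x - v y| ≤ C * ‖x - y‖)
    (hv0 : ∫ x, v x ∂sph n = 0) (hv1 : ∀ i : Fin n, ∫ x, x i * v x ∂sph n = 0) :
    (1 + 1 / (15 * (n : ℝ) ^ 2)) * lamOne n s e * ∫ x, v x ^ 2 ∂sph n ≤ gag n s v := by
  have hnR : (2 : ℝ) ≤ n := by exact_mod_cast hn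
  set a := ((n : ℝ) + s) / 2
  have ha1 : 1 ≤ a := by simp only [a]; linarith [hs.1]
  have ha2 : a ≤ (n + 1) / 2 := by simp only [a]; linarith [hs.2]
  have hev : ∀ᶠ r : ℝ in 𝓝[<] 1, r ∈ Ico (1 / 2 : ℝ) 1 :=
    Ico_mem_nhdsLT (by norm_num)
  have hL : Tendsto (fun r : ℝ => ∫ z, (1 - ⟪e, z⟫) * (1 - r * ⟪e, z⟫) ^ (-a) ∂sph n) (𝓝[<] 1)
      (𝓝 (∫ z, (1 - ⟪e, z⟫) * (2 ^ a * (2 - 2 * ⟪e, z⟫) ^ (-a)) ∂sph n)) := by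
    refine tendsto_integral_filter_of_dominated_convergence
      (fun z => 4 ^ a / 2 * (2 - 2 * ⟪e, z⟫) ^ (1 - a)) ?_ ?_
      ((integrable_two_sub hn hs he).const_mul _) ?_
    · refine Eventually.of_forall fun r => Measurable.aestronglyMeasurable ?_
      exact (by fun_prop : Measurable fun z : V n => 1 - ⟪e, z⟫).mul
        ((by fun_prop : Measurable fun z : V n => 1 - r * ⟪e, z⟫).pow_const _)
    · filter_upwards [hev] with r hr
      filter_upwards [ae_inner_lt_one hn he, sph_ae_norm n] with z hz hz1
      have h0 := regularised_pos hr (inner_mem_Icc he hz1)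
      rw [Real.norm_of_nonneg (mul_nonneg (by linarith) (Real.rpow_nonneg h0.le _)),
        sub_eq_add_neg (1 : ℝ) a, Real.rpow_add (by linarith), Real.rpow_one]
      calc _ ≤ (1 - ⟪e, z⟫) * (4 ^ a * (2 - 2 * ⟪e, z⟫) ^ (-a)) :=
            mul_le_mul_of_nonneg_left (regularised_kernel_le (by linarith) hr hz) (by linarith)
        _ = _ := by ring
    · filter_upwards [ae_inner_lt_one hn he] with z hz
      exact (tendsto_regularised_kernel hz).const_mul _
  have hLe : ∫ z, (1 - ⟪e, z⟫) * (2 ^ a * (2 - 2 * ⟪e, z⟫) ^ (-a)) ∂sph n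
      = 2 ^ a / 2 * lamOne n s e := by
    rw [lamOne, ← integral_const_mul]
    refine integral_congr_ae ?_
    filter_upwards [ae_inner_lt_one hn he] with z hz
    change _ = 2 ^ a / 2 * (2 - 2 * ⟪e, z⟫) ^ (1 - a)
    rw [sub_eq_add_neg (1 : ℝ) a, Real.rpow_add (by linarith), Real.rpow_one]
    ring
  have hR : Tendsto (fun r : ℝ => ∫ z, (1 - r * ⟪z.1, z.2⟫) ^ (-a) * ((v z.1 - v z.2) ^ 2 / 2)
        ∂((sph n).prod (sph n))) (𝓝[<] 1)
      (𝓝 (∫ z, 2 ^ a * (2 - 2 * ⟪z.1, z.2⟫) ^ (-a) * ((v z.1 - v z.2) ^ 2 / 2)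
        ∂((sph n).prod (sph n)))) := by
    refine tendsto_integral_filter_of_dominated_convergence
      (fun z => 4 ^ a / 2 * ((v z.1 - v z.2) ^ 2 * chordSq z ^ (-a))) ?_ ?_
      ((integrable_gag hn hs he v.continuous hv).const_mul _) ?_
    · refine Eventually.of_forall fun r => Measurable.aestronglyMeasurable ?_
      exact ((by fun_prop : Measurable fun z : V n × V n => 1 - r * ⟪z.1, z.2⟫).pow_const _).mul
        (by fun_prop : Continuous fun z : V n × V n => (v z.1 - v z.2) ^ 2 / 2).measurable
    · filter_upwards [hev] with r hr
      filter_upwards [ae_chordSq_pos hn] with z hz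
      have h0 := regularised_pos hr (inner_mem_Icc hz.1 hz.2.1)
      have h1 := hz.2.2
      simp only [chordSq] at h1 ⊢
      rw [Real.norm_of_nonneg (mul_nonneg (Real.rpow_nonneg h0.le _) (by positivity))]
      calc _ ≤ (4 ^ a * (2 - 2 * ⟪z.1, z.2⟫) ^ (-a)) * ((v z.1 - v z.2) ^ 2 / 2) :=
            mul_le_mul_of_nonneg_right
              (regularised_kernel_le (by linarith) hr (by linarith)) (by positivity)
        _ = _ := by ring
    · filter_upwards [ae_chordSq_pos hn] with z hz
      have h1 := hz.2.2
      simp only [chordSq] at h1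
      exact (tendsto_regularised_kernel (by linarith)).mul_const _
  have hRe : ∫ z, 2 ^ a * (2 - 2 * ⟪z.1, z.2⟫) ^ (-a) * ((v z.1 - v z.2) ^ 2 / 2)
        ∂((sph n).prod (sph n)) = 2 ^ a / 2 * gag n s v := by
    rw [gag, ← integral_const_mul]
    refine integral_congr_ae (ae_of_all _ fun z => ?_)
    simp only [chordSq, a]
    ring
  have h := le_of_tendsto_of_tendsto ((hL.const_mul (1 + 1 / (15 * (n : ℝ) ^ 2))).mul_const
    (∫ x, v x ^ 2 ∂sph n)) hR (by
      filter_upwards [hev] with r hr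
      refine le_trans (le_of_eq ?_) (regularised_gap hn ha1 ha2 hr he v hv0 hv1)
      have hc : ContinuousOn (fun z : V n => (1 - r * ⟪e, z⟫) ^ (-a)) (sphere 0 1) :=
        ContinuousOn.rpow_const (by fun_prop) fun z hz =>
          Or.inl (regularised_pos hr (mapsTo_inner he hz)).ne'
      have hc' : ContinuousOn (fun z : V n => (1 - r * ⟪e, z⟫) ^ (-a) * ⟪e, z⟫) (sphere 0 1) :=
        hc.mul (by fun_prop)
      rw [← integral_sub (integrable_sph_of_continuousOn hc) (integrable_sph_of_continuousOn hc')]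
      congr 2
      refine integral_congr_ae (ae_of_all _ fun z => ?_)
      simp only
      ring)
  rw [hLe, hRe] at h
  have hp : (0 : ℝ) < 2 ^ a / 2 := by positivity
  refine le_of_mul_le_mul_left ?_ hp
  linarith

lemma abs_one_add_pow_sub_le {t : ℝ} (ht : |t| ≤ 1) (k : ℕ) :
    |(1 + t) ^ k - 1 - k * t| ≤ 2 ^ k * t ^ 2 := by
  have h : |(1 + t) ^ k - 1 - k * t| ≤ (2 ^ k - k - 1) * t ^ 2 := by
    induction k with
    | zero => simp
    | succ k ih =>
      have e : (1 + t) ^ (k + 1) - 1 - ((k + 1 : ℕ) : ℝ) * t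
          = (1 + t) * ((1 + t) ^ k - 1 - k * t) + k * t ^ 2 := by
        push_cast
        ring
      have h2 : |1 + t| ≤ 2 := by
        rw [abs_le] at ht ⊢
        constructor <;> linarith
      rw [e]
      calc _ ≤ |1 + t| * |(1 + t) ^ k - 1 - k * t| + k * t ^ 2 := by
            refine (abs_add_le _ _).trans_eq ?_
            rw [abs_mul, abs_of_nonneg (by positivity : 0 ≤ (k : ℝ) * t ^ 2)]
        _ ≤ 2 * ((2 ^ k - k - 1) * t ^ 2) + k * t ^ 2 := by
            gcongr
        _ = _ := by
            push_cast
            ring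
  refine h.trans (mul_le_mul_of_nonneg_right ?_ (sq_nonneg t))
  linarith [k.cast_nonneg (α := ℝ)]

lemma integral_inner_sq {n : ℕ} (hn : 2 ≤ n) (w : V n) :
    ∫ x, ⟪w, x⟫ ^ 2 ∂sph n = ‖w‖ ^ 2 * ((sph n).real univ / n) := by
  rcases eq_or_ne w 0 with rfl | hw
  · simp
  have hw' : ‖w‖ ≠ 0 := norm_ne_zero_iff.2 hw
  have he : ‖‖w‖⁻¹ • w‖ = 1 := by rw [norm_smul, norm_inv, norm_norm, inv_mul_cancel₀ hw']
  have hn0 : (n : ℝ) ≠ 0 := by positivity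
  have h := mom_two _ he
  rw [mom_zero, mom] at h
  rw [← h, mul_div_cancel_left₀ _ hn0, ← integral_const_mul]
  refine integral_congr_ae (ae_of_all _ fun x => ?_)
  simp only [real_inner_smul_left]
  field_simp

lemma integral_inner_mul_inner {n : ℕ} (hn : 2 ≤ n) (w w' : V n) :
    ∫ x, ⟪w, x⟫ * ⟪w', x⟫ ∂sph n = ⟪w, w'⟫ * ((sph n).real univ / n) := by
  have e : ∫ x, ⟪w, x⟫ * ⟪w', x⟫ ∂sph n
      = ∫ x, (1 / 4) * (⟪w + w', x⟫ ^ 2 - ⟪w - w', x⟫ ^ 2) ∂sph n := by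
    refine integral_congr_ae (ae_of_all _ fun x => ?_)
    simp only [inner_add_left, inner_sub_left]
    ring
  rw [e, integral_const_mul, integral_sub (integrable_sph_of_continuous (by fun_prop))
    (integrable_sph_of_continuous (by fun_prop)), integral_inner_sq hn, integral_inner_sq hn,
    norm_add_sq_real, norm_sub_sq_real]
  ring

lemma integral_inner_sph {n : ℕ} (w : V n) : ∫ x, ⟪w, x⟫ ∂sph n = 0 := by
  have h := integral_neg_sph (fun x => ⟪w, x⟫)
  simp only [inner_neg_right, integral_neg] at h
  linarith

/-- The center of mass of a density on the unit sphere. -/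
noncomputable def sphMoment (n : ℕ) (u : V n → ℝ) : V n := ∫ x, u x • x ∂sph n

lemma inner_sphMoment {n : ℕ} {u : V n → ℝ} (hu : Continuous u) (w : V n) :
    ⟪w, sphMoment n u⟫ = ∫ x, ⟪w, x⟫ * u x ∂sph n := by
  have hi : Integrable (fun x : V n => u x • x) (sph n) := by
    have hc : Continuous (fun x : V n => u x • x) := by fun_prop
    obtain ⟨C, hC⟩ := (isCompact_sphere (0 : V n) 1).exists_bound_of_continuousOn hc.continuousOn
    refine Integrable.of_bound hc.aestronglyMeasurable C ?_
    filter_upwards [sph_ae_sphere n] with x hx using hC x hx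
  rw [sphMoment, ← integral_inner hi]
  refine integral_congr_ae (ae_of_all _ fun x => ?_)
  simp only [real_inner_smul_right]
  ring

/-- The component of a function orthogonal to the spherical harmonics of degree at most one. -/
noncomputable def highPart (n : ℕ) (u : C(V n, ℝ)) : C(V n, ℝ) :=
  ⟨fun x => u x - ((∫ y, u y ∂sph n) / (sph n).real univ
    + ⟪(n / (sph n).real univ) • sphMoment n u, x⟫), by fun_prop⟩

lemma integral_inner_mul_highPart {n : ℕ} (hn : 2 ≤ n) (u : C(V n, ℝ)) (w : V n) :
    ∫ x, ⟪w, x⟫ * highPart n u x ∂sph n = 0 := by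
  have hω := sph_real_pos (n := n) (by omega)
  have hn0 : (n : ℝ) ≠ 0 := by positivity
  set b := (n / (sph n).real univ) • sphMoment n u with hb
  set c := (∫ y, u y ∂sph n) / (sph n).real univ
  have e : ∫ x, ⟪w, x⟫ * highPart n u x ∂sph n
      = ∫ x, (⟪w, x⟫ * u x - (c * ⟪w, x⟫ + ⟪w, x⟫ * ⟪b, x⟫)) ∂sph n := by
    refine integral_congr_ae (ae_of_all _ fun x => ?_)
    simp only [highPart, ContinuousMap.coe_mk]
    ring
  rw [e, integral_sub (integrable_sph_of_continuous (by fun_prop))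
    (integrable_sph_of_continuous (by fun_prop)), integral_add
    (integrable_sph_of_continuous (by fun_prop)) (integrable_sph_of_continuous (by fun_prop)),
    integral_const_mul, integral_inner_sph, integral_inner_mul_inner hn, hb,
    real_inner_smul_right, ← inner_sphMoment u.continuous]
  field_simp
  ring

lemma integral_highPart {n : ℕ} (hn : 2 ≤ n) (u : C(V n, ℝ)) :
    ∫ x, highPart n u x ∂sph n = 0 := by
  have hω := sph_real_pos (n := n) (by omega)
  simp only [highPart, ContinuousMap.coe_mk]
  rw [integral_sub (integrable_sph_of_continuous (by fun_prop))
    (integrable_sph_of_continuous (by fun_prop)), integral_add (integrable_const _)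
    (integrable_sph_of_continuous (by fun_prop)), integral_inner_sph, integral_const, smul_eq_mul]
  field_simp
  ring

lemma integral_highPart_sq {n : ℕ} (hn : 2 ≤ n) (u : C(V n, ℝ)) :
    ∫ x, highPart n u x ^ 2 ∂sph n = ∫ x, u x ^ 2 ∂sph n
      - (∫ x, u x ∂sph n) ^ 2 / (sph n).real univ
      - n / (sph n).real univ * ‖sphMoment n u‖ ^ 2 := by
  have hω := sph_real_pos (n := n) (by omega)
  have h1 := integral_inner_mul_highPart hn u ((n / (sph n).real univ) • sphMoment n u)
  have h0 := integral_highPart hn u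
  set b := (n / (sph n).real univ) • sphMoment n u with hb
  set c := (∫ y, u y ∂sph n) / (sph n).real univ with hc
  have e : ∫ x, highPart n u x ^ 2 ∂sph n
      = ∫ x, ((u x ^ 2 - c * u x - ⟪b, x⟫ * u x)
        - (c * highPart n u x + ⟪b, x⟫ * highPart n u x)) ∂sph n := by
    refine integral_congr_ae (ae_of_all _ fun x => ?_)
    simp only [highPart, ContinuousMap.coe_mk]
    ring
  rw [e, integral_sub (integrable_sph_of_continuous (by fun_prop))
    (integrable_sph_of_continuous (by fun_prop)), integral_add
    (integrable_sph_of_continuous (by fun_prop)) (integrable_sph_of_continuous (by fun_prop)),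
    integral_sub (integrable_sph_of_continuous (by fun_prop))
    (integrable_sph_of_continuous (by fun_prop)), integral_sub
    (integrable_sph_of_continuous (by fun_prop)) (integrable_sph_of_continuous (by fun_prop)),
    integral_const_mul, integral_const_mul, h1, h0, ← inner_sphMoment u.continuous, hb,
    real_inner_smul_left, real_inner_self_eq_norm_sq, hc]
  ring

lemma gap_scalar {κ δ : ℝ} (hκ0 : 0 < κ) (hκ1 : κ ≤ 1 / 60) (hδκ : δ ≤ κ ^ 2 / 64) :
    (1 + κ / 8) * (1 + κ / 2) ≤ (1 + κ) * (1 - δ) - (1 + 8 / κ) * δ := by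
  have hk8 : 8 / κ * δ ≤ κ / 8 := by
    rw [div_mul_eq_mul_div, div_le_iff₀ hκ0]
    linarith
  have h1 : κ * δ ≤ κ * (κ ^ 2 / 64) := mul_le_mul_of_nonneg_left hδκ hκ0.le
  have h2 : κ ^ 2 ≤ κ / 60 := by nlinarith
  have h3 : κ * κ ^ 2 ≤ κ * (κ / 60) := mul_le_mul_of_nonneg_left h2 hκ0.le
  have h4 : κ * (κ / 60) = κ ^ 2 / 60 := by ring
  have h5 : (1 + κ / 8) * (1 + κ / 2) = 1 + 5 / 8 * κ + κ ^ 2 / 16 := by ring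
  rw [h5, add_mul, mul_sub, add_mul]
  linarith

lemma sub_sq_le_weighted {κ : ℝ} (hκ : 0 < κ) (x y : ℝ) :
    (x - y) ^ 2 ≤ (1 + κ / 8) * x ^ 2 + (1 + 8 / κ) * y ^ 2 := by
  have h : 0 ≤ (κ / 8) * (x + (8 / κ) * y) ^ 2 := by positivity
  have e : (κ / 8) * (x + (8 / κ) * y) ^ 2 = κ / 8 * x ^ 2 + 2 * x * y + 8 / κ * y ^ 2 := by
    field_simp
    ring
  linarith [sub_sq x y]

section NearlySpherical

variable {n : ℕ} {u : C(V n, ℝ)}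

lemma abs_integral_le (hn : 2 ≤ n) (hu : ∀ x, ‖x‖ = 1 → |u x| ≤ 1)
    (hvol : ∫ x, ((1 + u x) ^ n - 1) ∂sph n = 0) :
    |∫ x, u x ∂sph n| ≤ 2 ^ (n + 1) * ∫ x, u x ^ 2 ∂sph n := by
  have hN : (2 : ℝ) ≤ n := by exact_mod_cast hn
  have h1 : -(n * ∫ x, u x ∂sph n) = ∫ x, ((1 + u x) ^ n - 1 - n * u x) ∂sph n := by
    rw [integral_sub (integrable_sph_of_continuous (by fun_prop))
      (integrable_sph_of_continuous (by fun_prop)), hvol, integral_const_mul]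
    ring
  have h2 : |n * ∫ x, u x ∂sph n| ≤ 2 ^ n * ∫ x, u x ^ 2 ∂sph n := by
    rw [← abs_neg, h1, ← integral_const_mul]
    refine abs_integral_le_integral_abs.trans (integral_mono_ae
      (integrable_sph_of_continuous (by fun_prop)) (integrable_sph_of_continuous (by fun_prop)) ?_)
    filter_upwards [sph_ae_norm n] with x hx using abs_one_add_pow_sub_le (hu x hx) n
  rw [abs_mul, Nat.abs_cast] at h2
  have hW : 0 ≤ ∫ x, u x ^ 2 ∂sph n := integral_nonneg fun x => sq_nonneg _
  have h3 : |∫ x, u x ∂sph n| ≤ n * |∫ x, u x ∂sph n| :=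
    le_mul_of_one_le_left (abs_nonneg _) (by linarith)
  have : (0 : ℝ) < 2 ^ n := by positivity
  rw [pow_succ]
  nlinarith

lemma norm_sphMoment_le (hn : 2 ≤ n) (hu : ∀ x, ‖x‖ = 1 → |u x| ≤ 1)
    (hbar : ∀ w : V n, ∫ x, ⟪w, x⟫ * (1 + u x) ^ (n + 1) ∂sph n = 0) :
    ‖sphMoment n u‖ ≤ 2 ^ (n + 1) * ∫ x, u x ^ 2 ∂sph n := by
  have hN : (2 : ℝ) ≤ n := by exact_mod_cast hn
  have hW : 0 ≤ ∫ x, u x ^ 2 ∂sph n := integral_nonneg fun x => sq_nonneg _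
  set w := sphMoment n u with hw
  rcases eq_or_ne w 0 with h0 | h0
  · rw [h0, norm_zero]
    positivity
  have h1 : -((n + 1 : ℕ) * ‖w‖ ^ 2)
      = ∫ x, ⟪w, x⟫ * ((1 + u x) ^ (n + 1) - 1 - (n + 1 : ℕ) * u x) ∂sph n := by
    have e : ∫ x, ⟪w, x⟫ * ((1 + u x) ^ (n + 1) - 1 - (n + 1 : ℕ) * u x) ∂sph n
        = ∫ x, (⟪w, x⟫ * (1 + u x) ^ (n + 1) - ⟪w, x⟫ - (n + 1 : ℕ) * (⟪w, x⟫ * u x)) ∂sph n := by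
      refine integral_congr_ae (ae_of_all _ fun x => ?_)
      simp only
      ring
    rw [e, integral_sub (integrable_sph_of_continuous (by fun_prop))
      (integrable_sph_of_continuous (by fun_prop)), integral_sub
      (integrable_sph_of_continuous (by fun_prop)) (integrable_sph_of_continuous (by fun_prop)),
      hbar, integral_inner_sph, integral_const_mul, ← inner_sphMoment u.continuous, ← hw,
      real_inner_self_eq_norm_sq]
    ring
  have h2 : (n + 1 : ℕ) * ‖w‖ ^ 2 ≤ ‖w‖ * (2 ^ (n + 1) * ∫ x, u x ^ 2 ∂sph n) := by
    rw [← abs_of_nonneg (by positivity : 0 ≤ ((n + 1 : ℕ) : ℝ) * ‖w‖ ^ 2), ← abs_neg, h1,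
      ← integral_const_mul, ← integral_const_mul]
    refine abs_integral_le_integral_abs.trans (integral_mono_ae
      (integrable_sph_of_continuous (by fun_prop)) (integrable_sph_of_continuous (by fun_prop)) ?_)
    filter_upwards [sph_ae_norm n] with x hx
    rw [abs_mul]
    refine mul_le_mul ?_ (abs_one_add_pow_sub_le (hu x hx) (n + 1)) (abs_nonneg _) (norm_nonneg _)
    have := abs_real_inner_le_norm w x
    rwa [hx, mul_one] at this
  have hp : 0 < ‖w‖ := norm_pos_iff.2 h0
  push_cast at h2
  refine le_of_mul_le_mul_left (le_trans ?_ h2) hp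
  nlinarith

theorem nearly_spherical_gap (hn : 2 ≤ n) {ε s C : ℝ} (hs : s ∈ Ioo (0 : ℝ) 1) {e : V n}
    (he : ‖e‖ = 1) (hε : 120 * (n : ℝ) ^ 3 * 2 ^ (n + 1) * ε ≤ 1)
    (hu : ∀ x, ‖x‖ = 1 → |u x| ≤ ε)
    (huL : ∀ x y, ‖x‖ = 1 → ‖y‖ = 1 → |u x - u y| ≤ C * ‖x - y‖)
    (hvol : ∫ x, ((1 + u x) ^ n - 1) ∂sph n = 0)
    (hbar : ∀ w : V n, ∫ x, ⟪w, x⟫ * (1 + u x) ^ (n + 1) ∂sph n = 0) :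
    (1 + 1 / (30 * (n : ℝ) ^ 2)) * lamOne n s e * ∫ x, u x ^ 2 ∂sph n ≤ gag n s u := by
  have hN : (2 : ℝ) ≤ n := by exact_mod_cast hn
  have hε0 : 0 ≤ ε := (abs_nonneg _).trans (hu e he)
  have hω := sph_real_pos (n := n) (by omega)
  have hl1 := lamOne_pos hn hs he
  have hW0 : 0 ≤ ∫ x, u x ^ 2 ∂sph n := integral_nonneg fun x => sq_nonneg _
  have hm0 : (0 : ℝ) < 2 ^ (n + 1) := by positivity
  have hm1 : (1 : ℝ) ≤ 2 ^ (n + 1) := one_le_pow₀ (by norm_num)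
  have hε1 : ε ≤ 1 := by
    refine le_trans (le_mul_of_one_le_left hε0 ?_) hε
    have : (1 : ℝ) ≤ n ^ 3 := one_le_pow₀ (by linarith)
    nlinarith
  have hu1 : ∀ x, ‖x‖ = 1 → |u x| ≤ 1 := fun x hx => (hu x hx).trans hε1
  have hI := abs_integral_le hn hu1 hvol
  have hM := norm_sphMoment_le hn hu1 hbar
  have hWε : ∫ x, u x ^ 2 ∂sph n ≤ ε ^ 2 * (sph n).real univ := by
    have : ∫ x, u x ^ 2 ∂sph n ≤ ∫ x, ε ^ 2 ∂sph n := by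
      refine integral_mono_ae (integrable_sph_of_continuous (by fun_prop)) (integrable_const _) ?_
      filter_upwards [sph_ae_norm n] with x hx
      rw [← sq_abs]
      exact pow_le_pow_left₀ (abs_nonneg _) (hu x hx) 2
    rwa [integral_const, smul_eq_mul, mul_comm] at this
  have hsq := integral_highPart_sq hn u
  set W := ∫ x, u x ^ 2 ∂sph n
  set ω := (sph n).real univ
  set m : ℝ := 2 ^ (n + 1)
  set b := (n / ω) • sphMoment n u with hb
  set c := (∫ y, u y ∂sph n) / ω with hc
  set ℓ : V n → ℝ := fun x => c + ⟪b, x⟫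
  have hℓc : Continuous ℓ := by fun_prop
  have hℓL : ∀ x y : V n, ‖x‖ = 1 → ‖y‖ = 1 → |ℓ x - ℓ y| ≤ ‖b‖ * ‖x - y‖ := fun x y _ _ => by
    have : ℓ x - ℓ y = ⟪b, x - y⟫ := by simp only [ℓ, inner_sub_right]; ring
    rw [this]
    exact abs_real_inner_le_norm _ _
  have hv : ∀ x, highPart n u x = u x - ℓ x := fun x => rfl
  have hgap := gag_gap (C := C + ‖b‖) hn hs he (highPart n u) (fun x y hx hy => by
      rw [hv, hv, add_mul]
      have h1 := huL x y hx hy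
      have h2 := hℓL x y hx hy
      rw [show u x - ℓ x - (u y - ℓ y) = (u x - u y) - (ℓ x - ℓ y) by ring]
      exact (abs_sub _ _).trans (add_le_add h1 h2))
    (integral_highPart hn u) (fun i => by
      have := integral_inner_mul_highPart hn u (EuclideanSpace.single i 1)
      simpa [EuclideanSpace.inner_single_left] using this)
  have hℓg := gag_le hn hs he hℓc hℓL
  set κ : ℝ := 1 / (15 * (n : ℝ) ^ 2) with hκ
  have hκ0 : 0 < κ := by positivity
  have hκ1 : κ ≤ 1 / 60 := by
    rw [hκ]
    exact one_div_le_one_div_of_le (by norm_num) (by nlinarith)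
  have hsplit : gag n s (highPart n u) ≤ (1 + κ / 8) * gag n s u + (1 + 8 / κ) * gag n s ℓ := by
    have i1 := integrable_gag hn hs he u.continuous huL
    have i2 := integrable_gag hn hs he hℓc hℓL
    simp only [gag]
    rw [← integral_const_mul, ← integral_const_mul,
      ← integral_add (i1.const_mul _) (i2.const_mul _)]
    refine integral_mono_of_nonneg ?_ ((i1.const_mul _).add (i2.const_mul _)) ?_
    · filter_upwards [ae_chordSq_pos hn] with z hz
      exact mul_nonneg (sq_nonneg _) (Real.rpow_nonneg hz.2.2.le _)
    · filter_upwards [ae_chordSq_pos hn] with z hz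
      have hk := Real.rpow_nonneg hz.2.2.le (-(((n : ℝ) + s) / 2))
      rw [← mul_assoc, ← mul_assoc, ← add_mul]
      refine mul_le_mul_of_nonneg_right ?_ hk
      rw [hv, hv]
      rw [sub_sub_sub_comm]
      exact sub_sq_le_weighted hκ0 _ _
  have hbn : ‖b‖ ≤ n / ω * (m * W) := by
    rw [hb, norm_smul, Real.norm_of_nonneg (by positivity)]
    exact mul_le_mul_of_nonneg_left hM (by positivity)
  set δ : ℝ := (n * m * ε) ^ 2 with hδ
  have hδ0 : 0 ≤ δ := sq_nonneg _
  have hmW : (m * W) ^ 2 / ω ≤ m ^ 2 * ε ^ 2 * W := by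
    rw [div_le_iff₀ hω]
    calc (m * W) ^ 2 = m ^ 2 * W * W := by ring
      _ ≤ m ^ 2 * W * (ε ^ 2 * ω) := by gcongr
      _ = _ := by ring
  have hX0 : 0 ≤ m ^ 2 * ε ^ 2 * W := by positivity
  have hδn : (1 + n) * (m ^ 2 * ε ^ 2 * W) ≤ δ * W := by
    calc (1 + n) * (m ^ 2 * ε ^ 2 * W) ≤ (n * n) * (m ^ 2 * ε ^ 2 * W) :=
          mul_le_mul_of_nonneg_right (by nlinarith only [hN]) hX0
      _ = _ := by rw [hδ]; ring
  have hℓb : gag n s ℓ ≤ δ * lamOne n s e * W := by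
    refine hℓg.trans ?_
    calc ‖b‖ ^ 2 * (lamOne n s e * ω) ≤ (n / ω * (m * W)) ^ 2 * (lamOne n s e * ω) := by gcongr
      _ = n ^ 2 * lamOne n s e * ((m * W) ^ 2 / ω) := by field_simp
      _ ≤ n ^ 2 * lamOne n s e * (m ^ 2 * ε ^ 2 * W) := by gcongr
      _ = _ := by rw [hδ]; ring
  have hvW : (1 - δ) * W ≤ ∫ x, highPart n u x ^ 2 ∂sph n := by
    rw [hsq]
    have t1 : (∫ x, u x ∂sph n) ^ 2 / ω ≤ m ^ 2 * ε ^ 2 * W := by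
      refine le_trans ?_ hmW
      rw [← sq_abs]
      gcongr
    have t2 : n / ω * ‖sphMoment n u‖ ^ 2 ≤ n * (m ^ 2 * ε ^ 2 * W) := by
      calc n / ω * ‖sphMoment n u‖ ^ 2 ≤ n / ω * (m * W) ^ 2 := by gcongr
        _ = n * ((m * W) ^ 2 / ω) := by ring
        _ ≤ _ := by gcongr
    linarith
  have hδκ : δ ≤ κ ^ 2 / 64 := by
    have : n * m * ε ≤ κ / 8 := by
      rw [hκ, div_div, le_div_iff₀ (by positivity)]
      exact (by ring : _ = 120 * (n : ℝ) ^ 3 * m * ε).trans_le hε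
    calc δ ≤ (κ / 8) ^ 2 := by rw [hδ]; gcongr
      _ = _ := by ring
  set Λ := lamOne n s e * W with hΛ
  have hΛ0 : 0 ≤ Λ := by positivity
  have hmain : (1 + κ) * (1 - δ) * Λ ≤ (1 + κ / 8) * gag n s u + (1 + 8 / κ) * (δ * Λ) := by
    calc (1 + κ) * (1 - δ) * Λ = (1 + κ) * lamOne n s e * ((1 - δ) * W) := by rw [hΛ]; ring
      _ ≤ (1 + κ) * lamOne n s e * ∫ x, highPart n u x ^ 2 ∂sph n := by gcongr
      _ ≤ _ := hgap.trans hsplit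
      _ ≤ _ := by
        rw [show δ * Λ = δ * lamOne n s e * W by rw [hΛ]; ring]
        gcongr
  have hfin := gap_scalar hκ0 hκ1 hδκ
  have h3 := mul_le_mul_of_nonneg_right hfin hΛ0
  have h4 : (1 + κ / 8) * ((1 + κ / 2) * Λ) ≤ (1 + κ / 8) * gag n s u := by linarith
  have h5 := le_of_mul_le_mul_left h4 (by positivity)
  rw [show (1 : ℝ) / (30 * (n : ℝ) ^ 2) = κ / 2 by rw [hκ]; field_simp; norm_num, mul_assoc]
  exact h5

end NearlySpherical

lemma chordSq_rpow_eq {n : ℕ} (s : ℝ) {x y : V n} (hx : ‖x‖ = 1) (hy : ‖y‖ = 1) :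
    chordSq (x, y) ^ (-(((n : ℝ) + s) / 2)) = ‖x - y‖ ^ (-((n : ℝ) + s)) := by
  rw [chordSq_eq hx hy, sq_rpow_half (norm_nonneg _)]

section

variable {n : ℕ} {u : C(V n, ℝ)}

lemma lintegral_radSq_bounds (hn : 2 ≤ n) {ε s : ℝ} (hs : s ∈ Ioo (0 : ℝ) 1) {e : V n}
    (he : ‖e‖ = 1) (hε : 5 * n * ε ≤ 1) (hu : ∀ x, ‖x‖ = 1 → |u x| ≤ ε)
    (huL : ∀ x y, ‖x‖ = 1 → ‖y‖ = 1 → |u x - u y| ≤ ε * ‖x - y‖) :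
    ENNReal.ofReal ((1 - 5 * n * ε) * gag n s u)
        ≤ ∫⁻ x, ∫⁻ y, radSq n s ⟪x, y⟫ (1 + u x) (1 + u y) ∂sph n ∂sph n ∧
      ∫⁻ x, ∫⁻ y, radSq n s ⟪x, y⟫ (1 + u x) (1 + u y) ∂sph n ∂sph n
        ≤ ENNReal.ofReal (16 ^ n * gag n s u) := by
  have hε0 : 0 ≤ ε := (abs_nonneg _).trans (hu e he)
  have hi := integrable_gag hn hs he u.continuous huL
  have hm : Measurable fun z : V n × V n => radSq n s ⟪z.1, z.2⟫ (1 + u z.1) (1 + u z.2) :=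
    (measurable_radSq n s).comp (g := fun z : ℝ × ℝ × ℝ => radSq n s z.1 z.2.1 z.2.2)
      (f := fun z : V n × V n => (⟪z.1, z.2⟫, 1 + u z.1, 1 + u z.2)) (by fun_prop)
  have hg : ∀ c : ℝ, 0 ≤ c → ENNReal.ofReal (c * gag n s u) = ∫⁻ z, ENNReal.ofReal
      (c * ((u z.1 - u z.2) ^ 2 * chordSq z ^ (-(((n : ℝ) + s) / 2))))
        ∂((sph n).prod (sph n)) := fun c hc => by
    rw [gag, ← integral_const_mul, ofReal_integral_eq_lintegral_ofReal (hi.const_mul c)]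
    filter_upwards [ae_chordSq_pos hn] with z hz
    exact mul_nonneg hc (mul_nonneg (sq_nonneg _) (Real.rpow_nonneg hz.2.2.le _))
  rw [lintegral_lintegral hm.aemeasurable, hg _ (by linarith), hg _ (by positivity)]
  have hb : ∀ᵐ z ∂((sph n).prod (sph n)), ENNReal.ofReal ((1 - 5 * n * ε)
        * ((u z.1 - u z.2) ^ 2 * chordSq z ^ (-(((n : ℝ) + s) / 2))))
        ≤ radSq n s ⟪z.1, z.2⟫ (1 + u z.1) (1 + u z.2) ∧
      radSq n s ⟪z.1, z.2⟫ (1 + u z.1) (1 + u z.2) ≤ ENNReal.ofReal (16 ^ n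
        * ((u z.1 - u z.2) ^ 2 * chordSq z ^ (-(((n : ℝ) + s) / 2)))) := by
    filter_upwards [ae_chordSq_pos hn] with z hz
    obtain ⟨h1, h2, h3⟩ := hz
    have e2 := chordSq_eq h1 h2
    have e3 := chordSq_rpow_eq s h1 h2
    rw [Prod.mk.eta] at e2 e3
    have hmem : ∀ x, ‖x‖ = 1 → 1 + u x ∈ Icc (1 - ε) (1 + ε) := fun x hx => by
      have := abs_le.1 (hu x hx)
      constructor <;> linarith
    have hθ : 0 < ‖z.1 - z.2‖ := by
      refine lt_of_le_of_ne (norm_nonneg _) fun h => ?_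
      rw [e2, ← h] at h3
      simp at h3
    have := radSq_bounds hn hs hε0 hε hθ (t := ⟪z.1, z.2⟫) (by rw [← e2, chordSq])
      (hmem _ h1) (hmem _ h2) (by rw [add_sub_add_left_eq_sub]; exact huL _ _ h1 h2)
    rwa [add_sub_add_left_eq_sub, ← e3] at this
  exact ⟨lintegral_mono_ae (hb.mono fun z hz => hz.1), lintegral_mono_ae (hb.mono fun z hz => hz.2)⟩

lemma ballΦ_toReal {s : ℝ} (hn : 2 ≤ n) (hs : s ∈ Ioo (0 : ℝ) 1) {e : V n} (he : ‖e‖ = 1) :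
    ballΦ n s e ≠ ∞ ∧ s * ((n : ℝ) - s) * (ballΦ n s e).toReal = lamOne n s e := by
  have hN : (2 : ℝ) ≤ n := by exact_mod_cast hn
  have hp : 0 < s * ((n : ℝ) - s) := mul_pos hs.1 (by linarith [hs.2])
  have h := ballΦ_lamOne hn hs he
  constructor
  · intro h'
    rw [h', ENNReal.mul_top (by simpa using hp)] at h
    exact ENNReal.ofReal_ne_top h.symm
  · have := congrArg ENNReal.toReal h
    rwa [ENNReal.toReal_mul, ENNReal.toReal_ofReal hp.le,
      ENNReal.toReal_ofReal (lamOne_pos hn hs he).le] at this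

lemma fracPer_ball_toReal {s : ℝ} (hn : 2 ≤ n) {e : V n} (he : ‖e‖ = 1) :
    (fracPer n s (ball (0 : V n) 1)).toReal = (ballΦ n s e).toReal * (sph n).real univ := by
  rw [fracPer_ball (by omega) s he, ENNReal.toReal_mul, measureReal_def]

theorem fracPer_sub_ge (hn : 2 ≤ n) {ε s : ℝ} (hs : s ∈ Ioo (0 : ℝ) 1) {e : V n}
    (he : ‖e‖ = 1) (hε : 5 * n * ε ≤ 1) (hu : ∀ x, ‖x‖ = 1 → |u x| ≤ ε)
    (huL : ∀ x y, ‖x‖ = 1 → ‖y‖ = 1 → |u x - u y| ≤ ε * ‖x - y‖) {E : Set (V n)}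
    (hE : MeasurableSet E) (hEU : IsStar E fun x => 1 + u x)
    (hvol : ∫ x, ((1 + u x) ^ n - 1) ∂sph n = 0) :
    (1 / 2) * ((1 - 5 * n * ε) * gag n s u
        - (1 + 2 ^ n * ε) * lamOne n s e * ∫ x, u x ^ 2 ∂sph n)
      ≤ (fracPer n s E).toReal - (fracPer n s (ball (0 : V n) 1)).toReal := by
  have hN : (2 : ℝ) ≤ n := by exact_mod_cast hn
  have hε0 : 0 ≤ ε := (abs_nonneg _).trans (hu e he)
  have hε2 : ε ≤ 1 / 2 := by nlinarith
  have hU : ∀ x, ‖x‖ = 1 → 0 < 1 + u x := fun x hx => by linarith [abs_le.1 (hu x hx)]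
  have hP := two_mul_fracPer (by omega) s hE hEU (by fun_prop) hU he
  obtain ⟨hA1, hA2⟩ := lintegral_radSq_bounds hn hs he hε hu huL
  obtain ⟨hΦ, hφ⟩ := ballΦ_toReal hn hs he
  set A := ∫⁻ x, ∫⁻ y, radSq n s ⟪x, y⟫ (1 + u x) (1 + u y) ∂sph n ∂sph n
  have hAt : A ≠ ∞ := ne_top_of_le_ne_top ENNReal.ofReal_ne_top hA2
  have hAr : (1 - 5 * n * ε) * gag n s u ≤ A.toReal := (ENNReal.ofReal_le_iff_le_toReal hAt).1 hA1
  have hJi : Integrable (fun x => (1 + u x) ^ ((n : ℝ) - s)) (sph n) :=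
    integrable_sph_of_continuousOn (ContinuousOn.rpow_const (by fun_prop) fun x hx =>
      Or.inl (hU x (mem_sphere_zero_iff_norm.1 hx)).ne')
  have hJ0 : 0 ≤ᵐ[sph n] fun x => (1 + u x) ^ ((n : ℝ) - s) := by
    filter_upwards [sph_ae_norm n] with x hx using Real.rpow_nonneg (hU x hx).le _
  rw [← ofReal_integral_eq_lintegral_ofReal hJi hJ0] at hP
  set J := ∫ x, (1 + u x) ^ ((n : ℝ) - s) ∂sph n with hJ
  have hJnn : 0 ≤ J := integral_nonneg_of_ae hJ0
  have hPr := congrArg ENNReal.toReal hP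
  rw [ENNReal.toReal_mul, ENNReal.toReal_add hAt
    (ENNReal.mul_ne_top (by simp) (ENNReal.mul_ne_top hΦ ENNReal.ofReal_ne_top)),
    ENNReal.toReal_mul, ENNReal.toReal_mul, ENNReal.toReal_ofReal hJnn] at hPr
  simp only [ENNReal.toReal_ofNat] at hPr
  rw [fracPer_ball_toReal hn he]
  set φ := (ballΦ n s e).toReal
  have hφ0 : 0 ≤ φ := ENNReal.toReal_nonneg
  set W := ∫ x, u x ^ 2 ∂sph n with hW
  have hJW : -(s * ((n : ℝ) - s) / 2 * (1 + 2 ^ n * ε) * W) ≤ J - (sph n).real univ := by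
    have e1 : J - (sph n).real univ = ∫ x, ((1 + u x) ^ ((n : ℝ) - s) - 1
        - (((n : ℝ) - s) / n) * ((1 + u x) ^ n - 1)) ∂sph n := by
      rw [integral_sub (by exact hJi.sub (integrable_const _))
        (integrable_sph_of_continuous (by fun_prop)), integral_sub hJi (integrable_const _),
        integral_const_mul, hvol, integral_const, smul_eq_mul]
      ring
    rw [e1, hW, ← integral_const_mul, ← integral_neg]
    refine integral_mono_ae (integrable_sph_of_continuous (by fun_prop))
      (by exact (hJi.sub (integrable_const _)).sub (integrable_sph_of_continuous (by fun_prop))) ?_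
    filter_upwards [sph_ae_norm n] with x hx using profile_ge hn hs hε2 (hu x hx)
  have h1 := mul_le_mul_of_nonneg_left hJW hφ0
  have h2 : φ * -(s * ((n : ℝ) - s) / 2 * (1 + 2 ^ n * ε) * W)
      = -(1 / 2) * ((1 + 2 ^ n * ε) * lamOne n s e * W) := by
    rw [← hφ]
    ring
  rw [h2] at h1
  linarith

/-- The fractional isoperimetric deficit of a nearly spherical set controls the Gagliardo
seminorm of its radial profile. -/
theorem fracPer_sub_ge_gag (hn : 2 ≤ n) {ε s : ℝ} (hs : s ∈ Ioo (0 : ℝ) 1) {e : V n}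
    (he : ‖e‖ = 1) (hε : 120 * (n : ℝ) ^ 3 * 2 ^ (n + 1) * ε ≤ 1)
    (hu : ∀ x, ‖x‖ = 1 → |u x| ≤ ε)
    (huL : ∀ x y, ‖x‖ = 1 → ‖y‖ = 1 → |u x - u y| ≤ ε * ‖x - y‖) {E : Set (V n)}
    (hE : MeasurableSet E) (hEU : IsStar E fun x => 1 + u x)
    (hvol : ∫ x, ((1 + u x) ^ n - 1) ∂sph n = 0)
    (hbar : ∀ w : V n, ∫ x, ⟪w, x⟫ * (1 + u x) ^ (n + 1) ∂sph n = 0) :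
    1 / (240 * (n : ℝ) ^ 2) * gag n s u
        ≤ (fracPer n s E).toReal - (fracPer n s (ball (0 : V n) 1)).toReal ∧
      lamOne n s e * ∫ x, u x ^ 2 ∂sph n ≤ gag n s u := by
  have hN : (2 : ℝ) ≤ n := by exact_mod_cast hn
  have hε0 : 0 ≤ ε := (abs_nonneg _).trans (hu e he)
  have hgap := nearly_spherical_gap hn hs he hε hu huL hvol hbar
  have hl := lamOne_pos hn hs he
  have hW0 : 0 ≤ ∫ x, u x ^ 2 ∂sph n := integral_nonneg fun x => sq_nonneg _
  have hn2 : (4 : ℝ) ≤ n ^ 2 := by nlinarith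
  have hq : (4 : ℝ) ≤ 2 ^ n := by
    calc (4 : ℝ) = 2 ^ 2 := by norm_num
      _ ≤ 2 ^ n := pow_le_pow_right₀ (by norm_num) hn
  have hp : (0 : ℝ) < 15 * n ^ 2 := by positivity
  set κ : ℝ := 1 / (15 * (n : ℝ) ^ 2) with hκ
  have hκ0 : 0 < κ := by positivity
  have hκ1 : κ ≤ 1 / 60 := by
    rw [hκ]
    exact one_div_le_one_div_of_le (by norm_num) (by linarith)
  have h1 : 5 * n * ε ≤ κ / 12 := by
    rw [hκ, div_div, le_div_iff₀ (by positivity)]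
    refine le_trans ?_ hε
    rw [pow_succ (2 : ℝ) n]
    have h0 : 0 ≤ (n : ℝ) ^ 3 * ε := by positivity
    have := mul_nonneg h0 (sub_nonneg.2 hq)
    linarith
  have h2 : 2 ^ n * ε ≤ κ / 32 := by
    rw [hκ, div_div, le_div_iff₀ (by positivity)]
    refine le_trans ?_ hε
    rw [pow_succ (2 : ℝ) n]
    have : 0 ≤ (n : ℝ) ^ 2 * 2 ^ n * ε * (n - 2) := mul_nonneg (by positivity) (by linarith)
    linarith
  have hmain := fracPer_sub_ge hn hs he (by linarith) hu huL hE hEU hvol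
  rw [show (1 : ℝ) / (30 * (n : ℝ) ^ 2) = κ / 2 by rw [hκ]; field_simp; norm_num] at hgap
  rw [show (1 : ℝ) / (240 * (n : ℝ) ^ 2) = κ / 16 by rw [hκ]; field_simp; norm_num]
  set G := gag n s u
  set W := ∫ x, u x ^ 2 ∂sph n
  set Λ := lamOne n s e * W with hΛ
  have hΛ0 : 0 ≤ Λ := by positivity
  rw [mul_assoc] at hgap
  rw [mul_assoc (1 + 2 ^ n * ε)] at hmain
  rw [← hΛ] at hgap hmain
  have hG : Λ ≤ G := by nlinarith
  refine ⟨?_, hG⟩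
  have hG0 : 0 ≤ G := hΛ0.trans hG
  refine le_trans ?_ hmain
  have h3 : (1 - κ / 12) * G ≤ (1 - 5 * n * ε) * G :=
    mul_le_mul_of_nonneg_right (by linarith) hG0
  have h4 : (1 + 2 ^ n * ε) * Λ ≤ (1 + κ / 32) * Λ := mul_le_mul_of_nonneg_right (by linarith) hΛ0
  have h5 : (1 + κ / 32) * Λ ≤ (1 - 5 / 16 * κ) * G := by
    have e1 : 1 + κ / 32 ≤ (1 - 5 / 16 * κ) * (1 + κ / 2) := by nlinarith
    calc (1 + κ / 32) * Λ ≤ ((1 - 5 / 16 * κ) * (1 + κ / 2)) * Λ :=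
          mul_le_mul_of_nonneg_right e1 hΛ0
      _ = (1 - 5 / 16 * κ) * ((1 + κ / 2) * Λ) := by ring
      _ ≤ _ := mul_le_mul_of_nonneg_left hgap (by linarith)
  have h6 : 0 ≤ κ * G := by positivity
  linarith

end

lemma integral_le_mul_of_le_smul {α : Type*} [MeasurableSpace α] {μ ν : Measure α} {K : ℝ≥0∞}
    (hK : K ≠ ∞) (h : ν ≤ K • μ) {f : α → ℝ} (hf : Integrable f μ) (hf0 : 0 ≤ᵐ[μ] f) :
    ∫ x, f x ∂ν ≤ K.toReal * ∫ x, f x ∂μ := by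
  rw [← smul_eq_mul, ← integral_smul_measure]
  exact integral_mono_measure h (Measure.ae_smul_measure hf0 K) (hf.smul_measure hK)

/-- The Gagliardo seminorm with respect to a measure dominated by the surface measure. -/
lemma integral_integral_le_gag {n : ℕ} (hn : 2 ≤ n) {s C : ℝ} (hs : s ∈ Ioo (0 : ℝ) 1) {e : V n}
    (he : ‖e‖ = 1) {v : V n → ℝ} (hvc : Continuous v)
    (hv : ∀ x y, ‖x‖ = 1 → ‖y‖ = 1 → |v x - v y| ≤ C * ‖x - y‖)
    {ν : Measure (V n)} {K : ℝ≥0∞} (hK : K ≠ ∞) (hν : ν ≤ K • sph n) :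
    ∫ x, ∫ y, (v x - v y) ^ 2 / ‖x - y‖ ^ ((n : ℝ) + s) ∂ν ∂ν ≤ K.toReal ^ 2 * gag n s v := by
  have hac : ν ≪ sph n := (Measure.absolutelyContinuous_of_le hν).trans
    Measure.smul_absolutelyContinuous
  have hnorm : ∀ᵐ x ∂ν, ‖x‖ = 1 := hac.ae_le (sph_ae_norm n)
  set F : V n × V n → ℝ := fun z => (v z.1 - v z.2) ^ 2 * chordSq z ^ (-(((n : ℝ) + s) / 2))
    with hF
  have hFi : Integrable F ((sph n).prod (sph n)) := integrable_gag hn hs he hvc hv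
  have hF0 : ∀ x y : V n, ‖x‖ = 1 → ‖y‖ = 1 → 0 ≤ F (x, y) := fun x y hx hy => by
    have := chordSq_eq hx hy
    simp only [hF]
    rw [this]
    positivity
  have hsec : ∀ x : V n, ‖x‖ = 1 → Integrable (fun y => F (x, y)) (sph n) := by
    intro x hx
    refine Integrable.mono' ((integrable_two_sub hn hs hx).const_mul (C ^ 2))
      (((by fun_prop : Continuous fun z : V n × V n => (v z.1 - v z.2) ^ 2).measurable.mul
      (measurable_chordSq_rpow _)).comp measurable_prodMk_left).aestronglyMeasurable ?_
    filter_upwards [sph_ae_norm n, ae_inner_lt_one hn hx] with y hy hxy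
    rw [Real.norm_of_nonneg (hF0 x y hx hy)]
    exact sq_mul_chordSq_le (z := (x, y)) hv hx hy (by simp only [chordSq]; linarith)
  have hG0 : 0 ≤ᵐ[sph n] fun x => ∫ y, F (x, y) ∂sph n := by
    filter_upwards [sph_ae_norm n] with x hx
    refine integral_nonneg_of_ae ?_
    filter_upwards [sph_ae_norm n] with y hy using hF0 x y hx hy
  have hGi := hFi.integral_prod_left
  have heq : ∫ x, ∫ y, (v x - v y) ^ 2 / ‖x - y‖ ^ ((n : ℝ) + s) ∂ν ∂ν
      = ∫ x, ∫ y, F (x, y) ∂ν ∂ν := by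
    refine integral_congr_ae ?_
    filter_upwards [hnorm] with x hx
    refine integral_congr_ae ?_
    filter_upwards [hnorm] with y hy
    simp only [hF]
    rw [chordSq_rpow_eq s hx hy, Real.rpow_neg (norm_nonneg _), div_eq_mul_inv]
  have h_dom : ∫ x, ∫ y, F (x, y) ∂ν ∂ν ≤ ∫ x, K.toReal * ∫ y, F (x, y) ∂sph n ∂ν := by
    refine integral_mono_of_nonneg ?_ ?_ ?_
    · filter_upwards [hnorm] with x hx
      refine integral_nonneg_of_ae ?_
      filter_upwards [hnorm] with y hy using hF0 x y hx hy
    · exact ((hGi.smul_measure hK).mono_measure hν).const_mul _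
    · filter_upwards [hnorm] with x hx
      refine integral_le_mul_of_le_smul hK hν (hsec x hx) ?_
      filter_upwards [sph_ae_norm n] with y hy using hF0 x y hx hy
  rw [heq]
  refine h_dom.trans ?_
  rw [integral_const_mul, pow_two, mul_assoc, gag, integral_prod _ hFi]
  exact mul_le_mul_of_nonneg_left (integral_le_mul_of_le_smul hK hν hGi hG0)
    ENNReal.toReal_nonneg

/-- The fractional Fuglede inequality with surface integrals taken with respect to a measure
dominated by the surface measure. -/
theorem fuglede_of_le_smul {n : ℕ} (hn : 2 ≤ n) {ν : Measure (V n)} {K : ℝ≥0∞} (hK : K ≠ ∞)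
    (hν : ν ≤ K • sph n) {ε s : ℝ} (hs : s ∈ Ioo (0 : ℝ) 1)
    (hε : 120 * (n : ℝ) ^ 3 * 2 ^ (n + 1) * ε ≤ 1) {u : C(V n, ℝ)}
    (hu : ∀ x, ‖x‖ = 1 → |u x| ≤ ε)
    (huL : ∀ x y, ‖x‖ = 1 → ‖y‖ = 1 → |u x - u y| ≤ ε * ‖x - y‖) {E : Set (V n)}
    (hE : MeasurableSet E) (hEU : IsStar E fun x => 1 + u x)
    (hvol : ∫ x, ((1 + u x) ^ n - 1) ∂sph n = 0)
    (hbar : ∀ w : V n, ∫ x, ⟪w, x⟫ * (1 + u x) ^ (n + 1) ∂sph n = 0) :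
    1 / (240 * (n : ℝ) ^ 2) / (K.toReal ^ 2 + (sph n).real univ * K.toReal + 1)
        * ((∫ x, ∫ y, (u x - u y) ^ 2 / ‖x - y‖ ^ ((n : ℝ) + s) ∂ν ∂ν)
          + s * (fracPer n s (ball (0 : V n) 1)).toReal * ∫ x, u x ^ 2 ∂ν)
      ≤ (fracPer n s E).toReal - (fracPer n s (ball (0 : V n) 1)).toReal := by
  have he : ‖EuclideanSpace.single (⟨0, by omega⟩ : Fin n) (1 : ℝ)‖ = 1 := by simp
  generalize EuclideanSpace.single (⟨0, by omega⟩ : Fin n) (1 : ℝ) = e at he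
  have hN : (2 : ℝ) ≤ n := by exact_mod_cast hn
  obtain ⟨h1, h2⟩ := fracPer_sub_ge_gag hn hs he hε hu huL hE hEU hvol hbar
  have h3 := integral_integral_le_gag hn hs he u.continuous huL hK hν
  have h4 := integral_le_mul_of_le_smul hK hν
    (integrable_sph_of_continuous (by fun_prop : Continuous fun x => u x ^ 2))
    (Eventually.of_forall fun x => sq_nonneg (u x))
  have hφ := (ballΦ_toReal hn hs he).2
  rw [fracPer_ball_toReal hn he] at h1 ⊢
  set φ := (ballΦ n s e).toReal
  have hφ0 : 0 ≤ φ := ENNReal.toReal_nonneg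
  set ω := (sph n).real univ
  have hω0 : 0 ≤ ω := measureReal_nonneg
  set k := K.toReal
  have hk0 : 0 ≤ k := ENNReal.toReal_nonneg
  set W := ∫ x, u x ^ 2 ∂sph n
  have hW0 : 0 ≤ W := integral_nonneg fun x => sq_nonneg _
  have hG0 : 0 ≤ gag n s u := (mul_nonneg (lamOne_pos hn hs he).le hW0).trans h2
  have hs0 := hs.1
  have h5 : s * φ ≤ lamOne n s e := by
    rw [← hφ]
    have : 0 ≤ s * φ * ((n : ℝ) - s - 1) := mul_nonneg (by positivity) (by linarith [hs.2])
    linarith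
  have h6 : s * (φ * ω) * ∫ x, u x ^ 2 ∂ν ≤ ω * k * gag n s u := by
    calc s * (φ * ω) * ∫ x, u x ^ 2 ∂ν ≤ s * (φ * ω) * (k * W) :=
          mul_le_mul_of_nonneg_left h4 (by positivity)
      _ = ω * k * (s * φ * W) := by ring
      _ ≤ ω * k * gag n s u := mul_le_mul_of_nonneg_left
          ((mul_le_mul_of_nonneg_right h5 hW0).trans h2) (by positivity)
  refine le_trans ?_ h1
  rw [div_mul_eq_mul_div, div_le_iff₀ (by positivity), mul_assoc _ (gag n s u)]
  refine mul_le_mul_of_nonneg_left ?_ (by positivity)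
  linarith

end FracFuglede

/-- **Fractional Fuglede-type inequality for nearly spherical sets.**
There are `ε₀ ∈ (0,1/2)` and `c₀ > 0`, depending only on `n ≥ 2`, such that: if `E ⊆ ℝⁿ` is
open and bounded with `|E| = |B|`, barycenter at the origin, and boundary
`∂E = {(1 + u(x)) x : x ∈ ∂B}` for a Lipschitz function `u` with
`‖u‖_{W^{1,∞}(∂B)} = ‖u‖_{L^∞(∂B)} + ‖∇u‖_{L^∞(∂B)} < ε₀` (the gradient bound being encoded by
the Lipschitz constant `L` of `u` on the sphere), then for every `s ∈ (0,1)`,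
`P_s(E) - P_s(B) ≥ c₀ ([u]²_{(1+s)/2} + s P_s(B) ‖u‖²_{L²(∂B)})`, the surface integrals being
taken with respect to the `(n-1)`-dimensional Hausdorff measure on the unit sphere. -/
theorem fractional_fuglede
    (n : ℕ) (hn : 2 ≤ n) :
    ∃ ε₀ ∈ Set.Ioo (0 : ℝ) (1 / 2), ∃ c₀ : ℝ, 0 < c₀ ∧
      ∀ (E : Set (EuclideanSpace ℝ (Fin n))) (u : EuclideanSpace ℝ (Fin n) → ℝ)
        (M : ℝ) (L : NNReal),
        IsOpen E → IsBounded E →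
        volume E = volume (ball (0 : EuclideanSpace ℝ (Fin n)) 1) →
        barycenter n E = 0 →
        frontier E = (fun x => (1 + u x) • x) '' sphere (0 : EuclideanSpace ℝ (Fin n)) 1 →
        LipschitzOnWith L u (sphere (0 : EuclideanSpace ℝ (Fin n)) 1) →
        (∀ x ∈ sphere (0 : EuclideanSpace ℝ (Fin n)) 1, |u x| ≤ M) →
        M + (L : ℝ) < ε₀ →
        ∀ s ∈ Set.Ioo (0 : ℝ) 1,
          c₀ * ((∫ x in sphere (0 : EuclideanSpace ℝ (Fin n)) 1,
                  ∫ y in sphere (0 : EuclideanSpace ℝ (Fin n)) 1,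
                    (u x - u y) ^ 2 / ‖x - y‖ ^ ((n : ℝ) + s)
                  ∂(μH[(n : ℝ) - 1]) ∂(μH[(n : ℝ) - 1]))
              + s * (fracPer n s (ball (0 : EuclideanSpace ℝ (Fin n)) 1)).toReal
                  * ∫ x in sphere (0 : EuclideanSpace ℝ (Fin n)) 1, (u x) ^ 2
                      ∂(μH[(n : ℝ) - 1]))
            ≤ (fracPer n s E).toReal
              - (fracPer n s (ball (0 : EuclideanSpace ℝ (Fin n)) 1)).toReal := by
  have hN : (2 : ℝ) ≤ n := by exact_mod_cast hn
  have hp : (480 : ℝ) ≤ 120 * (n : ℝ) ^ 3 * 2 ^ (n + 1) := by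
    have h1 : (2 : ℝ) ^ 3 ≤ (n : ℝ) ^ 3 := pow_le_pow_left₀ (by norm_num) hN 3
    have h2 : (1 : ℝ) ≤ 2 ^ (n + 1) := one_le_pow₀ (by norm_num)
    nlinarith
  have hp0 : (0 : ℝ) < 120 * (n : ℝ) ^ 3 * 2 ^ (n + 1) := by linarith
  obtain ⟨K, hK, hν⟩ := FracFuglede.hausdorff_le_sph (n := n) (by omega)
  refine ⟨1 / (120 * (n : ℝ) ^ 3 * 2 ^ (n + 1)), ⟨by positivity,
    one_div_lt_one_div_of_lt (by norm_num) (by linarith)⟩,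
    1 / (240 * (n : ℝ) ^ 2) / (K.toReal ^ 2 + (FracFuglede.sph n).real Set.univ * K.toReal + 1),
    by positivity, ?_⟩
  intro E u M L hE hb hvol hbar hfr hL hM hML s hs
  obtain ⟨g, hgL, hgu⟩ := hL.extend_real
  have hmem : ∀ {x : EuclideanSpace ℝ (Fin n)}, ‖x‖ = 1 → x ∈ sphere 0 1 := by simp
  have hL0 : (0 : ℝ) ≤ L := L.2
  have hg : ∀ x, ‖x‖ = 1 → |g x| ≤ M + L := fun x hx => by
    rw [← hgu (hmem hx)]
    linarith [hM x (hmem hx)]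
  have hM0 : 0 ≤ M := by
    have h := hM (EuclideanSpace.single (⟨0, by omega⟩ : Fin n) (1 : ℝ)) (by simp)
    exact (abs_nonneg _).trans h
  have hgl : ∀ x y, ‖x‖ = 1 → ‖y‖ = 1 → |g x - g y| ≤ (M + L) * ‖x - y‖ := fun x y _ _ => by
    have h := hgL.dist_le_mul x y
    rw [Real.dist_eq, dist_eq_norm] at h
    exact h.trans (mul_le_mul_of_nonneg_right (by linarith) (norm_nonneg _))
  have hsmall : 120 * (n : ℝ) ^ 3 * 2 ^ (n + 1) * (M + L) ≤ 1 := by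
    rw [lt_div_iff₀ hp0] at hML
    linarith
  have hone : M + L < 1 := hML.trans (by rw [div_lt_one hp0]; linarith)
  have hn0 : Nonempty (Fin n) := ⟨⟨0, by omega⟩⟩
  have hvpos : volume E ≠ 0 := by
    rw [hvol]
    exact (measure_ball_pos _ _ one_pos).ne'
  have hvfin : volume E ≠ ∞ := by
    rw [hvol]
    exact measure_ball_lt_top.ne
  have hstar : FracFuglede.IsStar E fun x => 1 + g x := fun x hx r hr => by
    beta_reduce
    rw [← hgu (hmem hx)]
    exact FracFuglede.mem_iff_of_frontier hE hb (nonempty_of_measure_ne_zero hvpos) hfr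
      (fun y hy => by linarith [abs_le.1 (hM y hy)]) hx hr
  have hzero : ∫ z in E, z = 0 := by
    have h : ((volume E).toReal)⁻¹ • ∫ z in E, z = 0 := hbar
    exact (smul_eq_zero.1 h).resolve_left (inv_ne_zero (ENNReal.toReal_ne_zero.2 ⟨hvpos, hvfin⟩))
  have hU : ∀ x, ‖x‖ = 1 → 0 < 1 + g x := fun x hx => by linarith [abs_le.1 (hg x hx)]
  have hc : Continuous fun x => 1 + g x := continuous_const.add hgL.continuous
  have key := FracFuglede.fuglede_of_le_smul hn hK hν hs hsmall (u := ⟨g, hgL.continuous⟩) hg hgl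
    hE.measurableSet hstar
    (FracFuglede.integral_radius_pow (by omega) hE.measurableSet hstar hc hU hvol)
    (FracFuglede.integral_radius_moment (by omega) hE.measurableSet hb hstar hc hU hvol hzero)
  simp only [ContinuousMap.coe_mk] at key
  have hms : MeasurableSet (sphere (0 : EuclideanSpace ℝ (Fin n)) 1) :=
    isClosed_sphere.measurableSet
  have e1 : ∫ x in sphere (0 : EuclideanSpace ℝ (Fin n)) 1,
        ∫ y in sphere (0 : EuclideanSpace ℝ (Fin n)) 1,
          (u x - u y) ^ 2 / ‖x - y‖ ^ ((n : ℝ) + s) ∂(μH[(n : ℝ) - 1]) ∂(μH[(n : ℝ) - 1])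
      = ∫ x in sphere (0 : EuclideanSpace ℝ (Fin n)) 1,
        ∫ y in sphere (0 : EuclideanSpace ℝ (Fin n)) 1,
          (g x - g y) ^ 2 / ‖x - y‖ ^ ((n : ℝ) + s) ∂(μH[(n : ℝ) - 1]) ∂(μH[(n : ℝ) - 1]) :=
    setIntegral_congr_fun hms fun x hx => setIntegral_congr_fun hms fun y hy => by
      rw [hgu hx, hgu hy]
  have e2 : ∫ x in sphere (0 : EuclideanSpace ℝ (Fin n)) 1, (u x) ^ 2 ∂(μH[(n : ℝ) - 1])
      = ∫ x in sphere (0 : EuclideanSpace ℝ (Fin n)) 1, (g x) ^ 2 ∂(μH[(n : ℝ) - 1]) :=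
    setIntegral_congr_fun hms fun x hx => by rw [hgu hx]
  rw [e1, e2]
  exact key
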